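/- arXiv:math/0602128 — 11 statements merged into one kernel-verified Lean document; each statement's English description precedes it below -/
import Mathlib

section
/- Let G be a group and let γ, γ'' ∈ G be two commuting elements (γγ'' = γ''γ). Let Γ be the quotient of the free product G ∗ F₂, where F₂ is the free group on two generators a, b, by the normal closure of the three elements aγa⁻¹γ⁻¹, γbγ⁻¹b⁻¹, and aba⁻¹b⁻¹(γ'')⁻¹ (i.e. Γ is obtained from G by adjoining two generators a, b subject to the relations [a,γ] = [γ,b] = 1 and [a,b] = γ''). Then the natural homomorphism G → Γ, given by the inclusion of the free factor G followed by the quotient map, is injective. -/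
/-- Let `G` act on `G × ℤ` by left multiplication on the first factor. The permutations
`(x, n) ↦ (c ^ n * x, n)` and `(x, n) ↦ (x, n + 1)` commute with every element commuting with `c`,
and their commutator is left multiplication by `c`. -/
theorem exists_injective_hom_with_commutator_eq {G : Type*} [Group G] (c : G) :
    ∃ (f : G →* Equiv.Perm (G × ℤ)) (a b : Equiv.Perm (G × ℤ)), Function.Injective f ∧
      (∀ g, g * c = c * g → a * f g = f g * a) ∧ (∀ g, b * f g = f g * b) ∧
      a * b * a⁻¹ * b⁻¹ = f c := by
  let f : G →* Equiv.Perm (G × ℤ) :=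
    { toFun g := (Equiv.mulLeft g).prodCongr (Equiv.refl ℤ)
      map_one' := by ext x <;> simp
      map_mul' g h := by ext x <;> simp [mul_assoc] }
  let a : Equiv.Perm (G × ℤ) :=
    { toFun x := (c ^ x.2 * x.1, x.2)
      invFun x := ((c ^ x.2)⁻¹ * x.1, x.2)
      left_inv x := by simp
      right_inv x := by simp }
  let b : Equiv.Perm (G × ℤ) := (Equiv.refl G).prodCongr (Equiv.addRight 1)
  refine ⟨f, a, b, fun g h hgh => ?_, fun g hg => ?_, fun g => ?_, ?_⟩
  · simpa [f] using congrArg (fun e : Equiv.Perm (G × ℤ) => (e (1, 0)).1) hgh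
  · refine Equiv.ext fun x => Prod.ext ?_ rfl
    have h : c ^ x.2 * g = g * c ^ x.2 := ((show Commute g c from hg).zpow_right x.2).symm
    change c ^ x.2 * (g * x.1) = g * (c ^ x.2 * x.1)
    rw [← mul_assoc, h, mul_assoc]
  · rfl
  · rw [mul_inv_eq_iff_eq_mul, mul_inv_eq_iff_eq_mul]
    refine Equiv.ext fun x => Prod.ext ?_ rfl
    change c ^ (x.2 + 1) * x.1 = c * (c ^ x.2 * x.1)
    rw [add_comm, zpow_add, zpow_one, mul_assoc]


/-- **Zappa's proposition.** Given a group `G` and commuting elements `γ, γ'' ∈ G`, let `Γ`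
be the quotient of the free product `G ∗ F₂` (with `F₂` free on `a`, `b`) by the relations
`[a,γ] = [γ,b] = 1` and `[a,b] = γ''`. Then the natural map `G → Γ` is injective. -/
theorem zappa_injective (G : Type*) [Group G] (γ γ'' : G) (hcomm : γ * γ'' = γ'' * γ) :
    let a : Monoid.Coprod G (FreeGroup (Fin 2)) := Monoid.Coprod.inr (FreeGroup.of 0)
    let b : Monoid.Coprod G (FreeGroup (Fin 2)) := Monoid.Coprod.inr (FreeGroup.of 1)
    let N : Subgroup (Monoid.Coprod G (FreeGroup (Fin 2))) :=
      Subgroup.normalClosure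
        {a * Monoid.Coprod.inl γ * a⁻¹ * (Monoid.Coprod.inl γ)⁻¹,
         Monoid.Coprod.inl γ * b * (Monoid.Coprod.inl γ)⁻¹ * b⁻¹,
         a * b * a⁻¹ * b⁻¹ * (Monoid.Coprod.inl γ'')⁻¹}
    Function.Injective
      ((QuotientGroup.mk' N).comp (Monoid.Coprod.inl : G →* Monoid.Coprod G (FreeGroup (Fin 2)))) := by
  intro a b N
  obtain ⟨f, p, q, hf, hp, hq, hpq⟩ := exists_injective_hom_with_commutator_eq γ''
  let F : Monoid.Coprod G (FreeGroup (Fin 2)) →* Equiv.Perm (G × ℤ) :=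
    Monoid.Coprod.lift f (FreeGroup.lift ![p, q])
  have hF : N ≤ F.ker := by
    refine Subgroup.normalClosure_le_normal ?_
    rintro x (rfl | rfl | rfl)
    · simp [F, a, MonoidHom.mem_ker, hp γ hcomm]
    · simp [F, b, MonoidHom.mem_ker, ← hq γ]
    · simp [F, a, b, MonoidHom.mem_ker, hpq]
  refine Function.Injective.of_comp (f := QuotientGroup.lift N F hF) ?_
  convert hf using 1
  ext1 g
  simp [F]
end

section
/- Let r ≥ 3, let G₁, …, G_r be groups, and for each i let aᵢ ∈ Gᵢ be a nontrivial element. Let Γ be the quotient of the free product G₁ ∗ G₂ ∗ ⋯ ∗ G_r by the normal closure of the single element a₁a₂⋯a_r. Then the natural homomorphism G₁ → Γ is injective. -/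
universe u

/-- Every natural number is the order of some nonzero complex number. -/
theorem Complex.exists_orderOf_eq (n : ℕ) : ∃ z : ℂ, z ≠ 0 ∧ orderOf z = n := by
  rcases eq_or_ne n 0 with rfl | hn
  · refine ⟨2, two_ne_zero, orderOf_eq_zero_iff'.2 fun k hk h => ?_⟩
    have h2 : (2 : ℕ) ^ k = 1 := by exact_mod_cast h
    exact absurd h2 (Nat.one_lt_two_pow hk.ne').ne'
  · exact ⟨_, Complex.exp_ne_zero _, (Complex.isPrimitiveRoot_exp n hn).eq_orderOf.symm⟩

/-- Powers of an element annihilated by `(X - μ) (X - ν)`. -/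
theorem sub_smul_pow_of_mul_eq_zero {K R : Type*} [Field K] [Ring R] [Algebra K R]
    {M : R} {μ ν : K} (h : (M - algebraMap K R μ) * (M - algebraMap K R ν) = 0) (k : ℕ) :
    (μ - ν) • M ^ k = μ ^ k • (M - algebraMap K R ν) - ν ^ k • (M - algebraMap K R μ) := by
  simp only [Algebra.algebraMap_eq_smul_one] at *
  have hM : M * M = (μ + ν) • M - (μ * ν) • (1 : R) := by
    simp only [sub_mul, mul_sub, smul_mul_assoc, mul_smul_comm, one_mul, mul_one] at h
    rw [← sub_eq_zero, ← h]
    module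
  induction k with
  | zero => simp only [pow_zero]; module
  | succ k ih =>
    rw [pow_succ, ← smul_mul_assoc, ih]
    simp only [sub_mul, smul_mul_assoc, one_mul, hM]
    module

/-- Modulo the centre, the order of a non-central unit with two distinct eigenvalues is the order
of the ratio of the eigenvalues. -/
theorem orderOf_mk_center_of_mul_eq_zero {K R : Type*} [Field K] [Ring R] [Algebra K R]
    (M N : Rˣ) {μ γ : K} (hμ : μ ≠ 0) (hγ : γ ≠ 1)
    (h : ((M : R) - algebraMap K R (γ * μ)) * (M - algebraMap K R μ) = 0)
    (hN : (M : R) * N ≠ N * M) :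
    orderOf (M : Rˣ ⧸ Subgroup.center Rˣ) = orderOf γ := by
  have hd : γ * μ - μ ≠ 0 := by
    rw [← sub_one_mul]
    exact mul_ne_zero (sub_ne_zero.2 hγ) hμ
  rw [orderOf_eq_orderOf_iff]
  intro k
  have hk := sub_smul_pow_of_mul_eq_zero h k
  rw [← QuotientGroup.mk_pow, QuotientGroup.eq_one_iff, Subgroup.mem_center_iff]
  simp only [Algebra.algebraMap_eq_smul_one] at hk
  constructor
  · intro hc
    have hc' : (N : R) * (M : R) ^ k = (M : R) ^ k * N := by
      exact_mod_cast congrArg Units.val (hc N)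
    have h0 : ((γ * μ) ^ k - μ ^ k) • ((M : R) * N - N * M) = 0 := by
      have h1 : (γ * μ - μ) • ((M : R) ^ k * N) - (γ * μ - μ) • ((N : R) * (M : R) ^ k) = 0 := by
        rw [hc', sub_self]
      rw [← smul_mul_assoc, ← mul_smul_comm, hk] at h1
      rw [← h1]
      simp only [sub_mul, mul_sub, smul_mul_assoc, mul_smul_comm, one_mul, mul_one]
      module
    rcases smul_eq_zero.1 h0 with h0 | h0
    · rw [mul_pow, sub_eq_zero] at h0
      exact mul_eq_right₀ (pow_ne_zero k hμ) |>.1 h0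
    · exact absurd (sub_eq_zero.1 h0) hN
  · intro hγk g
    have hs : (M : R) ^ k = algebraMap K R (μ ^ k) := by
      rw [mul_pow, hγk, one_mul] at hk
      rw [Algebra.algebraMap_eq_smul_one]
      refine smul_right_injective R hd ?_
      simp only [hk]
      module
    ext
    push_cast
    rw [hs, Algebra.commutes]

/-- There are two elements of a group that, together with their product, have any prescribed
orders other than `1`. -/
theorem exists_orderOf_mul_eq (l m n : ℕ) (hl : l ≠ 1) (hm : m ≠ 1) (hn : n ≠ 1) :
    ∃ (K : Type) (_ : Group K) (x y : K),
      orderOf x = l ∧ orderOf y = m ∧ orderOf (x * y) = n := by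
  obtain ⟨α, hα, rfl⟩ := Complex.exists_orderOf_eq l
  obtain ⟨β, hβ, rfl⟩ := Complex.exists_orderOf_eq m
  obtain ⟨γ, hγ, rfl⟩ := Complex.exists_orderOf_eq n
  rw [Ne, orderOf_eq_one_iff] at hl hm hn
  obtain ⟨μ, hμ⟩ := IsAlgClosed.exists_pow_nat_eq (α * β / γ) two_pos
  have hμ0 : μ ≠ 0 := by
    rintro rfl
    simp [hα, hβ, hγ, eq_comm] at hμ
  have hμ' : μ * μ * γ = α * β := by
    rw [← sq, hμ, div_mul_cancel₀ _ hγ]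
  let x : GL (Fin 2) ℂ := Matrix.GeneralLinearGroup.mkOfDetNeZero !![α, 1; 0, 1] (by simpa)
  let y : GL (Fin 2) ℂ := Matrix.GeneralLinearGroup.mkOfDetNeZero
    !![β, 0; μ * (1 + γ) - α * β - 1, 1] (by simpa)
  have hx : (x : Matrix (Fin 2) (Fin 2) ℂ) = !![α, 1; 0, 1] := rfl
  have hy : (y : Matrix (Fin 2) (Fin 2) ℂ) = !![β, 0; μ * (1 + γ) - α * β - 1, 1] := rfl
  have hxy : (x : Matrix (Fin 2) (Fin 2) ℂ) * y ≠ y * x := by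
    rw [hx, hy, Matrix.mul_fin_two, Matrix.mul_fin_two]
    intro h
    have := congrFun (congrFun h 0) 1
    simp at this
    exact hm this.symm
  refine ⟨GL (Fin 2) ℂ ⧸ Subgroup.center (GL (Fin 2) ℂ), inferInstance, x, y, ?_, ?_, ?_⟩
  · refine orderOf_mk_center_of_mul_eq_zero x y one_ne_zero hl ?_ hxy
    ext i j
    fin_cases i <;> fin_cases j <;> simp [hx, Matrix.mul_apply, Matrix.algebraMap_matrix_apply]
  · refine orderOf_mk_center_of_mul_eq_zero y x one_ne_zero hm ?_ hxy.symm
    ext i j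
    fin_cases i <;> fin_cases j <;> simp [hy, Matrix.mul_apply, Matrix.algebraMap_matrix_apply]
    ring
  · rw [← QuotientGroup.mk_mul]
    refine orderOf_mk_center_of_mul_eq_zero (x * y) y hμ0 hn ?_ ?_
    · ext i j
      fin_cases i <;> fin_cases j <;>
        simp [hx, hy, Matrix.mul_apply, Matrix.algebraMap_matrix_apply] <;>
        grind
    · rw [Units.val_mul, ← mul_assoc]
      exact fun h => hxy (y.isUnit.mul_left_injective h)

/-- Two groups embed in a common group in which two given elements of equal order coincide. -/
theorem exists_amalgam {A B : Type u} [Group A] [Group B] {a : A} {b : B}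
    (h : orderOf a = orderOf b) :
    ∃ (L : Type u) (_ : Group L) (f : A →* L) (g : B →* L),
      Function.Injective f ∧ Function.Injective g ∧ f a = g b := by
  let G : Bool → Type u := fun t => cond t A B
  let _ : ∀ t, Group (G t) := fun t => match t with
    | true => ‹Group A›
    | false => ‹Group B›
  let e : Subgroup.zpowers a ≃* Subgroup.zpowers b :=
    mulEquivOfOrderOfEq (g := ⟨a, Subgroup.mem_zpowers a⟩) (g' := ⟨b, Subgroup.mem_zpowers b⟩)
      (fun ⟨_, k, hk⟩ => ⟨k, Subtype.ext hk⟩) (fun ⟨_, k, hk⟩ => ⟨k, Subtype.ext hk⟩)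
      (by simpa using h)
  let φ : ∀ t, Subgroup.zpowers a →* G t := fun t => match t with
    | true => (Subgroup.zpowers a).subtype
    | false => (Subgroup.zpowers b).subtype.comp e.toMonoidHom
  have hφ : ∀ t, Function.Injective (φ t) := fun t => match t with
    | true => Subtype.val_injective
    | false => Subtype.val_injective.comp e.injective
  refine ⟨Monoid.PushoutI φ, inferInstance, Monoid.PushoutI.of (φ := φ) true,
    Monoid.PushoutI.of (φ := φ) false, Monoid.PushoutI.of_injective hφ true,
    Monoid.PushoutI.of_injective hφ false, ?_⟩
  have ha := Monoid.PushoutI.of_apply_eq_base φ true ⟨a, Subgroup.mem_zpowers a⟩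
  have hb := Monoid.PushoutI.of_apply_eq_base φ false ⟨a, Subgroup.mem_zpowers a⟩
  have he' : e ⟨a, Subgroup.mem_zpowers a⟩ = ⟨b, Subgroup.mem_zpowers b⟩ :=
    mulEquivOfOrderOfEq_apply_gen ..
  have he : φ false ⟨a, Subgroup.mem_zpowers a⟩ = b :=
    congrArg Subtype.val he'
  rw [he] at hb
  exact ha.trans hb.symm

/-- Two groups map to a common group in such a way that the product of two given nontrivial
elements acquires any prescribed order other than `1`. -/
theorem exists_monoidHom_orderOf_mul_eq {A B : Type u} [Group A] [Group B] {a : A} {b : B}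
    (ha : a ≠ 1) (hb : b ≠ 1) {n : ℕ} (hn : n ≠ 1) :
    ∃ (L : Type u) (_ : Group L) (f : A →* L) (g : B →* L), orderOf (f a * g b) = n := by
  obtain ⟨K, _, x, y, hx, hy, hxy⟩ := exists_orderOf_mul_eq (orderOf a) (orderOf b) n
    (by rwa [Ne, orderOf_eq_one_iff]) (by rwa [Ne, orderOf_eq_one_iff]) hn
  let i : K →* ULift.{u} K := MulEquiv.ulift.symm.toMonoidHom
  have hi : Function.Injective i := MulEquiv.ulift.symm.injective
  obtain ⟨L, _, f, g, -, hg, hfg⟩ := exists_amalgam (a := a) (b := i x)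
    (by rw [orderOf_injective i hi, hx])
  obtain ⟨L', _, f', g', -, hg', hfg'⟩ := exists_amalgam (a := b) (b := g (i y))
    (by rw [orderOf_injective g hg, orderOf_injective i hi, hy])
  refine ⟨L', inferInstance, g'.comp f, f', ?_⟩
  rw [MonoidHom.comp_apply, hfg, hfg', ← map_mul, ← map_mul, orderOf_injective g' hg',
    orderOf_injective g hg, ← map_mul, orderOf_injective i hi, hxy]

/-- At least two groups map to a common group in such a way that the product of given nontrivial
elements acquires any prescribed order other than `1`. -/
theorem exists_monoidHom_orderOf_prod_eq (k : ℕ) (G : Fin (k + 2) → Type u) [∀ i, Group (G i)]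
    (a : ∀ i, G i) (ha : ∀ i, a i ≠ 1) {n : ℕ} (hn : n ≠ 1) :
    ∃ (L : Type u) (_ : Group L) (f : ∀ i, G i →* L),
      orderOf (List.ofFn fun i => f i (a i)).prod = n := by
  induction k generalizing n with
  | zero =>
    obtain ⟨L, _, f, g, h⟩ := exists_monoidHom_orderOf_mul_eq (ha 0) (ha 1) hn
    refine ⟨L, inferInstance, Fin.cons f (Fin.cons g finZeroElim), ?_⟩
    simpa using h
  | succ k ih =>
    obtain ⟨L, _, f, h⟩ := ih (fun i => G i.succ) (fun i => a i.succ) (fun i => ha i.succ)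
      zero_ne_one
    have hb : (List.ofFn fun i => f i (a i.succ)).prod ≠ 1 := by
      intro h1
      rw [h1, orderOf_one] at h
      exact one_ne_zero h
    obtain ⟨L', _, f', g', h'⟩ := exists_monoidHom_orderOf_mul_eq (ha 0) hb hn
    refine ⟨L', inferInstance, Fin.cons f' fun i => g'.comp (f i), ?_⟩
    rw [map_list_prod, List.map_ofFn] at h'
    simpa [List.ofFn_succ (n := k + 2), Function.comp_def] using h'

/-- Let `r ≥ 3`, let `G₁, …, G_r` be groups, each with a nontrivial element `aᵢ`. Then in
the quotient `Γ` of the free product `G₁ ∗ ⋯ ∗ G_r` by the normal closure of `a₁a₂⋯a_r`,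
the natural homomorphism `G₁ → Γ` is injective. -/
theorem freeProduct_r_factors_injective (r : ℕ) (hr : 3 ≤ r)
    (G : Fin r → Type*) [∀ i, Group (G i)] (a : ∀ i, G i) (ha : ∀ i, a i ≠ 1) :
    let N : Subgroup (Monoid.CoprodI G) :=
      Subgroup.normalClosure {(List.ofFn fun i : Fin r => Monoid.CoprodI.of (a i)).prod}
    Function.Injective
      ((QuotientGroup.mk' N).comp
        (Monoid.CoprodI.of : G ⟨0, by omega⟩ →* Monoid.CoprodI G)) := by
  intro N
  obtain ⟨k, rfl⟩ := Nat.exists_eq_add_of_le' hr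
  obtain ⟨L, _, f, hf⟩ := exists_monoidHom_orderOf_prod_eq k (fun i => G i.succ)
    (fun i => a i.succ) (fun i => ha i.succ) (n := orderOf (a 0)⁻¹)
    (by rw [Ne, orderOf_eq_one_iff, inv_eq_one]; exact ha 0)
  obtain ⟨M, _, g, h, hg, -, hgh⟩ := exists_amalgam hf.symm
  let F : ∀ i, G i →* M := Fin.cons g fun i => h.comp (f i)
  have hN : N ≤ (Monoid.CoprodI.lift F).ker := by
    refine Subgroup.normalClosure_le_normal (Set.singleton_subset_iff.2 ?_)
    rw [map_inv, map_list_prod, List.map_ofFn, inv_eq_iff_mul_eq_one] at hgh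
    rw [SetLike.mem_coe, MonoidHom.mem_ker, map_list_prod, List.map_ofFn,
      List.ofFn_succ, List.prod_cons]
    simpa [F, Function.comp_def] using hgh
  have hF : ∀ t : G 0, QuotientGroup.lift N (Monoid.CoprodI.lift F) hN
      (QuotientGroup.mk' N (Monoid.CoprodI.of t)) = g t := fun t => by
    simp [F]
  intro s t hst
  exact hg (by rw [← hF s, ← hF t]; exact congrArg _ hst)
end

section
/- Let r ≥ 4, let G₁, …, G_r be groups, and for each i let aᵢ ∈ Gᵢ be a nontrivial element. Then the quotient Γ of the free product G₁ ∗ G₂ ∗ ⋯ ∗ G_r by the normal closure of the single element a₁a₂⋯a_r is an infinite group. -/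
namespace Monoid.CoprodI

variable {ι : Type*} {G : ι → Type*} [∀ i, Group (G i)]

theorem NeWord.prod_ne_one {i j : ι} (w : NeWord G i j) : w.prod ≠ 1 := by
  classical
  intro h
  refine w.toList_ne_nil (congrArg Word.toList (?_ : w.toWord = Word.empty))
  apply Word.equiv.symm.injective
  change w.toWord.prod = (Word.empty : Word G).prod
  rw [Word.prod_empty]
  exact h

theorem NeWord.exists_prod_eq_pow {i j : ι} (hij : i ≠ j) (w : NeWord G i j) (n : ℕ) :
    ∃ v : NeWord G i j, v.prod = w.prod ^ (n + 1) := by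
  induction n with
  | zero => exact ⟨w, by simp⟩
  | succ n ih =>
    obtain ⟨v, hv⟩ := ih
    exact ⟨v.append hij.symm w, by rw [NeWord.append_prod, hv, pow_succ _ (n + 1)]⟩

theorem NeWord.not_isOfFinOrder_prod {i j : ι} (hij : i ≠ j) (w : NeWord G i j) :
    ¬ IsOfFinOrder w.prod := by
  rw [isOfFinOrder_iff_pow_eq_one]
  rintro ⟨n, hn, h⟩
  obtain ⟨m, rfl⟩ := Nat.exists_eq_add_one.mpr hn
  obtain ⟨v, hv⟩ := w.exists_prod_eq_pow hij m
  exact v.prod_ne_one (hv.trans h)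

theorem exists_neWord_prod_eq {a : ∀ i, G i} (ha : ∀ i, a i ≠ 1) (l : List ι) (i : ι)
    (hl : (i :: l).IsChain (· ≠ ·)) :
    ∃ w : NeWord G i ((i :: l).getLast (List.cons_ne_nil i l)),
      w.prod = ((i :: l).map fun k => of (a k)).prod := by
  induction l generalizing i with
  | nil => exact ⟨.singleton (a i) (ha i), by simp⟩
  | cons j l ih =>
    rw [List.isChain_cons_cons] at hl
    obtain ⟨w, hw⟩ := ih j hl.2
    rw [List.getLast_cons (List.cons_ne_nil j l)]
    exact ⟨(NeWord.singleton (a i) (ha i)).append hl.1 w, by simp [hw]⟩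

theorem not_isOfFinOrder_prod_of_nodup {a : ∀ i, G i} (ha : ∀ i, a i ≠ 1) {i j : ι} {l : List ι}
    (hl : (i :: j :: l).Nodup) :
    ¬ IsOfFinOrder ((i :: j :: l).map fun k => of (a k)).prod := by
  obtain ⟨w, hw⟩ := exists_neWord_prod_eq ha (j :: l) i (List.Pairwise.isChain hl)
  rw [← hw]
  refine w.not_isOfFinOrder_prod fun h => ?_
  rw [List.getLast_cons (List.cons_ne_nil j l)] at h
  exact (List.nodup_cons.mp hl).1 (h ▸ List.getLast_mem _)

/-- The quotient maps to the amalgam of two copies of the free product along the infinite cyclic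
subgroups generated by `∏ l₁` and `(∏ l₂)⁻¹`, where the first factor embeds. -/
theorem infinite_quotient_normalClosure_of_disjoint (a : ∀ i, G i) (l₁ l₂ : List ι)
    (hd : l₁.Disjoint l₂)
    (h₁ : ¬ IsOfFinOrder (l₁.map fun k => (of (a k) : CoprodI G)).prod)
    (h₂ : ¬ IsOfFinOrder (l₂.map fun k => (of (a k) : CoprodI G)).prod) :
    Infinite (CoprodI G ⧸
      Subgroup.normalClosure {((l₁ ++ l₂).map fun k => (of (a k) : CoprodI G)).prod}) := by
  classical
  set x := (l₁.map fun k => (of (a k) : CoprodI G)).prod with hx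
  set y := (l₂.map fun k => (of (a k) : CoprodI G)).prod with hy
  let φ : Bool → Multiplicative ℤ →* CoprodI G := fun b => zpowersHom _ (cond b x y⁻¹)
  have hφ : ∀ b, Function.Injective (φ b) := by
    rintro (_ | _)
    · exact (injective_zpow_iff_not_isOfFinOrder.mpr (mt isOfFinOrder_inv_iff.mp h₂)).comp
        Multiplicative.toAdd.injective
    · exact (injective_zpow_iff_not_isOfFinOrder.mpr h₁).comp Multiplicative.toAdd.injective
  have hbase : (PushoutI.of true : _ →* PushoutI φ) x = PushoutI.of false y⁻¹ := by
    have h := (PushoutI.of_apply_eq_base φ true (Multiplicative.ofAdd 1)).trans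
      (PushoutI.of_apply_eq_base φ false (Multiplicative.ofAdd 1)).symm
    simpa [φ] using h
  let f : CoprodI G →* PushoutI φ :=
    lift fun i => (PushoutI.of (decide (i ∈ l₁))).comp of
  have hfx : f x = PushoutI.of true x := by
    rw [hx, map_list_prod, map_list_prod, List.map_map, List.map_map]
    congr 1
    exact List.map_congr_left fun k hk => by simp [f, hk]
  have hfy : f y = PushoutI.of false y := by
    rw [hy, map_list_prod, map_list_prod, List.map_map, List.map_map]
    congr 1
    exact List.map_congr_left fun k hk => by
      have hk₁ : k ∉ l₁ := fun h => hd h hk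
      simp only [f, Function.comp_apply, lift_of, MonoidHom.comp_apply, decide_eq_false hk₁]
  have hker : Subgroup.normalClosure {((l₁ ++ l₂).map fun k => (of (a k) : CoprodI G)).prod}
      ≤ f.ker := by
    refine Subgroup.normalClosure_le_normal ?_
    rw [Set.singleton_subset_iff, SetLike.mem_coe, MonoidHom.mem_ker, List.map_append,
      List.prod_append, map_mul, hfx, hfy, hbase, ← map_mul, inv_mul_cancel, map_one]
  refine Infinite.of_injective (fun n : ℤ => QuotientGroup.mk x ^ n)
    (injective_zpow_iff_not_isOfFinOrder.mpr fun h => h₁ ?_)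
  have h' := (QuotientGroup.lift _ f hker).isOfFinOrder h
  rw [QuotientGroup.lift_mk, hfx] at h'
  exact (PushoutI.of_injective hφ true).isOfFinOrder_iff.mp h'

end Monoid.CoprodI


/-- Let `r ≥ 4`, let `G₁, …, G_r` be groups, each with a nontrivial element `aᵢ`. Then the
quotient of the free product `G₁ ∗ ⋯ ∗ G_r` by the normal closure of `a₁a₂⋯a_r` is an
infinite group. -/
theorem freeProduct_r_factors_infinite (r : ℕ) (hr : 4 ≤ r)
    (G : Fin r → Type*) [∀ i, Group (G i)] (a : ∀ i, G i) (ha : ∀ i, a i ≠ 1) :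
    Infinite ((Monoid.CoprodI G) ⧸
      Subgroup.normalClosure {(List.ofFn fun i : Fin r => Monoid.CoprodI.of (a i)).prod}) := by
  have hnd := List.nodup_finRange r
  have hlen := List.length_finRange (n := r)
  rw [List.ofFn_eq_map]
  match h : List.finRange r with
  | i :: j :: k :: m :: l =>
    rw [h] at hnd
    have hsplit : ([i, j] ++ (k :: m :: l)).Nodup := hnd
    rw [List.nodup_append'] at hsplit
    exact Monoid.CoprodI.infinite_quotient_normalClosure_of_disjoint a [i, j] (k :: m :: l)
      hsplit.2.2
      (Monoid.CoprodI.not_isOfFinOrder_prod_of_nodup ha hsplit.1)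
      (Monoid.CoprodI.not_isOfFinOrder_prod_of_nodup ha hsplit.2.1)
  | [] | [_] | [_, _] | [_, _, _] =>
    simp only [h, List.length_cons, List.length_nil] at hlen
    omega
end

section
/- Let G be a group, let β₁ ∈ G, and let k ≥ 1 be an integer. Let G'' be the quotient of the free product G ∗ ℤ by the normal closure of the element β₁β⁻ᵏ, where β denotes a fixed generator of the infinite cyclic free factor ℤ. Then the natural homomorphism G → G'' is injective, the order of the image of β in G'' equals k times the order of β₁ in G (with the convention that elements of infinite order have order 0, so that β has infinite order in G'' exactly when β₁ has infinite order in G), and every element g ∈ G has the same order in G'' as in G. -/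
/-- The permutation of `ZMod k × G` that advances the first coordinate and multiplies the second
one by `a` when leaving `0`. Its `k`-th power is left multiplication by `a`. -/
def twistedShift {G : Type*} [Group G] (a : G) (k : ℕ) : Equiv.Perm (ZMod k × G) where
  toFun p := (p.1 + 1, if p.1 = 0 then a * p.2 else p.2)
  invFun p := (p.1 - 1, if p.1 - 1 = 0 then a⁻¹ * p.2 else p.2)
  left_inv p := by
    by_cases h : p.1 = 0 <;> ext <;> simp [h]
  right_inv p := by
    refine Prod.ext (sub_add_cancel p.1 1) ?_
    by_cases h : p.1 - 1 = 0 <;> simp only [h, if_true, if_false, mul_inv_cancel_left]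

theorem twistedShift_apply {G : Type*} [Group G] (a : G) (k : ℕ) (p : ZMod k × G) :
    twistedShift a k p = (p.1 + 1, if p.1 = 0 then a * p.2 else p.2) := rfl

/-- `G` acting on the second coordinate of `ZMod k × G` by left multiplication. -/
def mulLeftSnd (G : Type*) [Group G] (k : ℕ) : G →* Equiv.Perm (ZMod k × G) where
  toFun g := (Equiv.refl _).prodCongr (Equiv.mulLeft g)
  map_one' := by ext p <;> simp
  map_mul' g h := by ext p <;> simp [mul_assoc]

@[simp]
theorem mulLeftSnd_apply {G : Type*} [Group G] (k : ℕ) (g : G) (p : ZMod k × G) :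
    mulLeftSnd G k g p = (p.1, g * p.2) := rfl

theorem mulLeftSnd_injective (G : Type*) [Group G] (k : ℕ) :
    Function.Injective (mulLeftSnd G k) := fun g h hgh => by
  simpa using DFunLike.congr_fun hgh (0, 1)

theorem twistedShift_pow_apply_fst {G : Type*} [Group G] (a : G) (k m : ℕ) (p : ZMod k × G) :
    ((twistedShift a k ^ m) p).1 = p.1 + m := by
  induction m with
  | zero => simp
  | succ m ih =>
    rw [pow_succ', Equiv.Perm.mul_apply]
    simp [twistedShift_apply, ih, add_assoc]

theorem twistedShift_pow_succ_apply_zero {G : Type*} [Group G] (a : G) (k m : ℕ) (hm : m < k)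
    (x : G) : (twistedShift a k ^ (m + 1)) (0, x) = (((m + 1 : ℕ) : ZMod k), a * x) := by
  induction m with
  | zero => simp [twistedShift_apply]
  | succ m ih =>
    have h : ((m + 1 : ℕ) : ZMod k) ≠ 0 := by
      rw [Ne, ZMod.natCast_eq_zero_iff]
      exact Nat.not_dvd_of_pos_of_lt m.succ_pos hm
    rw [pow_succ', Equiv.Perm.mul_apply, ih (by omega)]
    ext
    · simp [twistedShift_apply]
    · simp only [twistedShift_apply, if_neg h]

theorem twistedShift_pow_self {G : Type*} [Group G] (a : G) {k : ℕ} (hk : 1 ≤ k) :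
    twistedShift a k ^ k = mulLeftSnd G k a := by
  obtain ⟨k, rfl⟩ := Nat.exists_eq_add_of_le' hk
  have h_zero (x : G) : (twistedShift a (k + 1) ^ (k + 1)) (0, x) = (0, a * x) := by
    rw [twistedShift_pow_succ_apply_zero a _ k k.lt_succ_self, ZMod.natCast_self]
  ext1 ⟨i, x⟩
  obtain ⟨m, hm, rfl⟩ : ∃ m < k + 1, ((m + 1 : ℕ) : ZMod (k + 1)) = i :=
    ⟨(i - 1).val, ZMod.val_lt _, by simp⟩
  have h_orbit := twistedShift_pow_succ_apply_zero a (k + 1) m hm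
  have hx : (((m + 1 : ℕ) : ZMod (k + 1)), x) =
      (twistedShift a (k + 1) ^ (m + 1)) (0, a⁻¹ * x) := by
    rw [h_orbit, mul_inv_cancel_left]
  rw [hx, ← Equiv.Perm.mul_apply, (Commute.self_pow _ _).pow_left (k + 1) |>.eq, Equiv.Perm.mul_apply, h_zero,
    h_orbit, h_orbit, mulLeftSnd_apply, mul_inv_cancel_left]

theorem mul_orderOf_dvd_orderOf_twistedShift {G : Type*} [Group G] (a : G) {k : ℕ}
    (hk : 1 ≤ k) : k * orderOf a ∣ orderOf (twistedShift a k) := by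
  have hdvd : k ∣ orderOf (twistedShift a k) := by
    have h := twistedShift_pow_apply_fst a k (orderOf (twistedShift a k)) (0, 1)
    rw [pow_orderOf_eq_one] at h
    rw [← ZMod.natCast_eq_zero_iff]
    simpa using h.symm
  obtain ⟨j, hj⟩ := hdvd
  rw [hj]
  refine mul_dvd_mul_left k (orderOf_dvd_of_pow_eq_one (mulLeftSnd_injective G k ?_))
  rw [map_pow, ← twistedShift_pow_self a hk, ← pow_mul, ← hj, pow_orderOf_eq_one, map_one]


/-- **Logical Principle Lemma.** Let `G` be a group, `β₁ ∈ G` and `k ≥ 1`. Let `G''` be the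
quotient of the free product `G ∗ ℤ` by the normal closure of `β₁β⁻ᵏ`, where `β` generates
the infinite cyclic free factor. Then the natural homomorphism `G → G''` is injective,
`ord(β) = k · ord(β₁)` in `G''` (orders being natural numbers, with `0` for infinite order),
and every `g ∈ G` has the same order in `G''` as in `G`. -/
theorem logical_principle (G : Type*) [Group G] (β₁ : G) (k : ℕ) (hk : 1 ≤ k) :
    let β : Monoid.Coprod G (Multiplicative ℤ) :=
      Monoid.Coprod.inr (Multiplicative.ofAdd (1 : ℤ))
    let N : Subgroup (Monoid.Coprod G (Multiplicative ℤ)) :=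
      Subgroup.normalClosure {Monoid.Coprod.inl β₁ * (β ^ k)⁻¹}
    let π : Monoid.Coprod G (Multiplicative ℤ) →*
        (Monoid.Coprod G (Multiplicative ℤ)) ⧸ N := QuotientGroup.mk' N
    Function.Injective (π.comp (Monoid.Coprod.inl : G →* Monoid.Coprod G (Multiplicative ℤ)))
      ∧ orderOf (π β) = k * orderOf β₁
      ∧ ∀ g : G, orderOf (π (Monoid.Coprod.inl g)) = orderOf g := by
  intro β N π
  let f : Monoid.Coprod G (Multiplicative ℤ) →* Equiv.Perm (ZMod k × G) :=
    Monoid.Coprod.lift (mulLeftSnd G k) (zpowersHom _ (twistedShift β₁ k))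
  have hfβ : f β = twistedShift β₁ k := by simp [f, β]
  have hfG (g : G) : f (Monoid.Coprod.inl g) = mulLeftSnd G k g := by simp [f]
  have hN : N ≤ f.ker := by
    refine Subgroup.normalClosure_le_normal (Set.singleton_subset_iff.2 ?_)
    rw [SetLike.mem_coe, MonoidHom.mem_ker, map_mul, map_inv, map_pow, hfβ, hfG,
      twistedShift_pow_self β₁ hk, mul_inv_cancel]
  let F := QuotientGroup.lift N f hN
  have hF (x) : F (π x) = f x := rfl
  have hinj : Function.Injective
      (π.comp (Monoid.Coprod.inl : G →* Monoid.Coprod G (Multiplicative ℤ))) := fun g h hgh =>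
    mulLeftSnd_injective G k <| by
      rw [← hfG, ← hfG, ← hF, ← hF]
      exact congrArg F hgh
  have hpow : π β ^ k = π (Monoid.Coprod.inl β₁) := by
    rw [← map_pow, eq_comm, ← mul_inv_eq_one, ← map_inv, ← map_mul]
    exact (QuotientGroup.eq_one_iff _).2 (Subgroup.subset_normalClosure rfl)
  refine ⟨hinj, Nat.dvd_antisymm ?_ ?_, orderOf_injective _ hinj⟩
  · apply orderOf_dvd_of_pow_eq_one
    rw [pow_mul, hpow]
    exact (map_pow (π.comp Monoid.Coprod.inl) β₁ _).symm.trans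
      (by rw [pow_orderOf_eq_one, map_one])
  · refine (mul_orderOf_dvd_orderOf_twistedShift β₁ hk).trans ?_
    rw [← hfβ, ← hF]
    exact orderOf_map_dvd F (π β)
end

section
/- Let n ≥ 2 and let m₁, …, m_n be integers with mᵢ ≥ 2 for all i. Let Γ be the group with generators γ₁, …, γ_n and defining relations γ₁^{m₁} = γ₂, γᵢ^{mᵢ} = γ_{i−1}γ_{i+1} for 2 ≤ i ≤ n−1, and γ_n^{m_n} = γ_{n−1} (the quotient of the free group on γ₁, …, γ_n by the normal closure of the corresponding relators). Define a₁ = 1, a₂ = m₁, a_{i+1} = mᵢ·aᵢ − a_{i−1} for 2 ≤ i ≤ n. Then Γ is a finite cyclic group of order a_{n+1}, generated by the image of γ₁. -/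
/-- The relators of the local fundamental group of a linear chain of `n` smooth rational
curves with self-intersections `−m₁, …, −m_n` (the generator `i : Fin n` is the loop `γ_{i+1}`
around the `(i+1)`-st curve, and `m` is indexed starting from `1`): the relation at the `i`-th
vertex is `γᵢ^{mᵢ} = γ_{i−1}·γ_{i+1}` (with the missing neighbours omitted at the two ends). -/
def chainRelator (n : ℕ) (m : ℕ → ℤ) (i : Fin n) : FreeGroup (Fin n) :=
  FreeGroup.of i ^ (m (i.1 + 1)) *
    ((if _ : 0 < i.1 then FreeGroup.of (⟨i.1 - 1, by have := i.2; omega⟩ : Fin n) else 1) *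
     (if h : i.1 + 1 < n then FreeGroup.of (⟨i.1 + 1, h⟩ : Fin n) else 1))⁻¹

/-- The relation imposed by the `i`-th relator in the presented group. -/
lemma chainRelator_relation (n : ℕ) (m : ℕ → ℤ) (i : Fin n) :
    (PresentedGroup.of i : PresentedGroup (Set.range (chainRelator n m))) ^ m (i.1 + 1) =
      (if _ : 0 < i.1 then PresentedGroup.of (⟨i.1 - 1, by have := i.2; omega⟩ : Fin n) else 1) *
      (if h : i.1 + 1 < n then PresentedGroup.of (⟨i.1 + 1, h⟩ : Fin n) else 1) := by
  have h : PresentedGroup.mk (Set.range (chainRelator n m)) (chainRelator n m i) = 1 :=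
    PresentedGroup.one_of_mem (Set.mem_range_self i)
  rw [chainRelator, map_mul, map_inv, mul_inv_eq_one, map_zpow, map_mul] at h
  refine h.trans ?_
  congr 1 <;> split_ifs <;> rfl

/-- Powers of a single element with exponents satisfying the chain recursion satisfy the
relations of the chain. -/
lemma lift_chainRelator_eq_one {G : Type*} [Group G] (n : ℕ) (m b : ℕ → ℤ) (hb0 : b 0 = 0)
    (hrec : ∀ i < n, b (i + 2) = m (i + 1) * b (i + 1) - b i) (g : G) (hg : g ^ b (n + 1) = 1)
    (i : Fin n) : FreeGroup.lift (fun j : Fin n => g ^ b (j.1 + 1)) (chainRelator n m i) = 1 := by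
  have hprev : FreeGroup.lift (fun j : Fin n => g ^ b (j.1 + 1))
      (if _ : 0 < i.1 then FreeGroup.of (⟨i.1 - 1, by have := i.2; omega⟩ : Fin n) else 1) =
      g ^ b i.1 := by
    split_ifs with h
    · simp only [FreeGroup.lift_apply_of]
      rw [Nat.sub_add_cancel h]
    · rw [map_one, Nat.eq_zero_of_not_pos h, hb0, zpow_zero]
  have hnext : FreeGroup.lift (fun j : Fin n => g ^ b (j.1 + 1))
      (if h : i.1 + 1 < n then FreeGroup.of (⟨i.1 + 1, h⟩ : Fin n) else 1) =
      g ^ b (i.1 + 2) := by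
    split_ifs with h
    · simp only [FreeGroup.lift_apply_of]
    · have hi : i.1 + 2 = n + 1 := by omega
      rw [map_one, hi, hg]
  rw [chainRelator, map_mul, map_inv, mul_inv_eq_one, map_zpow, map_mul, hprev, hnext,
    FreeGroup.lift_apply_of, ← zpow_mul, ← zpow_add, hrec i.1 i.2]
  congr 1
  ring

/-- Every generator of the chain group is an explicit power of the first one. -/
lemma chain_of_eq_zpow (n : ℕ) (hn : 0 < n) (m b : ℕ → ℤ) (hb0 : b 0 = 0) (hb1 : b 1 = 1)
    (hrec : ∀ i < n, b (i + 2) = m (i + 1) * b (i + 1) - b i) (k : ℕ) (hk : k < n) :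
    (PresentedGroup.of (⟨k, hk⟩ : Fin n) : PresentedGroup (Set.range (chainRelator n m))) =
      PresentedGroup.of (⟨0, hn⟩ : Fin n) ^ b (k + 1) := by
  induction k using Nat.strong_induction_on with
  | _ k ih =>
    rcases k with _ | k
    · rw [zero_add, hb1, zpow_one]
    · have h := chainRelator_relation n m ⟨k, by omega⟩
      rw [dif_pos (show k + 1 < n from hk), ih k (by omega) (by omega), ← zpow_mul] at h
      rw [← inv_mul_eq_iff_eq_mul] at h
      rw [← h, hrec k (by omega)]
      split_ifs with hk0
      · simp only at hk0
        rw [ih (k - 1) (by omega) (by omega), Nat.sub_add_cancel hk0, ← zpow_neg, ← zpow_add]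
        congr 1
        ring
      · simp only at hk0
        obtain rfl : k = 0 := by omega
        simp [hb0, mul_comm]

/-- The first generator of the chain group is annihilated by the last term of the recursion. -/
lemma chain_of_zero_zpow (n : ℕ) (hn : 0 < n) (m b : ℕ → ℤ) (hb0 : b 0 = 0) (hb1 : b 1 = 1)
    (hrec : ∀ i < n, b (i + 2) = m (i + 1) * b (i + 1) - b i) :
    (PresentedGroup.of (⟨0, hn⟩ : Fin n) : PresentedGroup (Set.range (chainRelator n m))) ^
      b (n + 1) = 1 := by
  obtain ⟨k, rfl⟩ : ∃ k, n = k + 1 := ⟨n - 1, by omega⟩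
  have h := chainRelator_relation (k + 1) m ⟨k, by omega⟩
  rw [dif_neg (show ¬ k + 1 < k + 1 by omega), mul_one,
    chain_of_eq_zpow _ hn m b hb0 hb1 hrec k (by omega), ← zpow_mul] at h
  rw [hrec k (by omega), zpow_sub, mul_comm (m _), h]
  split_ifs with hk0
  · simp only at hk0
    rw [chain_of_eq_zpow _ hn m b hb0 hb1 hrec (k - 1) (by omega), Nat.sub_add_cancel hk0,
      mul_inv_cancel]
  · simp only at hk0
    obtain rfl : k = 0 := by omega
    simp [hb0]

/-- A sequence satisfying the chain recursion with coefficients at least `2` is increasing. -/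
lemma chain_recursion_lt (n : ℕ) (m b : ℕ → ℤ) (hm : ∀ i, 1 ≤ i → i ≤ n → 2 ≤ m i)
    (hb0 : b 0 = 0) (hb1 : b 1 = 1)
    (hrec : ∀ i < n, b (i + 2) = m (i + 1) * b (i + 1) - b i) (k : ℕ) (hk : k ≤ n) :
    0 ≤ b k ∧ b k < b (k + 1) := by
  induction k with
  | zero => simp [hb0, hb1]
  | succ k ih =>
    obtain ⟨h0, h1⟩ := ih (by omega)
    have := hm (k + 1) (by omega) hk
    have := hrec k (by omega)
    constructor
    · omega
    · show b (k + 1) < b (k + 2)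
      nlinarith

/-- The first generator of the chain group generates it. -/
lemma chain_zpowers_eq_top (n : ℕ) (hn : 0 < n) (m b : ℕ → ℤ) (hb0 : b 0 = 0) (hb1 : b 1 = 1)
    (hrec : ∀ i < n, b (i + 2) = m (i + 1) * b (i + 1) - b i) :
    Subgroup.zpowers
      (PresentedGroup.of (rels := Set.range (chainRelator n m)) (⟨0, hn⟩ : Fin n)) = ⊤ := by
  rw [← top_le_iff, ← PresentedGroup.closure_range_of, Subgroup.closure_le]
  rintro _ ⟨i, rfl⟩
  exact ⟨_, (chain_of_eq_zpow n hn m b hb0 hb1 hrec i.1 i.2).symm⟩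

/-- The order of the first generator of the chain group is the last term of the recursion. -/
lemma chain_orderOf (n : ℕ) (hn : 0 < n) (m b : ℕ → ℤ) (hb0 : b 0 = 0) (hb1 : b 1 = 1)
    (hrec : ∀ i < n, b (i + 2) = m (i + 1) * b (i + 1) - b i) :
    orderOf (PresentedGroup.of (rels := Set.range (chainRelator n m)) (⟨0, hn⟩ : Fin n)) =
      (b (n + 1)).natAbs := by
  set N := (b (n + 1)).natAbs with hN
  apply Nat.dvd_antisymm
  · rw [← Int.natCast_dvd, orderOf_dvd_iff_zpow_eq_one]
    exact chain_of_zero_zpow n hn m b hb0 hb1 hrec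
  · let g : Multiplicative (ZMod N) := Multiplicative.ofAdd 1
    have hord : orderOf g = N := by
      rw [orderOf_ofAdd_eq_addOrderOf, ZMod.addOrderOf_one]
    have hg : g ^ b (n + 1) = 1 := by
      rw [← orderOf_dvd_iff_zpow_eq_one, hord, Int.natCast_dvd]
    let φ : PresentedGroup (Set.range (chainRelator n m)) →* Multiplicative (ZMod N) :=
      PresentedGroup.toGroup (f := fun j : Fin n => g ^ b (j.1 + 1)) (by
        rintro _ ⟨i, rfl⟩
        exact lift_chainRelator_eq_one n m b hb0 hrec g hg i)
    have hφ : φ (PresentedGroup.of ⟨0, hn⟩) = g := by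
      simp [φ, hb1]
    rw [← hord, ← hφ]
    exact orderOf_map_dvd φ _

/-- Let `n ≥ 2` and `mᵢ ≥ 2` for `1 ≤ i ≤ n`. Let `Γ = ⟨γ₁,…,γₙ | γ₁^{m₁} = γ₂,
γᵢ^{mᵢ} = γ_{i−1}γ_{i+1} (2 ≤ i ≤ n−1), γₙ^{mₙ} = γ_{n−1}⟩`, and define `a₁ = 1`, `a₂ = m₁`,
`a_{i+1} = mᵢaᵢ − a_{i−1}`. Then `Γ` is a finite cyclic group of order `a_{n+1}`,
generated by the image of `γ₁`. -/
theorem chain_group_cyclic (n : ℕ) (hn : 2 ≤ n) (m a : ℕ → ℤ)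
    (hm : ∀ i, 1 ≤ i → i ≤ n → 2 ≤ m i)
    (ha1 : a 1 = 1) (ha2 : a 2 = m 1)
    (harec : ∀ i, 2 ≤ i → i ≤ n → a (i + 1) = m i * a i - a (i - 1)) :
    Finite (PresentedGroup (Set.range (chainRelator n m))) ∧
    (Nat.card (PresentedGroup (Set.range (chainRelator n m))) : ℤ) = a (n + 1) ∧
    Subgroup.zpowers
        (PresentedGroup.of (rels := Set.range (chainRelator n m)) (⟨0, by omega⟩ : Fin n)) =
      ⊤ := by
  let b : ℕ → ℤ := fun i => if i = 0 then 0 else a i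
  have hb0 : b 0 = 0 := rfl
  have hb1 : b 1 = 1 := ha1
  have hrec : ∀ i < n, b (i + 2) = m (i + 1) * b (i + 1) - b i := by
    intro i hi
    rcases i with _ | i
    · simp [b, ha1, ha2]
    · exact harec (i + 2) (by omega) (by omega)
  have hpos : 0 < b (n + 1) := by
    have := chain_recursion_lt n m b hm hb0 hb1 hrec n le_rfl
    omega
  have hn0 : 0 < n := by omega
  have htop := chain_zpowers_eq_top n hn0 m b hb0 hb1 hrec
  have hcard : Nat.card (PresentedGroup (Set.range (chainRelator n m))) =
      (b (n + 1)).natAbs := by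
    rw [← chain_orderOf n hn0 m b hb0 hb1 hrec, ← Nat.card_zpowers, htop, Subgroup.card_top]
  refine ⟨Nat.finite_of_card_ne_zero (by omega), ?_, htop⟩
  rw [hcard, Int.natAbs_of_nonneg hpos.le]
  rfl
end

section
/- Let G be a finite tree (a connected acyclic simple graph) on a linearly ordered finite vertex set V, and let m_v ≥ 2 be an integer for each vertex v. Let Γ be the group with one generator γ_v for each vertex v and defining relations: γ_vγ_w = γ_wγ_v for every edge {v,w} of G, and γ_v^{m_v} = ∏_{w adjacent to v} γ_w for every vertex v, the product over the neighbours of v being taken in the fixed linear order. Then for every vertex v the image of γ_v in Γ is a nontrivial element. -/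
/-- The relators of the fundamental group of the boundary of a tubular neighbourhood of a
normal-crossings configuration of smooth rational curves with dual graph `G` and
self-intersections `−m_v`: commutation `[γ_v, γ_w] = 1` for each edge `{v,w}`, and
`γ_v^{m_v} = ∏_{w ∼ v} γ_w` for each vertex `v`, the product over the neighbours taken
in the fixed linear order on the vertex set. -/
def treeRelators {V : Type*} [Fintype V] [LinearOrder V] (G : SimpleGraph V)
    [DecidableRel G.Adj] (m : V → ℕ) : Set (FreeGroup V) :=
  {x | ∃ v w, G.Adj v w ∧
      x = FreeGroup.of v * FreeGroup.of w * (FreeGroup.of v)⁻¹ * (FreeGroup.of w)⁻¹} ∪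
  {x | ∃ v, x = FreeGroup.of v ^ (m v) *
      (((G.neighborFinset v).sort (· ≤ ·)).map FreeGroup.of).prod⁻¹}

namespace TreePlumbing

open SimpleGraph

universe u

/-! ### Branches of a tree -/

section Branch

variable {V : Type*} {G : SimpleGraph V}

/-- The vertices which are closer to `w` than to `v`, for an edge `{v, w}` of a tree. -/
def branch (G : SimpleGraph V) (v w : V) : Set V := {u | G.dist u v = G.dist u w + 1}

theorem eq_of_closer (hG : G.IsTree) {u v w₁ w₂ : V} (h₁ : G.Adj v w₁) (h₂ : G.Adj v w₂)
    (hu₁ : u ∈ branch G v w₁) (hu₂ : u ∈ branch G v w₂) : w₁ = w₂ := by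
  obtain ⟨p, hp⟩ := (hG.connected u w₁).exists_walk_length_eq_dist
  obtain ⟨q, hq⟩ := (hG.connected u w₂).exists_walk_length_eq_dist
  have hp' : (p.concat h₁.symm).IsPath :=
    Walk.isPath_of_length_eq_dist _ (by rw [Walk.length_concat, hp]; exact hu₁.symm)
  have hq' : (q.concat h₂.symm).IsPath :=
    Walk.isPath_of_length_eq_dist _ (by rw [Walk.length_concat, hq]; exact hu₂.symm)
  have h := congrArg (fun r : G.Path u v => r.1.penultimate)
    ((hG.isAcyclic.subsingleton_path u v).elim ⟨_, hp'⟩ ⟨_, hq'⟩)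
  simpa using h

theorem exists_mem_branch (hG : G.IsTree) {u v : V} (h : u ≠ v) :
    ∃ w, G.Adj v w ∧ u ∈ branch G v w := by
  obtain ⟨p, hp⟩ := (hG.connected v u).exists_walk_length_eq_dist
  cases p with
  | nil => exact absurd rfl h
  | @cons _ w _ hvw q =>
    refine ⟨w, hvw, ?_⟩
    have h₁ := dist_le q
    have h₂ := hG.dist_eq_dist_add_one_of_adj u hvw
    simp only [Walk.length_cons] at hp
    simp only [branch, Set.mem_ofPred_eq]
    rw [G.dist_comm] at h₁ hp
    omega

theorem notMem_branch_left {v w : V} : v ∉ branch G v w := by simp [branch]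

theorem mem_branch_right {v w : V} (h : G.Adj v w) : w ∈ branch G v w := by
  simpa [branch] using dist_eq_one_iff_adj.2 h.symm

theorem mem_branch_or (hG : G.IsTree) {v w : V} (h : G.Adj v w) (u : V) :
    u ∈ branch G v w ∨ u ∈ branch G w v :=
  hG.dist_eq_dist_add_one_of_adj u h

theorem notMem_branch_of_mem {u v w : V} (hu : u ∈ branch G v w) : u ∉ branch G w v := by
  simp only [branch, Set.mem_ofPred_eq] at *
  omega

theorem branch_subset (hG : G.IsTree) {v w w' : V} (h : G.Adj v w) (h' : G.Adj w w')
    (hne : w' ≠ v) : branch G w w' ⊆ branch G v w := by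
  intro u hu
  rcases mem_branch_or hG h u with h₁ | h₁
  · exact h₁
  · exact absurd (eq_of_closer hG h' h.symm hu h₁) hne

theorem mem_branch_cases (hG : G.IsTree) {u v w : V} (hu : u ∈ branch G v w) :
    u = w ∨ ∃ w', G.Adj w w' ∧ w' ≠ v ∧ u ∈ branch G w w' := by
  by_cases h : u = w
  · exact .inl h
  · obtain ⟨w', hw', hu'⟩ := exists_mem_branch hG h
    refine .inr ⟨w', hw', ?_, hu'⟩
    rintro rfl
    exact notMem_branch_of_mem hu hu'

theorem adj_mem_branch (hG : G.IsTree) {u u' v w : V} (h : G.Adj v w) (hu : u ∈ branch G v w)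
    (hadj : G.Adj u u') : u' ∈ branch G v w ∨ (u = w ∧ u' = v) := by
  rcases mem_branch_or hG h u' with hu' | hu'
  · exact .inl hu'
  right
  have hv := hG.dist_eq_dist_add_one_of_adj v hadj
  have hw := hG.dist_eq_dist_add_one_of_adj w hadj
  simp only [branch, Set.mem_ofPred_eq] at hu hu'
  rw [G.dist_comm, G.dist_comm (u := u) (v := w)] at hu
  rw [G.dist_comm, G.dist_comm (u := u') (v := v)] at hu'
  have huw : u = w := by
    by_contra hne
    obtain ⟨z, hz, hwz⟩ := exists_mem_branch hG (Ne.symm hne)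
    have hzv : v ∈ branch G u z := by
      have h₁ := hG.dist_eq_dist_add_one_of_adj v hz
      have h₂ := hG.dist_eq_dist_add_one_of_adj z h
      simp only [branch, Set.mem_ofPred_eq] at hwz ⊢
      rw [G.dist_comm (u := z) (v := v), G.dist_comm (u := z) (v := w)] at h₂
      omega
    have hu'v : v ∈ branch G u u' := by
      simp only [branch, Set.mem_ofPred_eq]
      omega
    obtain rfl := eq_of_closer hG hz hadj hzv hu'v
    simp only [branch, Set.mem_ofPred_eq] at hwz
    omega
  refine ⟨huw, ?_⟩
  subst huw
  have : G.dist v u' = 0 := by simp only [dist_self] at *; omega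
  exact ((hG.connected.dist_eq_zero_iff).1 this).symm

end Branch

/-! ### Local solutions of the plumbing relations -/

section Relations

variable {V : Type*} [Fintype V] [LinearOrder V] {G : SimpleGraph V} [DecidableRel G.Adj]
  {m : V → ℕ}

/-- The elements `g` of a group satisfy the plumbing relations attached to the vertex `u`. -/
def Sat (G : SimpleGraph V) [DecidableRel G.Adj] (m : V → ℕ) {H : Type*} [Group H] (g : V → H)
    (u : V) : Prop :=
  (∀ u', G.Adj u u' → Commute (g u) (g u')) ∧
    g u ^ m u = (((G.neighborFinset u).sort (· ≤ ·)).map g).prod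

theorem of_ne_one_of_sat {H : Type*} [Group H] {g : V → H} (hg : ∀ u, Sat G m g u) {v : V}
    (hv : g v ≠ 1) : PresentedGroup.of (rels := treeRelators G m) v ≠ 1 := by
  have h : ∀ r ∈ treeRelators G m, FreeGroup.lift g r = 1 := by
    rintro r (⟨u, u', huu', rfl⟩ | ⟨u, rfl⟩)
    · have := (hg u).1 u' huu'
      simp only [map_mul, map_inv, FreeGroup.lift_apply_of]
      rw [this.eq]
      group
    · simp only [map_mul, map_inv, map_pow, FreeGroup.lift_apply_of, map_list_prod, List.map_map]
      rw [mul_inv_eq_one, (hg u).2]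
      congr 2
      ext
      simp
  intro h1
  apply hv
  have := congrArg (PresentedGroup.toGroup h) h1
  rwa [PresentedGroup.toGroup.of, map_one] at this

theorem Sat.map {H K : Type*} [Group H] [Group K] {g : V → H} {g' : V → K} {u : V}
    (h : Sat G m g u) (f : H →* K) (hu : g' u = f (g u))
    (hadj : ∀ u', G.Adj u u' → g' u' = f (g u')) : Sat G m g' u := by
  refine ⟨fun u' hu' => ?_, ?_⟩
  · rw [hu, hadj u' hu']
    exact (h.1 u' hu').map f
  · rw [hu, ← map_pow, h.2, map_list_prod, List.map_map]
    congr 1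
    refine List.map_congr_left fun x hx => ?_
    rw [Finset.mem_sort, mem_neighborFinset] at hx
    exact (hadj x hx).symm

theorem sat_zpow {H : Type*} [Group H] (s : H) {e : V → ℤ} {u : V}
    (h : s ^ (m u * e u) = s ^ (∑ u' ∈ G.neighborFinset u, e u')) :
    Sat G m (fun u => s ^ e u) u := by
  refine ⟨fun u' _ => (Commute.refl s).zpow_zpow _ _, ?_⟩
  have hsum : ∀ l : List V, (l.map fun u => s ^ e u).prod = s ^ (l.map e).sum := by
    intro l
    induction l with
    | nil => simp
    | cons a l ih => simp [ih, zpow_add]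
  rw [hsum, ← zpow_natCast, ← zpow_mul, mul_comm, h]
  congr 1
  rw [← Finset.sum_map_toList]
  exact (((Finset.sort_perm_toList _ _).map e).sum_eq).symm

/-- In a rooted branch, the relation at the root can be solved for the parent. -/
theorem exists_list_sat_update {v w : V} (hvw : G.Adj v w) (m : V → ℕ) :
    ∃ c : List V, c.Nodup ∧ (∀ u, u ∈ c ↔ G.Adj w u ∧ u ≠ v) ∧
      ∀ (H : Type*) [Group H] (g : V → H), (∀ u ∈ c, Commute (g w) (g u)) →
        Sat G m (Function.update g v (g w ^ m w * ((c.map g).prod)⁻¹)) w := by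
  have hv : v ∈ (G.neighborFinset w).sort (· ≤ ·) := by simpa using hvw.symm
  obtain ⟨L, R, hLR⟩ := List.append_of_mem hv
  have hnd : ((G.neighborFinset w).sort (· ≤ ·)).Nodup := Finset.sort_nodup _ _
  rw [hLR, List.nodup_middle, List.nodup_cons] at hnd
  have hmem : ∀ u, u ∈ R ++ L ↔ G.Adj w u ∧ u ≠ v := by
    intro u
    rw [← mem_neighborFinset, ← Finset.mem_sort (· ≤ ·), hLR]
    have := hnd.1
    simp only [List.mem_append, List.mem_cons] at this ⊢
    constructor
    · intro h
      exact ⟨by tauto, by rintro rfl; tauto⟩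
    · tauto
  refine ⟨R ++ L, (List.perm_append_comm.nodup_iff).1 hnd.2, hmem, fun H _ g hc => ?_⟩
  have hpow : ∀ l : List V, (∀ u ∈ l, u ∈ R ++ L) → Commute (g w) (l.map g).prod := fun l hl =>
    Commute.list_prod_right _ _ (by simpa using fun u hu => hc u (hl u hu))
  have hw : w ≠ v := hvw.ne'
  have hupd : ∀ (x : H) (l : List V), (∀ u ∈ l, u ∈ R ++ L) →
      l.map (Function.update g v x) = l.map g := fun x l hl =>
    List.map_congr_left fun u hu => Function.update_of_ne ((hmem u).1 (hl u hu)).2 _ _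
  refine ⟨fun u' hu' => ?_, ?_⟩
  · rw [Function.update_of_ne hw]
    by_cases h : u' = v
    · subst h
      rw [Function.update_self]
      exact ((Commute.refl _).pow_right _).mul_right (hpow _ fun _ h => h).inv_right
    · rw [Function.update_of_ne h]
      exact hc u' ((hmem u').2 ⟨hu', h⟩)
  · rw [hLR, Function.update_of_ne hw, List.map_append, List.map_cons, Function.update_self,
      hupd _ _ (by simp +contextual), hupd _ _ (by simp +contextual), List.prod_append,
      List.prod_cons, List.map_append, List.prod_append]
    have hL := (hpow L (by simp +contextual)).pow_left (m w)
    rw [mul_inv_rev, mul_assoc, inv_mul_cancel_right, ← mul_assoc, ← hL.eq,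
      mul_inv_cancel_right]

theorem sat_update_of_mem_branch (hG : G.IsTree) {u v w w' : V} (hvw : G.Adj v w)
    (hw' : G.Adj w w') (hne : w' ≠ v) (hu : u ∈ branch G w w') {H : Type*} [Group H] {g : V → H}
    (hg : Sat G m g u) (x : H) : Sat G m (Function.update g v x) u := by
  have hv : ∀ z, z ∈ branch G w w' → z ≠ v := by
    rintro z hz rfl
    exact notMem_branch_left (branch_subset hG hvw hw' hne hz)
  refine hg.map (MonoidHom.id H) (Function.update_of_ne (hv u hu) _ _) fun u' hu' =>
    Function.update_of_ne ?_ _ _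
  rcases adj_mem_branch hG hw' hu hu' with h | ⟨-, rfl⟩
  · exact hv u' h
  · exact hvw.ne'

/-- A solution on all the branches hanging below `w` extends to the branch rooted at `w`. -/
theorem exists_list_extend (hG : G.IsTree) {v w : V} (hvw : G.Adj v w) (m : V → ℕ) :
    ∃ c : List V, c.Nodup ∧ (∀ u, u ∈ c ↔ G.Adj w u ∧ u ≠ v) ∧
      ∀ (H : Type*) [Group H] (g : V → H), g w ≠ 1 →
        (∀ w' ∈ c, ∀ u ∈ branch G w w', Sat G m g u ∧ g u ≠ 1) →
        ∀ u ∈ branch G v w,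
          Sat G m (Function.update g v (g w ^ m w * ((c.map g).prod)⁻¹)) u ∧
            Function.update g v (g w ^ m w * ((c.map g).prod)⁻¹) u ≠ 1 := by
  obtain ⟨c, hnd, hmem, hsat⟩ := exists_list_sat_update hvw m
  refine ⟨c, hnd, hmem, fun H _ g hw hg u hu => ?_⟩
  constructor
  · rcases mem_branch_cases hG hu with rfl | ⟨w', hw', hne, hu'⟩
    · refine hsat H g fun w' hw' => ?_
      have hadj := ((hmem w').1 hw').1
      exact ((hg w' hw' w' (mem_branch_right hadj)).1.1 _ hadj.symm).symm
    · exact sat_update_of_mem_branch hG hvw hw' hne hu' (hg w' ((hmem w').2 ⟨hw', hne⟩) u hu').1 _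
  · rw [Function.update_of_ne (by rintro rfl; exact notMem_branch_left hu)]
    rcases mem_branch_cases hG hu with rfl | ⟨w', hw', hne, hu'⟩
    · exact hw
    · exact (hg w' ((hmem w').2 ⟨hw', hne⟩) u hu').2

end Relations

/-! ### Amalgamated products -/

section Amalgam

open Monoid

theorem isChain_flatten_replicate {α β : Type*} (t : α → β) {l : List α}
    (hl : (l.map t).Nodup) (hlen : 2 ≤ l.length) (n : ℕ) :
    (List.replicate n l).flatten.IsChain fun a b => t a ≠ t b := by
  match l, hl, hlen with
  | a :: b :: l, hl, _ =>
    rw [List.isChain_flatten (by simp [List.mem_replicate])]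
    constructor
    · intro l' hl'
      rw [List.eq_of_mem_replicate hl']
      exact (List.pairwise_map.1 hl).isChain
    · refine List.isChain_replicate_of_rel _ ?_
      intro x hx y hy
      simp only [List.head?_cons, Option.mem_def, Option.some.injEq] at hy
      subst hy
      rw [List.getLast?_cons_cons] at hx
      have hx' := List.mem_of_getLast? hx
      intro h
      rw [List.map_cons, List.nodup_cons] at hl
      exact hl.1 (h ▸ List.mem_map_of_mem hx')

/-- Groups with a distinguished element of infinite order embed in a common group in such a way
that these elements get identified, and that a product of at least two elements of distinct
factors, each outside the distinguished cyclic group, has no power in that cyclic group. -/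
theorem exists_amalgam_zpowers {ι : Type u} (H : ι → Type u) [∀ i, Group (H i)] (x a : ∀ i, H i)
    (hx : ∀ i (n : ℤ), x i ^ n = 1 → n = 0) (ha : ∀ i, a i ∉ Subgroup.zpowers (x i)) :
    ∃ (K : Type u) (_ : Group K) (f : ∀ i, H i →* K) (z : K),
      (∀ i, Function.Injective (f i)) ∧ (∀ i, f i (x i) = z) ∧
      ∀ l : List ι, l.Nodup → 2 ≤ l.length → ∀ n : ℤ,
        ((l.map fun i => f i (a i)).prod) ^ n ∈ Subgroup.zpowers z → n = 0 := by
  let φ : ∀ i, Multiplicative ℤ →* H i := fun i => zpowersHom (H i) (x i)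
  have hφ : ∀ i, Function.Injective (φ i) := fun i =>
    (injective_iff_map_eq_one _).2 fun n hn => hx i _ hn
  have hrange : ∀ i, (φ i).range = Subgroup.zpowers (x i) := fun i => by
    ext; simp [φ, Subgroup.mem_zpowers_iff]
  have hbase : (PushoutI.base φ).range =
      Subgroup.zpowers (PushoutI.base φ (Multiplicative.ofAdd 1)) := by
    ext y
    rw [Subgroup.mem_zpowers_iff, MonoidHom.mem_range]
    constructor
    · rintro ⟨k, rfl⟩
      exact ⟨k.toAdd, by rw [← map_zpow, ← ofAdd_zsmul]; simp⟩
    · rintro ⟨k, rfl⟩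
      exact ⟨_, map_zpow _ _ _⟩
  refine ⟨PushoutI φ, inferInstance, fun i => PushoutI.of i,
    PushoutI.base φ (Multiplicative.ofAdd 1), PushoutI.of_injective hφ, fun i => ?_, ?_⟩
  · rw [← PushoutI.of_apply_eq_base φ i]
    simp [φ]
  intro l hl hlen
  have key : ∀ n : ℕ, ((l.map fun i => PushoutI.of (φ := φ) i (a i)).prod) ^ n ∈
      (PushoutI.base φ).range → n = 0 := by
    intro n hn
    let c : List (Σ i, H i) := l.map fun i => ⟨i, a i⟩
    have hc : ∀ y ∈ (List.replicate n c).flatten, y.2 ∉ (φ y.1).range := by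
      intro y hy
      obtain ⟨l', hl', hy⟩ := List.mem_flatten.1 hy
      rw [List.eq_of_mem_replicate hl'] at hy
      obtain ⟨i, -, rfl⟩ := List.mem_map.1 hy
      rw [hrange]
      exact ha i
    let W : CoprodI.Word H :=
      { toList := (List.replicate n c).flatten
        ne_one := fun y hy h => hc y hy (h ▸ one_mem _)
        chain_ne := isChain_flatten_replicate Sigma.fst (by simpa [c, Function.comp_def] using hl)
          (by simpa [c] using hlen) n }
    have hW : PushoutI.Reduced φ W := hc
    have hprod : PushoutI.ofCoprodI W.prod =
        ((l.map fun i => PushoutI.of (φ := φ) i (a i)).prod) ^ n := by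
      simp only [CoprodI.Word.prod, W, c, List.map_map, List.map_flatten,
        List.prod_flatten, List.map_replicate, List.prod_replicate, map_pow, map_list_prod,
        Function.comp_def, PushoutI.ofCoprodI_of]
    have := hW.eq_empty_of_mem_range hφ (by rw [hprod]; exact hn)
    have h0 : (List.replicate n c).flatten = [] := congrArg CoprodI.Word.toList this
    by_contra hne
    rw [List.flatten_eq_nil_iff] at h0
    have := h0 c (List.mem_replicate.2 ⟨hne, rfl⟩)
    simp [c] at this
    simp [this] at hlen
  intro n hn
  rw [← hbase] at hn
  obtain ⟨k, rfl | rfl⟩ := n.eq_nat_or_neg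
  · simpa using key k (by simpa using hn)
  · simpa using key k (by simpa using hn)

/-- Groups with a distinguished free abelian subgroup of rank two embed in a common group in such
a way that the given bases of these subgroups get identified. -/
theorem exists_amalgam_pair {ι : Type u} (H : ι → Type u) [∀ i, Group (H i)] (x h : ∀ i, H i)
    (hcomm : ∀ i, Commute (x i) (h i))
    (hind : ∀ i (k n : ℤ), x i ^ k * h i ^ n = 1 → k = 0 ∧ n = 0) :
    ∃ (K : Type u) (_ : Group K) (f : ∀ i, H i →* K), (∀ i, Function.Injective (f i)) ∧
      (∀ i j, f i (x i) = f j (x j)) ∧ ∀ i j, f i (h i) = f j (h j) := by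
  let φ : ∀ i, Multiplicative ℤ × Multiplicative ℤ →* H i := fun i =>
    (zpowersHom (H i) (x i)).noncommCoprod (zpowersHom (H i) (h i))
      fun k n => by simpa using (hcomm i).zpow_zpow _ _
  have hφ : ∀ i, Function.Injective (φ i) := fun i =>
    (injective_iff_map_eq_one _).2 fun n hn => by
      have := hind i n.1.toAdd n.2.toAdd (by simpa [φ] using hn)
      exact Prod.ext this.1 this.2
  have hx : ∀ i, x i = φ i (Multiplicative.ofAdd 1, 1) := by simp [φ]
  have hh : ∀ i, h i = φ i (1, Multiplicative.ofAdd 1) := by simp [φ]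
  refine ⟨PushoutI φ, inferInstance, fun i => PushoutI.of i, PushoutI.of_injective hφ, ?_, ?_⟩
  · intro i j
    rw [hx, hx, PushoutI.of_apply_eq_base, PushoutI.of_apply_eq_base]
  · intro i j
    rw [hh, hh, PushoutI.of_apply_eq_base, PushoutI.of_apply_eq_base]

end Amalgam

/-! ### Products of conjugacy classes in `GL₂(ℂ)` -/

section Matrices

open Matrix

/-- The diagonal matrix with entries `α` and `α⁻¹`. -/
noncomputable def diagGL : ℂˣ →* GL (Fin 2) ℂ where
  toFun α := ⟨!![(α : ℂ), 0; 0, (α : ℂ)⁻¹], !![(α : ℂ)⁻¹, 0; 0, (α : ℂ)], by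
    simp [Matrix.one_fin_two], by simp [Matrix.one_fin_two]⟩
  map_one' := by ext i j; fin_cases i <;> fin_cases j <;> simp
  map_mul' α β := by
    ext i j; fin_cases i <;> fin_cases j <;> simp [Matrix.mul_apply, mul_comm]

theorem coe_diagGL (α : ℂˣ) :
    (diagGL α : Matrix (Fin 2) (Fin 2) ℂ) = !![(α : ℂ), 0; 0, (α : ℂ)⁻¹] := rfl

theorem diagGL_ne_one {α : ℂˣ} (h : α ≠ 1) : diagGL α ≠ 1 := by
  intro h1
  have := congrArg (fun M : GL (Fin 2) ℂ => (M : Matrix (Fin 2) (Fin 2) ℂ) 0 0) h1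
  exact h (Units.ext (by simpa [coe_diagGL] using this))

theorem commute_diagGL_neg_one (A : GL (Fin 2) ℂ) : Commute (diagGL (-1)) A := by
  have : (diagGL (-1)) = -1 := by
    ext i j; fin_cases i <;> fin_cases j <;> simp [coe_diagGL]
  rw [this]
  exact Commute.neg_one_left A

theorem sub_inv_ne_zero {γ : ℂˣ} (h : γ ^ 2 ≠ 1) : (γ : ℂ) - (γ : ℂ)⁻¹ ≠ 0 := by
  intro h0
  apply h
  ext
  have := γ.ne_zero
  field_simp at h0
  push_cast
  linear_combination h0

theorem exists_eq_conj_diagGL {M : GL (Fin 2) ℂ} {a b c d : ℂ} {γ : ℂˣ}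
    (hM : (M : Matrix (Fin 2) (Fin 2) ℂ) = !![a, b; c, d]) (hb : b ≠ 0)
    (hdet : a * d - b * c = 1) (htr : a + d = γ + (γ : ℂ)⁻¹) (hγ : γ ^ 2 ≠ 1) :
    ∃ S, M = S * diagGL γ * S⁻¹ := by
  have h0 := sub_inv_ne_zero hγ
  have hγ0 := γ.ne_zero
  have hdetS : (!![b, b; γ - a, (γ : ℂ)⁻¹ - a]).det ≠ 0 := by
    rw [Matrix.det_fin_two_of, show b * ((γ : ℂ)⁻¹ - a) - b * (γ - a) =
      -(b * (γ - (γ : ℂ)⁻¹)) by ring]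
    exact neg_ne_zero.2 (mul_ne_zero hb h0)
  refine ⟨GeneralLinearGroup.mkOfDetNeZero _ hdetS, eq_mul_inv_of_mul_eq ?_⟩
  have hinv : (γ : ℂ) * (γ : ℂ)⁻¹ = 1 := mul_inv_cancel₀ hγ0
  ext i j
  rw [Units.val_mul, Units.val_mul, hM, coe_diagGL]
  fin_cases i <;> fin_cases j <;>
    simp [GeneralLinearGroup.mkOfDetNeZero, Matrix.mul_apply]
  · ring
  · ring
  · linear_combination (γ : ℂ) * htr - hdet + hinv
  · linear_combination (γ : ℂ)⁻¹ * htr - hdet + hinv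

/-- The conjugacy classes of three non-scalar diagonal matrices of determinant one can be
realised by two matrices and their product. -/
theorem exists_mul_conj_diagGL {α β γ : ℂˣ} (hα : α ^ 2 ≠ 1) (hβ : β ^ 2 ≠ 1) (hγ : γ ^ 2 ≠ 1) :
    ∃ Q S, diagGL β * (Q * diagGL α * Q⁻¹) = S * diagGL γ * S⁻¹ := by
  have hβ0 := β.ne_zero
  have h0 := sub_inv_ne_zero hβ
  obtain ⟨a, d, htr, htr'⟩ : ∃ a d : ℂ, a + d = α + (α : ℂ)⁻¹ ∧
      β * a + (β : ℂ)⁻¹ * d = γ + (γ : ℂ)⁻¹ := by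
    refine ⟨(γ + (γ : ℂ)⁻¹ - (β : ℂ)⁻¹ * (α + (α : ℂ)⁻¹)) / (β - (β : ℂ)⁻¹),
      α + (α : ℂ)⁻¹ - (γ + (γ : ℂ)⁻¹ - (β : ℂ)⁻¹ * (α + (α : ℂ)⁻¹)) / (β - (β : ℂ)⁻¹),
      by ring, ?_⟩
    have := div_mul_cancel₀ (γ + (γ : ℂ)⁻¹ - (β : ℂ)⁻¹ * (α + (α : ℂ)⁻¹)) h0
    linear_combination this
  have hdetA : (!![a, 1; a * d - 1, d]).det = 1 := by
    rw [Matrix.det_fin_two_of]; ring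
  let A : GL (Fin 2) ℂ := GeneralLinearGroup.mkOfDetNeZero !![a, 1; a * d - 1, d]
    (by rw [hdetA]; exact one_ne_zero)
  have hA : (A : Matrix (Fin 2) (Fin 2) ℂ) = !![a, 1; a * d - 1, d] := rfl
  obtain ⟨Q, hQ⟩ := exists_eq_conj_diagGL hA one_ne_zero (by ring) htr hα
  have hM : ((diagGL β * A : GL (Fin 2) ℂ) : Matrix (Fin 2) (Fin 2) ℂ) =
      !![β * a, β; (β : ℂ)⁻¹ * (a * d - 1), (β : ℂ)⁻¹ * d] := by
    rw [Units.val_mul, hA, coe_diagGL]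
    simp
  have hinv : (β : ℂ) * (β : ℂ)⁻¹ = 1 := mul_inv_cancel₀ hβ0
  obtain ⟨S, hS⟩ := exists_eq_conj_diagGL hM hβ0
    (by linear_combination hinv) htr' hγ
  exact ⟨Q, S, by rw [← hQ, hS]⟩

/-- Two or more non-scalar conjugacy classes have a product lying in any given non-scalar
conjugacy class. -/
theorem exists_conj_prod_append {V : Type*} [DecidableEq V] {α : V → ℂˣ} {l : List V} {y : V}
    {β γ : ℂˣ} (hy : y ∉ l) (hα : α y ^ 2 ≠ 1) (hβ : β ^ 2 ≠ 1) (hγ : γ ^ 2 ≠ 1)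
    (hl : ∃ (Q : V → GL (Fin 2) ℂ) (S : GL (Fin 2) ℂ),
      (l.map fun w => Q w * diagGL (α w) * (Q w)⁻¹).prod = S * diagGL β * S⁻¹) :
    ∃ (Q : V → GL (Fin 2) ℂ) (S : GL (Fin 2) ℂ),
      ((l ++ [y]).map fun w => Q w * diagGL (α w) * (Q w)⁻¹).prod = S * diagGL γ * S⁻¹ := by
  obtain ⟨Q, S, hQ⟩ := hl
  obtain ⟨R, T, hR⟩ := exists_mul_conj_diagGL hα hβ hγ
  refine ⟨Function.update Q y (S * R), S * T, ?_⟩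
  have : (l.map fun w => Function.update Q y (S * R) w * diagGL (α w) *
      (Function.update Q y (S * R) w)⁻¹) = l.map fun w => Q w * diagGL (α w) * (Q w)⁻¹ :=
    List.map_congr_left fun w hw => by
      rw [Function.update_of_ne (by rintro rfl; exact hy hw)]
  rw [List.map_append, List.prod_append, this, hQ, List.map_singleton, List.prod_singleton,
    Function.update_self]
  calc S * diagGL β * S⁻¹ * (S * R * diagGL (α y) * (S * R)⁻¹)
      = S * (diagGL β * (R * diagGL (α y) * R⁻¹)) * S⁻¹ := by group
    _ = S * T * diagGL γ * (S * T)⁻¹ := by rw [hR]; group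

theorem exists_conj_prod {V : Type*} [DecidableEq V] {α : V → ℂˣ} {l : List V}
    (hα : ∀ w ∈ l, α w ^ 2 ≠ 1) (hl : l ≠ []) (hnd : l.Nodup) :
    ∃ β : ℂˣ, β ^ 2 ≠ 1 ∧ ∃ (Q : V → GL (Fin 2) ℂ) (S : GL (Fin 2) ℂ),
      (l.map fun w => Q w * diagGL (α w) * (Q w)⁻¹).prod = S * diagGL β * S⁻¹ := by
  induction l using List.reverseRecOn with
  | nil => exact absurd rfl hl
  | append_singleton l y ih =>
    rw [← List.concat_eq_append, List.nodup_concat] at hnd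
    have hαy := hα y (by simp)
    by_cases h : l = []
    · subst h
      exact ⟨α y, hαy, fun _ => 1, 1, by simp⟩
    · obtain ⟨β, hβ, hQ⟩ := ih (fun w hw => hα w (by simp [hw])) h hnd.2
      exact ⟨α y, hαy, exists_conj_prod_append hnd.1 hαy hβ hαy hQ⟩

/-- Three or more non-scalar conjugacy classes have a product equal to `±1`. -/
theorem exists_conj_prod_eq_neg_one_pow {V : Type*} [DecidableEq V] {α : V → ℂˣ}
    {l : List V} (hα : ∀ w ∈ l, α w ^ 2 ≠ 1) (hl : 3 ≤ l.length) (hnd : l.Nodup) (n : ℕ) :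
    ∃ Q : V → GL (Fin 2) ℂ,
      (l.map fun w => Q w * diagGL (α w) * (Q w)⁻¹).prod = diagGL (-1) ^ n := by
  induction l using List.reverseRecOn with
  | nil => simp at hl
  | append_singleton l z _ =>
    induction l using List.reverseRecOn with
    | nil => simp at hl
    | append_singleton l y _ =>
      rw [← List.concat_eq_append, List.nodup_concat, ← List.concat_eq_append,
        List.nodup_concat] at hnd
      obtain ⟨hz, hy, hnd⟩ := hnd
      have hne : l ≠ [] := by rintro rfl; simp at hl
      have hγ : ((-1) ^ n * (α z)⁻¹) ^ 2 ≠ 1 := by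
        rw [mul_pow, ← pow_mul, mul_comm n, pow_mul, neg_one_sq, one_pow, one_mul, inv_pow]
        exact inv_ne_one.2 (hα z (by simp))
      obtain ⟨β, hβ, hQ⟩ := exists_conj_prod (fun w hw => hα w (by simp [hw])) hne hnd
      obtain ⟨Q, S, hQ⟩ := exists_conj_prod_append hy (hα y (by simp)) hβ hγ hQ
      refine ⟨Function.update Q z S, ?_⟩
      rw [List.concat_eq_append] at hz
      have : ((l ++ [y]).map fun w => Function.update Q z S w * diagGL (α w) *
          (Function.update Q z S w)⁻¹) =
          (l ++ [y]).map fun w => Q w * diagGL (α w) * (Q w)⁻¹ :=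
        List.map_congr_left fun w hw => by
          rw [Function.update_of_ne (by rintro rfl; exact hz hw)]
      rw [List.map_append, List.prod_append, this, hQ, List.map_singleton, List.prod_singleton,
        Function.update_self]
      calc S * diagGL ((-1) ^ n * (α z)⁻¹) * S⁻¹ * (S * diagGL (α z) * S⁻¹)
          = S * (diagGL ((-1) ^ n * (α z)⁻¹) * diagGL (α z)) * S⁻¹ := by group
        _ = S * diagGL (-1) ^ n * S⁻¹ := by rw [← map_mul, inv_mul_cancel_right, map_pow]
        _ = diagGL (-1) ^ n := by
          rw [← ((commute_diagGL_neg_one S).pow_left n).eq, mul_inv_cancel_right]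

/-- There is an element of order `2 * p` whose `p`-th power is `-1`. -/
theorem exists_zpow_eq_neg_one {p : ℤ} (hp : 0 < p) :
    ∃ ζ : ℂˣ, ζ ^ p = -1 ∧ ∀ k : ℤ, 0 < k → k < p → (ζ ^ k) ^ 2 ≠ 1 := by
  lift p to ℕ using hp.le
  have hp' : p ≠ 0 := by omega
  have h := Complex.isPrimitiveRoot_exp (2 * p) (by omega)
  obtain ⟨ζ, hζ⟩ := h.isUnit (by omega)
  rw [← hζ, IsPrimitiveRoot.coe_units_iff] at h
  refine ⟨ζ, ?_, fun k hk hkp h1 => ?_⟩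
  · have := (IsPrimitiveRoot.coe_units_iff.2
      (h.pow (by omega) (mul_comm 2 p))).eq_neg_one_of_two_right
    rw [zpow_natCast]
    exact Units.ext (by simpa using this)
  · rw [← zpow_natCast, ← _root_.zpow_mul, h.zpow_eq_one_iff_dvd] at h1
    have := Int.le_of_dvd (by positivity) h1
    push_cast at this
    omega

end Matrices

/-! ### Solutions on branches -/

section Solutions

variable {V : Type u} [Fintype V] [LinearOrder V] {G : SimpleGraph V} [DecidableRel G.Adj]
  {m : V → ℕ}

/-- The relations of the branch can be solved by positive powers of a single element, the
exponents being smaller than the one at the vertex from which the branch hangs. -/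
def IsCyclicBranch (G : SimpleGraph V) [DecidableRel G.Adj] (m : V → ℕ) (v w : V) : Prop :=
  ∃ e : V → ℤ, ∀ u ∈ branch G v w,
    m u * e u = ∑ u' ∈ G.neighborFinset u, e u' ∧ 0 < e u ∧ e u < e v

/-- The relations of the branch can be solved by nontrivial elements in such a way that the
elements at `v` and `w` are independent. -/
def IsFreeBranch (G : SimpleGraph V) [DecidableRel G.Adj] (m : V → ℕ) (v w : V) : Prop :=
  ∃ (H : Type u) (_ : Group H) (g : V → H), (∀ u ∈ branch G v w, Sat G m g u ∧ g u ≠ 1) ∧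
    ∀ i j : ℤ, g v ^ i * g w ^ j = 1 → i = 0 ∧ j = 0

/-- The relations of the branch can be solved by nontrivial elements in such a way that the
element at `v` has infinite order and the element at `w` is not one of its powers. -/
def IsIncompressibleBranch (G : SimpleGraph V) [DecidableRel G.Adj] (m : V → ℕ) (v w : V) :
    Prop :=
  ∃ (H : Type u) (_ : Group H) (g : V → H), (∀ u ∈ branch G v w, Sat G m g u ∧ g u ≠ 1) ∧
    (∀ i : ℤ, g v ^ i = 1 → i = 0) ∧ g w ∉ Subgroup.zpowers (g v)

theorem IsFreeBranch.isIncompressibleBranch {v w : V} (h : IsFreeBranch G m v w) :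
    IsIncompressibleBranch G m v w := by
  obtain ⟨H, _, g, hg, hind⟩ := h
  refine ⟨H, _, g, hg, fun i hi => (hind i 0 (by simpa using hi)).1, ?_⟩
  rintro ⟨k, hk⟩
  have := (hind (-k) 1 (by simp [← hk])).2
  omega

theorem exists_infinite_order :
    ∃ (H : Type u) (_ : Group H) (s : H), ∀ k : ℤ, s ^ k = 1 → k = 0 := by
  refine ⟨ULift.{u} (Multiplicative ℤ), inferInstance, ⟨Multiplicative.ofAdd 1⟩, fun k hk => ?_⟩
  have h : (Multiplicative.ofAdd (1 : ℤ)) ^ k = 1 := congrArg ULift.down hk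
  simpa [← ofAdd_zsmul] using h

theorem IsCyclicBranch.isIncompressibleBranch {v w : V} (hvw : G.Adj v w)
    (h : IsCyclicBranch G m v w) : IsIncompressibleBranch G m v w := by
  obtain ⟨e, he⟩ := h
  obtain ⟨H, _, s, hs⟩ := exists_infinite_order.{u}
  obtain ⟨-, hw, hwv⟩ := he w (mem_branch_right hvw)
  refine ⟨H, _, fun u => s ^ e u, fun u hu => ⟨sat_zpow _ (by rw [(he u hu).1]), ?_⟩, ?_, ?_⟩
  · exact fun h => (he u hu).2.1.ne' (hs _ h)
  · intro i hi
    simp only [← zpow_mul] at hi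
    exact (mul_eq_zero.1 (hs _ hi)).resolve_left (by omega)
  · rintro ⟨k, hk⟩
    simp only [← zpow_mul] at hk
    have hk' := hs (e v * k - e w) (by rw [zpow_sub, hk, mul_inv_cancel])
    rcases lt_trichotomy k 0 with h | h | h
    · nlinarith
    · subst h; omega
    · nlinarith

/-- A branch whose root has at least two children is free. -/
theorem isFreeBranch_of_ne (hG : G.IsTree) {v w w₁ w₂ : V} (hvw : G.Adj v w)
    (h : ∀ w', G.Adj w w' → w' ≠ v → IsIncompressibleBranch G m w w')
    (h₁ : G.Adj w w₁) (h₂ : G.Adj w w₂) (hv₁ : w₁ ≠ v) (hv₂ : w₂ ≠ v) (h₁₂ : w₁ ≠ w₂) :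
    IsFreeBranch G m v w := by
  obtain ⟨c, hnd, hmem, hext⟩ := exists_list_extend hG hvw m
  have hadj : ∀ i : {u // u ∈ c}, G.Adj w i := fun i => ((hmem i).1 i.2).1
  have h' : ∀ i : {u // u ∈ c}, IsIncompressibleBranch G m w i := fun i =>
    h i (hadj i) ((hmem i).1 i.2).2
  choose H _ g hg hinf hnot using h'
  obtain ⟨K, _, f, z, hf, hfz, hword⟩ :=
    exists_amalgam_zpowers H (fun i => g i w) (fun i => g i i) hinf hnot
  classical
  let k : V → K := fun u =>
    if h : ∃ i : {u // u ∈ c}, u ∈ branch G w i then f h.choose (g h.choose u) else z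
  have hk : ∀ (i : {u // u ∈ c}) (u : V), u ∈ branch G w i → k u = f i (g i u) := by
    intro i u hu
    have hex : ∃ i : {u // u ∈ c}, u ∈ branch G w i := ⟨i, hu⟩
    have : hex.choose = i :=
      Subtype.ext (eq_of_closer hG (hadj _) (hadj i) hex.choose_spec hu)
    simp only [k, dif_pos hex]
    rw [this]
  have hkw : k w = z := dif_neg fun ⟨i, hi⟩ => notMem_branch_left hi
  have hz : ∀ n : ℤ, z ^ n = 1 → n = 0 := by
    intro n hn
    let i : {u // u ∈ c} := ⟨w₁, (hmem w₁).2 ⟨h₁, hv₁⟩⟩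
    refine hinf i n (hf i ?_)
    rw [map_zpow, hfz, hn, map_one]
  have hkw1 : k w ≠ 1 := fun h1 => one_ne_zero (hz 1 (by rw [← hkw, h1, one_zpow]))
  have hsat : ∀ w' ∈ c, ∀ u ∈ branch G w w', Sat G m k u ∧ k u ≠ 1 := by
    intro w' hw' u hu
    obtain ⟨hs, hne⟩ := hg ⟨w', hw'⟩ u hu
    refine ⟨hs.map (f ⟨w', hw'⟩) (hk ⟨w', hw'⟩ u hu) fun u' hu' => ?_, ?_⟩
    · rcases adj_mem_branch hG (hadj ⟨w', hw'⟩) hu hu' with h | ⟨-, rfl⟩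
      · exact hk ⟨w', hw'⟩ u' h
      · rw [hkw, hfz]
    · rw [hk ⟨w', hw'⟩ u hu]
      exact fun h1 => hne (hf _ (h1.trans (map_one _).symm))
  refine ⟨K, _, _, hext K k hkw1 hsat, fun i j hij => ?_⟩
  rw [Function.update_self, Function.update_of_ne hvw.ne', hkw] at hij
  have hP : (c.map k).prod = (c.attach.map fun i => f i (g i i)).prod := by
    conv_lhs => rw [← List.attach_map_val (l := c)]
    exact congrArg List.prod <|
      List.map_congr_left fun i _ => hk i i (mem_branch_right (hadj i))
  have hcomm : Commute z (c.map k).prod := by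
    refine Commute.list_prod_right _ _ fun y hy => ?_
    obtain ⟨w', hw', rfl⟩ := List.mem_map.1 hy
    rw [← hkw]
    exact ((hsat w' hw' w' (mem_branch_right (hadj ⟨w', hw'⟩))).1.1 _ (hadj ⟨w', hw'⟩).symm).symm
  have hlen : 2 ≤ c.attach.length := by
    rw [List.length_attach, ← List.toFinset_card_of_nodup hnd]
    refine Finset.one_lt_card.2 ⟨w₁, ?_, w₂, ?_, h₁₂⟩ <;> simp [*]
  have hi : i = 0 := by
    refine hword c.attach (List.nodup_attach.2 hnd) hlen i ⟨m w * i + j, ?_⟩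
    simp only
    rw [← hP]
    rw [((hcomm.pow_left (m w)).inv_right).mul_zpow, inv_zpow] at hij
    rw [zpow_add, zpow_mul, zpow_natCast]
    have hc := (((hcomm.zpow_zpow j i)).inv_right).eq
    rw [mul_assoc, ← hc, ← mul_assoc, mul_inv_eq_one] at hij
    exact hij
  subst hi
  exact ⟨rfl, hz j (by simpa using hij)⟩

theorem isCyclicBranch_or_isFreeBranch (hG : G.IsTree) (hm : ∀ v, 2 ≤ m v) {v w : V}
    (hvw : G.Adj v w) :
    IsCyclicBranch G m v w ∨ (IsFreeBranch G m v w ∧ ∃ z, 3 ≤ G.degree z) := by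
  induction hn : (branch G v w).ncard using Nat.strong_induction_on generalizing v w with
  | _ n ih =>
  subst hn
  have ih' : ∀ w', G.Adj w w' → w' ≠ v →
      IsCyclicBranch G m w w' ∨ (IsFreeBranch G m w w' ∧ ∃ z, 3 ≤ G.degree z) := by
    intro w' hw' hne
    refine ih _ (Set.ncard_lt_ncard ?_ (Set.toFinite _)) hw' rfl
    exact ⟨branch_subset hG hvw hw' hne, fun h => notMem_branch_left (h (mem_branch_right hvw))⟩
  by_cases h2 : ∃ w₁ w₂, G.Adj w w₁ ∧ G.Adj w w₂ ∧ w₁ ≠ v ∧ w₂ ≠ v ∧ w₁ ≠ w₂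
  · obtain ⟨w₁, w₂, h₁, h₂, hv₁, hv₂, h₁₂⟩ := h2
    refine .inr ⟨isFreeBranch_of_ne hG hvw (fun w' hw' hne => ?_) h₁ h₂ hv₁ hv₂ h₁₂, w, ?_⟩
    · rcases ih' w' hw' hne with h | h
      · exact h.isIncompressibleBranch hw'
      · exact h.1.isIncompressibleBranch
    · rw [← card_neighborFinset_eq_degree]
      exact Finset.two_lt_card.2 ⟨v, by simpa using hvw.symm, w₁, by simpa using h₁, w₂,
        by simpa using h₂, hv₁.symm, hv₂.symm, h₁₂⟩
  have hmw : (2 : ℤ) ≤ m w := by exact_mod_cast hm w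
  by_cases h1 : ∃ w', G.Adj w w' ∧ w' ≠ v
  · obtain ⟨w', hw', hne⟩ := h1
    have huniq : ∀ u, G.Adj w u ∧ u ≠ v ↔ u = w' := by
      refine fun u => ⟨fun hu => ?_, ?_⟩
      · by_contra hu'
        exact h2 ⟨u, w', hu.1, hw', hu.2, hne, hu'⟩
      · rintro rfl
        exact ⟨hw', hne⟩
    have hbr : ∀ u ∈ branch G v w, u = w ∨ u ∈ branch G w w' := fun u hu => by
      rcases mem_branch_cases hG hu with h | ⟨z, hz, hzv, hu'⟩
      · exact .inl h
      · obtain rfl := (huniq z).1 ⟨hz, hzv⟩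
        exact .inr hu'
    rcases ih' w' hw' hne with ⟨e, he⟩ | ⟨⟨H, _, g, hg, hind⟩, hz⟩
    · left
      have hw'w := (he w' (mem_branch_right hw')).2
      refine ⟨Function.update e v (m w * e w - e w'), fun u hu => ?_⟩
      have huv : u ≠ v := by rintro rfl; exact notMem_branch_left hu
      rw [Function.update_self, Function.update_of_ne huv]
      rcases hbr u hu with rfl | hu'
      · have hnb : G.neighborFinset u = {v, w'} := by
          ext z
          have := huniq z
          have := hvw.symm
          simp only [mem_neighborFinset, Finset.mem_insert, Finset.mem_singleton]
          constructor
          · tauto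
          · rintro (rfl | rfl) <;> assumption
        rw [hnb, Finset.sum_pair hne.symm, Function.update_self, Function.update_of_ne hne]
        refine ⟨by ring, by omega, by nlinarith⟩
      · obtain ⟨hs, h0, hlt⟩ := he u hu'
        refine ⟨?_, h0, by nlinarith⟩
        rw [hs]
        refine Finset.sum_congr rfl fun z hz => (Function.update_of_ne ?_ _ _).symm
        rw [mem_neighborFinset] at hz
        rintro rfl
        rcases adj_mem_branch hG hw' hu' hz with h | ⟨-, h⟩
        · exact notMem_branch_left (branch_subset hG hvw hw' hne h)
        · exact hvw.ne h
    · refine .inr ⟨?_, hz⟩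
      obtain ⟨c, hnd, hmem, hext⟩ := exists_list_extend hG hvw m
      have hc : c = [w'] := List.perm_singleton.1
        ((List.perm_ext_iff_of_nodup hnd (List.nodup_singleton _)).2 fun u => by
          rw [hmem, huniq, List.mem_singleton])
      subst hc
      have hgw : g w ≠ 1 := fun h => one_ne_zero (hind 1 0 (by simp [h])).1
      refine ⟨H, _, _, hext H g hgw (by simpa using hg), fun i j hij => ?_⟩
      have hcomm : Commute (g w) (g w') :=
        ((hg w' (mem_branch_right hw')).1.1 _ hw'.symm).symm
      rw [Function.update_self, Function.update_of_ne hvw.ne', List.map_singleton,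
        List.prod_singleton, ((hcomm.pow_left (m w)).inv_right).mul_zpow, mul_assoc, inv_zpow,
        ← (hcomm.zpow_zpow j i).inv_right.eq, ← mul_assoc, ← zpow_natCast, ← zpow_mul, ← zpow_add,
        ← zpow_neg] at hij
      obtain ⟨h₁, h₂⟩ := hind _ _ hij
      obtain rfl : i = 0 := by omega
      exact ⟨rfl, by simpa using h₁⟩
  · left
    push Not at h1
    refine ⟨Function.update (fun _ => 1) v (m w), fun u hu => ?_⟩
    obtain rfl : u = w := by
      rcases mem_branch_cases hG hu with h | ⟨z, hz, hzv, -⟩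
      · exact h
      · exact absurd (h1 z hz) hzv
    have hnb : G.neighborFinset u = {v} := by
      ext z
      rw [mem_neighborFinset, Finset.mem_singleton]
      exact ⟨h1 z, by rintro rfl; exact hvw.symm⟩
    rw [hnb, Finset.sum_singleton, Function.update_self, Function.update_of_ne hvw.ne']
    refine ⟨by ring, by omega, by omega⟩

/-! ### Assembling the branches -/

theorem of_ne_one_of_exponents {e : V → ℤ} {n : ℕ} (he : ∀ u, 0 < e u ∧ e u < n)
    (hrel : ∀ u, (n : ℤ) ∣ m u * e u - ∑ u' ∈ G.neighborFinset u, e u') (v : V) :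
    PresentedGroup.of (rels := treeRelators G m) v ≠ 1 := by
  have hs : ∀ k : ℤ, (Multiplicative.ofAdd (1 : ZMod n)) ^ k = 1 ↔ (n : ℤ) ∣ k := fun k => by
    rw [← ofAdd_zsmul, ofAdd_eq_one, zsmul_one, ZMod.intCast_zmod_eq_zero_iff_dvd]
  refine of_ne_one_of_sat (g := fun u => (Multiplicative.ofAdd (1 : ZMod n)) ^ e u)
    (fun u => sat_zpow _ ?_) fun h => ?_
  · rw [← mul_inv_eq_one, ← zpow_sub, hs]
    exact hrel u
  · have := Int.le_of_dvd (he v).1 ((hs _).1 h)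
    have := (he v).2
    omega

theorem of_ne_one_of_degree_le (hG : G.IsTree) (hm : ∀ v, 2 ≤ m v) (hd : ∀ z, G.degree z < 3)
    (v : V) : PresentedGroup.of (rels := treeRelators G m) v ≠ 1 := by
  rcases subsingleton_or_nontrivial V with hV | hV
  · refine of_ne_one_of_exponents (e := fun _ => 1) (n := m v) (fun u => ?_) (fun u => ?_) v
    · have := hm v
      omega
    · simp [Subsingleton.elim u v]
  · obtain ⟨r, hr⟩ := hG.exists_vert_degree_one_of_nontrivial
    rw [← card_neighborFinset_eq_degree, Finset.card_eq_one] at hr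
    obtain ⟨w, hw⟩ := hr
    have hadj : ∀ u, G.Adj r u ↔ u = w := fun u => by
      rw [← mem_neighborFinset, hw, Finset.mem_singleton]
    have hrw : G.Adj r w := (hadj w).2 rfl
    rcases isCyclicBranch_or_isFreeBranch hG hm hrw with ⟨e, he⟩ | ⟨-, z, hz⟩
    swap
    · exact absurd hz (hd z).not_ge
    obtain ⟨-, h0, hlt⟩ := he w (mem_branch_right hrw)
    have hmr : (2 : ℤ) ≤ m r := by exact_mod_cast hm r
    have hn : e r < m r * e r - e w := by nlinarith
    have hcast : ((m r * e r - e w).toNat : ℤ) = m r * e r - e w := Int.toNat_of_nonneg (by omega)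
    have hcases : ∀ u, u = r ∨ u ∈ branch G r w := by
      intro u
      by_cases hu : u = r
      · exact .inl hu
      · obtain ⟨w', hw', hu'⟩ := exists_mem_branch hG hu
        obtain rfl := (hadj w').1 hw'
        exact .inr hu'
    refine of_ne_one_of_exponents (e := e) (n := (m r * e r - e w).toNat) (fun u => ?_)
      (fun u => ?_) v <;> rw [hcast]
    · rcases hcases u with rfl | hu
      · omega
      · have := he u hu
        omega
    · rcases hcases u with rfl | hu
      · rw [hw, Finset.sum_singleton]
      · rw [(he u hu).1, sub_self]
        exact dvd_zero _

theorem of_ne_one_of_isFreeBranch (hG : G.IsTree) {v w : V} (hvw : G.Adj v w)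
    (h₁ : IsFreeBranch G m v w) (h₂ : IsFreeBranch G m w v) (z : V) :
    PresentedGroup.of (rels := treeRelators G m) z ≠ 1 := by
  obtain ⟨H₁, _, g₁, hg₁, hind₁⟩ := h₁
  obtain ⟨H₂, _, g₂, hg₂, hind₂⟩ := h₂
  have hcomm₁ := (hg₁ w (mem_branch_right hvw)).1.1 v hvw.symm
  have hcomm₂ := (hg₂ v (mem_branch_right hvw.symm)).1.1 w hvw
  obtain ⟨K, _, f₁, f₂, hf₁, hf₂, hv, hw⟩ :
      ∃ (K : Type u) (_ : Group K) (f₁ : H₁ →* K) (f₂ : H₂ →* K), Function.Injective f₁ ∧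
        Function.Injective f₂ ∧ f₁ (g₁ v) = f₂ (g₂ v) ∧ f₁ (g₁ w) = f₂ (g₂ w) := by
    let H : ULift.{u} Bool → Type u := fun b => bif b.down then H₁ else H₂
    let _ : ∀ b, Group (H b) := fun b => match b with
      | ⟨true⟩ => ‹Group H₁›
      | ⟨false⟩ => ‹Group H₂›
    let x : V → ∀ b, H b := fun u b => match b with
      | ⟨true⟩ => g₁ u
      | ⟨false⟩ => g₂ u
    obtain ⟨K, _, f, hf, hx, hh⟩ := exists_amalgam_pair H (x v) (x w)
      (fun b => match b with
        | ⟨true⟩ => hcomm₁.symm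
        | ⟨false⟩ => hcomm₂)
      (fun b => match b with
        | ⟨true⟩ => hind₁
        | ⟨false⟩ => fun k n h => (hind₂ n k (by
            rw [← h]; exact (hcomm₂.zpow_zpow k n).eq.symm)).symm)
    exact ⟨K, _, f ⟨true⟩, f ⟨false⟩, hf _, hf _, hx _ _, hh _ _⟩
  classical
  let g : V → K := fun u => if u ∈ branch G v w then f₁ (g₁ u) else f₂ (g₂ u)
  have hga : ∀ u ∈ branch G v w, g u = f₁ (g₁ u) := fun u hu => if_pos hu
  have hgb : ∀ u ∈ branch G w v, g u = f₂ (g₂ u) := fun u hu => if_neg (notMem_branch_of_mem hu)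
  have hgv : g v = f₁ (g₁ v) := (hgb v (mem_branch_right hvw.symm)).trans hv.symm
  have hgw : g w = f₂ (g₂ w) := (hga w (mem_branch_right hvw)).trans hw
  refine of_ne_one_of_sat (g := g) (fun u => ?_) ?_
  · rcases mem_branch_or hG hvw u with hu | hu
    · refine (hg₁ u hu).1.map f₁ (hga u hu) fun u' hu' => ?_
      rcases adj_mem_branch hG hvw hu hu' with h | ⟨-, rfl⟩
      · exact hga u' h
      · exact hgv
    · refine (hg₂ u hu).1.map f₂ (hgb u hu) fun u' hu' => ?_
      rcases adj_mem_branch hG hvw.symm hu hu' with h | ⟨-, rfl⟩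
      · exact hgb u' h
      · exact hgw
  · rcases mem_branch_or hG hvw z with hz | hz
    · rw [hga z hz]
      exact fun h => (hg₁ z hz).2 (hf₁ (h.trans (map_one _).symm))
    · rw [hgb z hz]
      exact fun h => (hg₂ z hz).2 (hf₂ (h.trans (map_one _).symm))

theorem of_ne_one_of_isCyclicBranch (hG : G.IsTree) {v : V} (hd : 3 ≤ G.degree v)
    (h : ∀ w, G.Adj v w → IsCyclicBranch G m v w) (z : V) :
    PresentedGroup.of (rels := treeRelators G m) z ≠ 1 := by
  choose! e he using h
  have hpos : ∀ w, G.Adj v w → 0 < e w v := fun w hw => by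
    have := he w hw w (mem_branch_right hw)
    omega
  have hζ : ∀ w, ∃ ζ : ℂˣ, G.Adj v w → ζ ^ e w v = -1 ∧
      ∀ k : ℤ, 0 < k → k < e w v → (ζ ^ k) ^ 2 ≠ 1 := fun w => by
    by_cases hw : G.Adj v w
    · obtain ⟨ζ, hζ⟩ := exists_zpow_eq_neg_one (hpos w hw)
      exact ⟨ζ, fun _ => hζ⟩
    · exact ⟨1, fun h => absurd h hw⟩
  choose ζ hζ using hζ
  have hel : ∀ w, w ∈ (G.neighborFinset v).sort (· ≤ ·) ↔ G.Adj v w := by simp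
  have hlt : ∀ w, G.Adj v w → ∀ u ∈ branch G v w, (ζ w ^ e w u) ^ 2 ≠ 1 := fun w hw u hu =>
    (hζ w hw).2 _ (he w hw u hu).2.1 (he w hw u hu).2.2
  obtain ⟨Q, hQ⟩ := exists_conj_prod_eq_neg_one_pow (α := fun w => ζ w ^ e w w)
    (l := (G.neighborFinset v).sort (· ≤ ·))
    (fun w hw => hlt w ((hel w).1 hw) w (mem_branch_right ((hel w).1 hw)))
    (by simpa using hd) (Finset.sort_nodup _ _) (m v)
  choose! b hb using fun u (hu : u ≠ v) => exists_mem_branch hG hu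
  let g : V → GL (Fin 2) ℂ := fun u =>
    if u = v then diagGL (-1) else Q (b u) * diagGL (ζ (b u) ^ e (b u) u) * (Q (b u))⁻¹
  have hgv : g v = diagGL (-1) := if_pos rfl
  have hne : ∀ w, ∀ u ∈ branch G v w, u ≠ v := by
    rintro w u hu rfl
    exact notMem_branch_left hu
  have hgu : ∀ w, G.Adj v w → ∀ u ∈ branch G v w,
      g u = Q w * diagGL (ζ w ^ e w u) * (Q w)⁻¹ := fun w hw u hu => by
    have huv := hne w u hu
    obtain rfl := eq_of_closer hG hw (hb u huv).1 hu (hb u huv).2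
    exact if_neg huv
  refine of_ne_one_of_sat (g := g) (fun u => ?_) ?_
  · by_cases hu : u = v
    · subst hu
      refine ⟨fun u' _ => hgv ▸ commute_diagGL_neg_one _, ?_⟩
      rw [hgv, ← hQ]
      congr 1
      refine List.map_congr_left fun w hw => (hgu w ((hel w).1 hw) w ?_).symm
      exact mem_branch_right ((hel w).1 hw)
    · obtain ⟨w, hw, hu⟩ := exists_mem_branch hG hu
      have hs : Sat G m (fun u => ζ w ^ e w u) u := sat_zpow _ (by rw [(he w hw u hu).1])
      refine hs.map ((MulAut.conj (Q w)).toMonoidHom.comp diagGL) (hgu w hw u hu)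
        fun u' hu' => ?_
      rcases adj_mem_branch hG hw hu hu' with h | ⟨-, rfl⟩
      · exact hgu w hw u' h
      · simp only [MonoidHom.comp_apply, (hζ w hw).1, hgv]
        exact (mul_inv_eq_of_eq_mul (commute_diagGL_neg_one (Q w)).eq.symm).symm
  · by_cases hz : z = v
    · subst hz
      rw [hgv]
      refine diagGL_ne_one fun h => ?_
      have := congrArg Units.val h
      norm_num at this
    · obtain ⟨w, hw, hz⟩ := exists_mem_branch hG hz
      rw [hgu w hw z hz, Ne, conj_eq_one_iff]
      exact diagGL_ne_one fun h => hlt w hw z hz (by rw [h, one_pow])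

theorem isFreeBranch_of_degree (hG : G.IsTree) (hm : ∀ v, 2 ≤ m v) {v w : V} (hvw : G.Adj v w)
    (hd : 3 ≤ G.degree w) : IsFreeBranch G m v w := by
  have hcard : 1 < ((G.neighborFinset w).erase v).card := by
    rw [Finset.card_erase_of_mem (by simpa using hvw.symm), card_neighborFinset_eq_degree]
    omega
  obtain ⟨w₁, h₁, w₂, h₂, h₁₂⟩ := Finset.one_lt_card.1 hcard
  simp only [Finset.mem_erase, mem_neighborFinset] at h₁ h₂
  refine isFreeBranch_of_ne hG hvw (fun w' hw' _ => ?_) h₁.2 h₂.2 h₁.1 h₂.1 h₁₂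
  rcases isCyclicBranch_or_isFreeBranch hG hm hw' with h | h
  · exact h.isIncompressibleBranch hw'
  · exact h.1.isIncompressibleBranch

end Solutions

end TreePlumbing

/-- **Weak Plumbing Theorem A, case of a tree of smooth rational curves.**
Let `G` be a finite tree on a linearly ordered vertex set `V` and let `m_v ≥ 2` for each
vertex. Let `Γ` be the group generated by the `γ_v` (`v ∈ V`) subject to the relations
`γ_vγ_w = γ_wγ_v` for each edge `{v,w}` and `γ_v^{m_v} = ∏_{w ∼ v} γ_w` for each vertex `v`
(neighbours ordered by the linear order). Then each `γ_v` is nontrivial in `Γ`. -/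
theorem tree_plumbing_generators_nontrivial {V : Type*} [Fintype V] [LinearOrder V]
    (G : SimpleGraph V) [DecidableRel G.Adj] (hG : G.IsTree)
    (m : V → ℕ) (hm : ∀ v, 2 ≤ m v) :
    ∀ v : V, (PresentedGroup.of (rels := treeRelators G m) v) ≠ 1 := by
  intro z
  by_cases hd : ∃ v, 3 ≤ G.degree v
  · obtain ⟨v, hd⟩ := hd
    by_cases h : ∀ w, G.Adj v w → TreePlumbing.IsCyclicBranch G m v w
    · exact TreePlumbing.of_ne_one_of_isCyclicBranch hG hd h z
    · push Not at h
      obtain ⟨w, hvw, hw⟩ := h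
      exact TreePlumbing.of_ne_one_of_isFreeBranch hG hvw
        ((TreePlumbing.isCyclicBranch_or_isFreeBranch hG hm hvw).resolve_left hw).1
        (TreePlumbing.isFreeBranch_of_degree hG hm hvw.symm hd) z
  · push Not at hd
    exact TreePlumbing.of_ne_one_of_degree_le hG hm hd z
end

section
/- Fix integers m ≥ 2, r ≥ 3, and bᵢ, dᵢ with bᵢ > dᵢ ≥ 1 for i = 1, …, r. Then the central element γ is nontrivial in the group Γ(m; b₁,…,b_r; d₁,…,d_r). -/
/-- Relators of the group `Γ(m; b₁,…,b_r; d₁,…,d_r)`: the generator `none` is `γ`, the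
generator `some i` is `βᵢ`, and the relations are `γ = βᵢ^{bᵢ}` for each `i` together with
`γ^m = β₁^{d₁}β₂^{d₂}⋯β_r^{d_r}`. -/
def combRelators (m : ℕ) {r : ℕ} (b d : Fin r → ℕ) : Set (FreeGroup (Option (Fin r))) :=
  (Set.range fun i : Fin r =>
    FreeGroup.of (some i) ^ (b i) * (FreeGroup.of (none : Option (Fin r)))⁻¹) ∪
  {(List.ofFn fun i : Fin r => FreeGroup.of (some i) ^ (d i)).prod *
    ((FreeGroup.of (none : Option (Fin r))) ^ m)⁻¹}

/-- The group `Γ(m; b₁,…,b_r; d₁,…,d_r)`. -/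
abbrev CombGroup (m : ℕ) {r : ℕ} (b d : Fin r → ℕ) : Type :=
  PresentedGroup (combRelators m b d)

/-- The central element `γ` of `Γ(m; b₁,…,b_r; d₁,…,d_r)`. -/
def combGamma (m : ℕ) {r : ℕ} (b d : Fin r → ℕ) : CombGroup m b d :=
  PresentedGroup.of none

/-- The diagonal torus `a ↦ diag(a, a⁻¹)` of `GL₂(ℂ)`. -/
def diagTorus : ℂˣ →* (Matrix (Fin 2) (Fin 2) ℂ)ˣ :=
  MonoidHom.mk' (fun a =>
    ⟨!![(a : ℂ), 0; 0, ((a⁻¹ : ℂˣ) : ℂ)], !![((a⁻¹ : ℂˣ) : ℂ), 0; 0, (a : ℂ)],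
      by simp [Matrix.one_fin_two], by simp [Matrix.one_fin_two]⟩)
    (fun a b => Units.ext (by simp [mul_comm]))

lemma coe_diagTorus (a : ℂˣ) :
    (diagTorus a : Matrix (Fin 2) (Fin 2) ℂ) = !![(a : ℂ), 0; 0, (a : ℂ)⁻¹] := by
  simp [diagTorus]

lemma diagTorus_neg_one_ne_one : diagTorus (-1) ≠ 1 := by
  intro h
  have h00 := congrArg (fun g : (Matrix (Fin 2) (Fin 2) ℂ)ˣ => g.val 0 0) h
  norm_num [coe_diagTorus] at h00

lemma commute_diagTorus_neg_one (g : (Matrix (Fin 2) (Fin 2) ℂ)ˣ) :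
    Commute (diagTorus (-1)) g := by
  have h : diagTorus (-1) = -1 := Units.ext (by
    simp [coe_diagTorus, Matrix.one_fin_two, inv_neg])
  rw [h]
  exact (Commute.one_left g).neg_left

lemma isConj_diagTorus_of_mul_eq {a : ℂˣ} {M : (Matrix (Fin 2) (Fin 2) ℂ)ˣ}
    (P : Matrix (Fin 2) (Fin 2) ℂ) (hP : P.det ≠ 0)
    (h : P * !![(a : ℂ), 0; 0, (a : ℂ)⁻¹] = (M : Matrix (Fin 2) (Fin 2) ℂ) * P) :
    IsConj (diagTorus a) M := by
  have hu : IsUnit P := (Matrix.isUnit_iff_isUnit_det P).2 hP.isUnit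
  refine isConj_iff.2 ⟨hu.unit, mul_inv_eq_iff_eq_mul.2 (Units.ext ?_)⟩
  simpa [coe_diagTorus] using h

lemma units_sub_inv_ne_zero {a : ℂˣ} (ha : a ^ 2 ≠ 1) : (a : ℂ) - (a : ℂ)⁻¹ ≠ 0 := by
  intro h
  refine ha (Units.ext ?_)
  have := a.ne_zero
  field_simp at h
  push_cast
  linear_combination h

/-- A `2 × 2` matrix with determinant `1`, trace `a + a⁻¹` (`a² ≠ 1`) and nonzero upper right
entry is conjugate to `diag(a, a⁻¹)`. -/
lemma isConj_diagTorus_of_upper_right_ne_zero {a : ℂˣ} (ha : a ^ 2 ≠ 1)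
    {M : (Matrix (Fin 2) (Fin 2) ℂ)ˣ} {x y z w : ℂ}
    (hM : (M : Matrix (Fin 2) (Fin 2) ℂ) = !![x, y; z, w]) (hy : y ≠ 0)
    (hdet : x * w - y * z = 1) (htr : x + w = a + (a : ℂ)⁻¹) : IsConj (diagTorus a) M := by
  have ha0 : (a : ℂ) * (a : ℂ)⁻¹ = 1 := mul_inv_cancel₀ a.ne_zero
  refine isConj_diagTorus_of_mul_eq !![y, y; (a : ℂ) - x, (a : ℂ)⁻¹ - x] ?_ ?_
  · rw [Matrix.det_fin_two_of]
    intro h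
    refine mul_ne_zero hy (units_sub_inv_ne_zero ha) ?_
    linear_combination -h
  · rw [hM]
    ext i j
    fin_cases i <;> fin_cases j <;> simp [Matrix.mul_apply, Fin.sum_univ_two]
    · ring
    · ring
    · linear_combination (-(a : ℂ)) * htr + hdet - ha0
    · linear_combination (-(a : ℂ)⁻¹) * htr + hdet - ha0

/-- Multiplying by a suitable element of a regular semisimple conjugacy class moves a regular
semisimple matrix into any prescribed regular semisimple class of determinant `1`. -/
lemma exists_isConj_diagTorus_mul {a b c : ℂˣ} (ha : a ^ 2 ≠ 1) (hb : b ^ 2 ≠ 1) (hc : c ^ 2 ≠ 1)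
    {M : (Matrix (Fin 2) (Fin 2) ℂ)ˣ} (hM : IsConj (diagTorus a) M) :
    ∃ h, IsConj (diagTorus b) h ∧ IsConj (diagTorus c) (h * M) := by
  have ha0 : (a : ℂ) * (a : ℂ)⁻¹ = 1 := mul_inv_cancel₀ a.ne_zero
  have hb0 : (b : ℂ) * (b : ℂ)⁻¹ = 1 := mul_inv_cancel₀ b.ne_zero
  have hb1 := units_sub_inv_ne_zero hb
  set t : ℂ := c + (c : ℂ)⁻¹ - a * b - (a : ℂ)⁻¹ * (b : ℂ)⁻¹ with ht
  let g : (Matrix (Fin 2) (Fin 2) ℂ)ˣ := Matrix.GeneralLinearGroup.mkOfDetNeZero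
    !![(a : ℂ), 1; 0, (a : ℂ)⁻¹] (by simp [Matrix.det_fin_two_of])
  let h : (Matrix (Fin 2) (Fin 2) ℂ)ˣ := Matrix.GeneralLinearGroup.mkOfDetNeZero
    !![(b : ℂ), 0; t, (b : ℂ)⁻¹] (by simp [Matrix.det_fin_two_of])
  have hg_coe : (g : Matrix (Fin 2) (Fin 2) ℂ) = !![(a : ℂ), 1; 0, (a : ℂ)⁻¹] := rfl
  have hh_coe : (h : Matrix (Fin 2) (Fin 2) ℂ) = !![(b : ℂ), 0; t, (b : ℂ)⁻¹] := rfl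
  have hg : IsConj (diagTorus a) g :=
    isConj_diagTorus_of_upper_right_ne_zero ha hg_coe one_ne_zero (by simp) rfl
  have hh : IsConj (diagTorus b) h := by
    refine isConj_diagTorus_of_mul_eq !![(b : ℂ) - (b : ℂ)⁻¹, 0; t, 1] ?_ ?_
    · simpa [Matrix.det_fin_two_of] using hb1
    · rw [hh_coe]
      ext i j
      fin_cases i <;> fin_cases j <;> simp [Matrix.mul_apply, Fin.sum_univ_two] <;> ring
  have hhg : IsConj (diagTorus c) (h * g) := by
    refine isConj_diagTorus_of_upper_right_ne_zero hc
      (x := b * a) (y := b) (z := t * a) (w := t + (b : ℂ)⁻¹ * (a : ℂ)⁻¹) ?_ b.ne_zero ?_ ?_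
    · rw [Units.val_mul, hg_coe, hh_coe]
      simp
    · linear_combination (a : ℂ) * (a : ℂ)⁻¹ * hb0 + ha0
    · rw [ht]; ring
  obtain ⟨p, hp⟩ := isConj_iff.1 (hg.symm.trans hM)
  refine ⟨p * h * p⁻¹, hh.trans (isConj_iff.2 ⟨p, rfl⟩), hhg.trans (isConj_iff.2 ⟨p, ?_⟩)⟩
  rw [← hp]
  group

/-- A regular semisimple matrix of determinant `1` is a product of elements of any `n + 2`
prescribed regular semisimple conjugacy classes of determinant `1`. -/
lemma exists_prod_ofFn_eq_of_isConj_diagTorus (n : ℕ) (f : Fin (n + 2) → ℂˣ)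
    (hf : ∀ i, f i ^ 2 ≠ 1) {a : ℂˣ} (ha : a ^ 2 ≠ 1) {M : (Matrix (Fin 2) (Fin 2) ℂ)ˣ}
    (hM : IsConj (diagTorus a) M) :
    ∃ g : Fin (n + 2) → (Matrix (Fin 2) (Fin 2) ℂ)ˣ,
      (∀ i, IsConj (diagTorus (f i)) (g i)) ∧ (List.ofFn g).prod = M := by
  have conj_inv {x : ℂˣ} {h : (Matrix (Fin 2) (Fin 2) ℂ)ˣ} (hx : IsConj (diagTorus x⁻¹) h) :
      IsConj (diagTorus x) h⁻¹ := by
    obtain ⟨p, rfl⟩ := isConj_iff.1 hx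
    exact isConj_iff.2 ⟨p, by rw [map_inv]; group⟩
  have inv_sq (i) : (f i)⁻¹ ^ 2 ≠ 1 := by simpa using hf i
  induction n generalizing a M with
  | zero =>
    obtain ⟨h, hh, hhM⟩ := exists_isConj_diagTorus_mul ha (inv_sq 0) (hf 1) hM
    refine ⟨![h⁻¹, h * M], ?_, by simp⟩
    intro i
    fin_cases i
    · exact conj_inv hh
    · exact hhM
  | succ n ih =>
    obtain ⟨h, hh, hhM⟩ := exists_isConj_diagTorus_mul ha (inv_sq 0) (hf 1) hM
    obtain ⟨g, hg, hprod⟩ := ih (fun i => f i.succ) (fun i => hf _) (hf 1) hhM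
      (fun i => inv_sq _)
    refine ⟨Fin.cons h⁻¹ g, Fin.cases (conj_inv hh) hg, ?_⟩
    rw [List.ofFn_succ, List.prod_cons]
    simp only [Fin.cons_zero, Fin.cons_succ, hprod, inv_mul_cancel_left]

lemma exists_pow_eq_neg_one_and_pow_sq_ne_one {b d : ℕ} (hd : 1 ≤ d) (hbd : d < b) :
    ∃ z : ℂˣ, z ^ b = -1 ∧ (z ^ d) ^ 2 ≠ 1 := by
  have hz := Complex.isPrimitiveRoot_exp (2 * b) (by omega)
  refine ⟨Units.mk0 _ (hz.ne_zero (by omega)), Units.ext ?_, fun h => ?_⟩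
  · simpa using (hz.pow (by omega) (mul_comm 2 b)).eq_neg_one_of_two_right
  · rw [← pow_mul] at h
    exact hz.pow_ne_one_of_pos_of_lt (l := d * 2) (by omega) (by omega)
      (by simpa using congrArg Units.val h)

lemma combGamma_ne_one_of_exists {G : Type*} [Group G] {m r : ℕ} {b d : Fin r → ℕ}
    {c : G} (hc : c ≠ 1) (x : Fin r → G) (hx : ∀ i, x i ^ b i = c)
    (hprod : (List.ofFn fun i => x i ^ d i).prod = c ^ m) : combGamma m b d ≠ 1 := by
  have hrel : ∀ w ∈ combRelators m b d,
      FreeGroup.lift (fun o : Option (Fin r) => o.elim c x) w = 1 := by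
    rintro w (⟨i, rfl⟩ | rfl)
    · simp [hx]
    · simp [map_list_prod, List.map_ofFn, Function.comp_def, hprod]
  intro h
  have h1 := congrArg (PresentedGroup.toGroup hrel) h
  rw [combGamma, PresentedGroup.toGroup.of, map_one] at h1
  exact hc h1

/-- **Rim Theorem, nontriviality.** For integers `m ≥ 2`, `r ≥ 3` and `bᵢ > dᵢ ≥ 1`, the
central element `γ` is nontrivial in `Γ(m; b₁,…,b_r; d₁,…,d_r)`. -/
theorem rim_gamma_nontrivial (m r : ℕ) (hm : 2 ≤ m) (hr : 3 ≤ r)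
    (b d : Fin r → ℕ) (hd : ∀ i, 1 ≤ d i) (hbd : ∀ i, d i < b i) :
    combGamma m b d ≠ 1 := by
  obtain ⟨n, rfl⟩ : ∃ n, r = n + 2 + 1 := ⟨r - 3, by omega⟩
  choose z hzb hzd using fun i => exists_pow_eq_neg_one_and_pow_sq_ne_one (hd i) (hbd i)
  have ha : ((z 0 ^ d 0)⁻¹ * (-1) ^ m) ^ 2 ≠ 1 := by
    rw [mul_pow, ← pow_mul (-1), mul_comm m, pow_mul]
    simpa using hzd 0
  obtain ⟨g, hg, hprod⟩ := exists_prod_ofFn_eq_of_isConj_diagTorus n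
    (fun i => z i.succ ^ d i.succ) (fun i => hzd _) ha (IsConj.refl _)
  choose p hp using fun i => isConj_iff.1 (hg i)
  refine combGamma_ne_one_of_exists diagTorus_neg_one_ne_one
    (Fin.cons (diagTorus (z 0)) fun i => p i * diagTorus (z i.succ) * (p i)⁻¹) ?_ ?_
  · refine Fin.cases ?_ fun i => ?_
    · rw [Fin.cons_zero, ← map_pow, hzb]
    · rw [Fin.cons_succ, conj_pow, ← map_pow, hzb, ← (commute_diagTorus_neg_one (p i)).eq,
        mul_inv_cancel_right]
  · rw [List.ofFn_succ, List.prod_cons]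
    simp only [Fin.cons_zero, Fin.cons_succ, conj_pow, ← map_pow, hp, hprod]
    rw [← map_mul, mul_inv_cancel_left]
end

section
/- Fix integers m ≥ 2, r ≥ 3, and bᵢ, dᵢ with bᵢ > dᵢ ≥ 1 and gcd(bᵢ, dᵢ) = 1 for i = 1, …, r. Assume that we are NOT in one of the following exceptional cases: r = 3 and, after a permutation of the indices, either (b₁,b₂,b₃) = (2,2,n) for some n ≥ 2 with (d₁,d₂,d₃) = (1,1,t), 1 ≤ t ≤ n−1, or (b₁,b₂,b₃) = (2,3,n) for some 3 ≤ n ≤ 5 with (d₁,d₂,d₃) = (1,c,t), c ∈ {1,2}, 1 ≤ t ≤ n−1. Then the central element γ has infinite order in Γ(m; b₁,…,b_r; d₁,…,d_r). -/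
/-- `p` is a product `x₁ ⋯ x_r` of elements of `K` with `xᵢ ^ bᵢ = 1`, where `b₁, …, b_r` are
the entries of the list. -/
def IsTorsionProd {G : Type*} [Group G] (K : Subgroup G) : List ℕ → G → Prop
  | [], p => p = 1
  | n :: L, p => ∃ x ∈ K, x ^ n = 1 ∧ ∃ q, IsTorsionProd K L q ∧ p = x * q

/-- Some group containing a copy of `ℝ` has torsion elements of exponents `b₁, …, b_r`, commuting
with `ℝ`, whose product is a nontrivial element of `ℝ`. -/
def IsNontriviallyTwisted (L : List ℕ) : Prop :=
  ∃ (G : Type) (_ : Group G) (Z : Multiplicative ℝ →* G) (k : ℝ),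
    Function.Injective Z ∧ k ≠ 0 ∧
      IsTorsionProd (Subgroup.centralizer (Set.range Z)) L (Z (Multiplicative.ofAdd k))

namespace IsTorsionProd

variable {G : Type*} [Group G] {K : Subgroup G}

theorem perm {L L' : List ℕ} (h : L.Perm L') {p : G} (hp : IsTorsionProd K L p) :
    IsTorsionProd K L' p := by
  induction h generalizing p with
  | nil => exact hp
  | cons n _ ih =>
    obtain ⟨x, hx, hxn, q, hq, rfl⟩ := hp
    exact ⟨x, hx, hxn, q, ih hq, rfl⟩
  | swap n n' L =>
    obtain ⟨x, hx, hxn, _, ⟨y, hy, hyn, q, hq, rfl⟩, rfl⟩ := hp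
    refine ⟨x * y * x⁻¹, K.mul_mem (K.mul_mem hx hy) (K.inv_mem hx), ?_, x * q,
      ⟨x, hx, hxn, q, hq, rfl⟩, by group⟩
    rw [conj_pow, hyn, mul_one, mul_inv_cancel]
  | trans _ _ ih₁ ih₂ => exact ih₂ (ih₁ hp)

theorem of_sublist {L L' : List ℕ} (h : L.Sublist L') {p : G} (hp : IsTorsionProd K L p) :
    IsTorsionProd K L' p := by
  induction h generalizing p with
  | slnil => exact hp
  | cons n _ ih => exact ⟨1, K.one_mem, one_pow n, p, ih hp, (one_mul p).symm⟩
  | cons_cons n _ ih =>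
    obtain ⟨x, hx, hxn, q, hq, rfl⟩ := hp
    exact ⟨x, hx, hxn, q, ih hq, rfl⟩

theorem exists_ofFn {r : ℕ} {b : Fin r → ℕ} {p : G} (hp : IsTorsionProd K (List.ofFn b) p) :
    ∃ x : Fin r → G, (∀ i, x i ∈ K) ∧ (∀ i, x i ^ b i = 1) ∧ (List.ofFn x).prod = p := by
  induction r generalizing p with
  | zero => exact ⟨Fin.elim0, fun i => i.elim0, fun i => i.elim0, by simpa using hp.symm⟩
  | succ r ih =>
    rw [List.ofFn_succ] at hp
    obtain ⟨x, hx, hxn, q, hq, rfl⟩ := hp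
    obtain ⟨y, hy, hyn, rfl⟩ := ih hq
    refine ⟨Fin.cons x y, fun i => ?_, fun i => ?_, by simp [List.ofFn_succ]⟩
    · cases i using Fin.cases <;> simp [hx, hy]
    · cases i using Fin.cases <;> simp [hxn, hyn]

end IsTorsionProd

theorem IsNontriviallyTwisted.of_subperm {L L' : List ℕ} (h : L.Subperm L')
    (hL : IsNontriviallyTwisted L) : IsNontriviallyTwisted L' := by
  obtain ⟨L₀, h₁, h₂⟩ := h
  obtain ⟨G, _, Z, k, hZ, hk, hp⟩ := hL
  exact ⟨G, _, Z, k, hZ, hk, (hp.perm h₁.symm).of_sublist h₂⟩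

theorem not_isOfFinOrder_combGamma {G : Type*} [Group G] {m r : ℕ} {b d : Fin r → ℕ}
    (β : Fin r → G) (g : G) (hb : ∀ i, β i ^ b i = g)
    (hd : (List.ofFn fun i => β i ^ d i).prod = g ^ m) (hg : ¬ IsOfFinOrder g) :
    ¬ IsOfFinOrder (combGamma m b d) := by
  have hrel : ∀ w ∈ combRelators m b d,
      FreeGroup.lift (fun o : Option (Fin r) => o.elim g β) w = 1 := by
    rintro w (⟨i, rfl⟩ | rfl)
    · simp [hb]
    · simp [map_list_prod, List.map_ofFn, Function.comp_def, hd]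
  intro h
  refine hg ?_
  have := (PresentedGroup.toGroup hrel).isOfFinOrder h
  rwa [combGamma, PresentedGroup.toGroup.of] at this

theorem prod_ofFn_mul_of_mem_centralizer {G A : Type*} [Group G] [CommGroup A] (Z : A →* G)
    {r : ℕ} (x : Fin r → G) (hx : ∀ i, x i ∈ Subgroup.centralizer (Set.range Z)) (s : Fin r → A) :
    (List.ofFn fun i => x i * Z (s i)).prod = (List.ofFn x).prod * Z (∏ i, s i) := by
  induction r with
  | zero => simp
  | succ r ih =>
    have hmem : (List.ofFn fun i : Fin r => x i.succ).prod ∈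
        Subgroup.centralizer (Set.range Z) := by
      refine Subgroup.list_prod_mem _ fun y hy => ?_
      obtain ⟨i, rfl⟩ := (List.mem_ofFn' _ _).1 hy
      exact hx _
    have hcomm := Subgroup.mem_centralizer_iff.1 hmem _ ⟨s 0, rfl⟩
    simp only [List.ofFn_succ, List.prod_cons, Fin.prod_univ_succ, map_mul,
      ih (fun i => x i.succ) (fun i => hx _) (fun i => s i.succ)]
    simp only [mul_assoc]
    rw [← mul_assoc (Z (s 0)), hcomm, mul_assoc]

theorem not_isOfFinOrder_map_ofAdd {G : Type*} [Group G] {Z : Multiplicative ℝ →* G}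
    (hZ : Function.Injective Z) {g : ℝ} (hg : g ≠ 0) :
    ¬ IsOfFinOrder (Z (Multiplicative.ofAdd g)) := by
  rw [hZ.isOfFinOrder_iff, isOfFinOrder_ofAdd_iff]
  exact not_isOfFinAddOrder_of_isAddTorsionFree hg

theorem IsNontriviallyTwisted.not_isOfFinOrder_combGamma {m r : ℕ} {b d : Fin r → ℕ}
    (hb : ∀ i, 0 < b i) (hgcd : ∀ i, Nat.gcd (b i) (d i) = 1)
    (h : IsNontriviallyTwisted (List.ofFn b)) : ¬ IsOfFinOrder (combGamma m b d) := by
  have hb' : ∀ i, (b i : ℝ) ≠ 0 := fun i => by exact_mod_cast (hb i).ne'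
  by_cases he : (m : ℝ) - ∑ i, (d i : ℝ) / b i = 0
  · refine _root_.not_isOfFinOrder_combGamma (fun i => Multiplicative.ofAdd (1 / (b i : ℝ)))
      (Multiplicative.ofAdd (1 : ℝ)) (fun i => ?_) ?_
      (not_isOfFinOrder_map_ofAdd (Z := MonoidHom.id _) Function.injective_id one_ne_zero)
    · rw [← ofAdd_nsmul, nsmul_eq_mul, mul_one_div_cancel (hb' i)]
    · rw [List.prod_ofFn]
      simp only [← ofAdd_nsmul, nsmul_eq_mul, ← ofAdd_sum, mul_one_div, mul_one]
      rw [sub_eq_zero.1 he]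
  · obtain ⟨G, _, Z, k, hZ, hk, hp⟩ := h
    obtain ⟨x, hxK, hxb, hxp⟩ := hp.exists_ofFn
    have hinv : ∀ i, ∃ e : ℤ, x i ^ (e * d i) = x i := fun i => by
      have hbez := Nat.gcd_eq_gcd_ab (b i) (d i)
      rw [hgcd i, Nat.cast_one] at hbez
      refine ⟨Nat.gcdB (b i) (d i), ?_⟩
      rw [show Nat.gcdB (b i) (d i) * (d i : ℤ) = -(b i * Nat.gcdA (b i) (d i)) + 1 by linarith,
        zpow_add, zpow_neg, zpow_mul, zpow_natCast, hxb, one_zpow, inv_one, one_mul, zpow_one]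
    choose e hxe using hinv
    set g := k / ((m : ℝ) - ∑ i, (d i : ℝ) / b i) with hg
    have hgm : k + ∑ i, (d i : ℝ) * (g / b i) = m * g := by
      have : ∑ i, (d i : ℝ) * (g / b i) = g * ∑ i, (d i : ℝ) / b i := by
        rw [Finset.mul_sum]
        exact Finset.sum_congr rfl fun i _ => by ring
      rw [this]
      have : g * ((m : ℝ) - ∑ i, (d i : ℝ) / b i) = k := div_mul_cancel₀ _ he
      linarith
    have hcomm : ∀ i s, Commute (x i ^ e i) (Z s) := fun i s =>
      (Commute.zpow_left (Subgroup.mem_centralizer_iff.1 (hxK i) _ ⟨s, rfl⟩).symm _)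
    refine _root_.not_isOfFinOrder_combGamma
      (fun i => x i ^ e i * Z (Multiplicative.ofAdd (g / b i))) (Z (Multiplicative.ofAdd g))
      (fun i => ?_) ?_ (not_isOfFinOrder_map_ofAdd hZ (div_ne_zero hk he))
    · rw [(hcomm i _).mul_pow, ← zpow_natCast, ← zpow_mul, mul_comm (e i), zpow_mul, zpow_natCast,
        hxb, one_zpow, one_mul, ← map_pow, ← ofAdd_nsmul, nsmul_eq_mul, mul_div_cancel₀ _ (hb' i)]
    · have hpow : ∀ i, (x i ^ e i * Z (Multiplicative.ofAdd (g / b i))) ^ d i =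
          x i * Z (Multiplicative.ofAdd (d i * (g / b i))) := fun i => by
        rw [(hcomm i _).mul_pow, ← zpow_natCast, ← zpow_mul, hxe, ← map_pow,
          ← ofAdd_nsmul, nsmul_eq_mul]
      simp only [hpow]
      rw [prod_ofFn_mul_of_mem_centralizer Z x hxK, hxp, ← map_mul, ← map_pow, ← ofAdd_sum,
        ← ofAdd_add, ← ofAdd_nsmul, nsmul_eq_mul, hgm]

section SkewProduct

variable {X : Type}

/-- The conjugate of `A × id` on `X × ℝ` by the vertical shift along `h`. -/
def skewConj (A : Equiv.Perm X) (h : X → ℝ) : Equiv.Perm (X × ℝ) where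
  toFun p := (A p.1, p.2 + (h p.1 - h (A p.1)))
  invFun p := (A⁻¹ p.1, p.2 - (h (A⁻¹ p.1) - h p.1))
  left_inv p := by simp
  right_inv p := by simp

theorem skewConj_apply (A : Equiv.Perm X) (h : X → ℝ) (x : X) (t : ℝ) :
    skewConj A h (x, t) = (A x, t + (h x - h (A x))) := rfl

theorem skewConj_pow_apply (A : Equiv.Perm X) (h : X → ℝ) (n : ℕ) (x : X) (t : ℝ) :
    (skewConj A h ^ n) (x, t) = ((A ^ n) x, t + (h x - h ((A ^ n) x))) := by
  induction n generalizing x t with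
  | zero => simp
  | succ n ih =>
    rw [pow_succ, Equiv.Perm.mul_apply, skewConj_apply, ih, pow_succ, Equiv.Perm.mul_apply]
    congr 1
    ring

variable (X) in
/-- The action of `ℝ` on `X × ℝ` by vertical translations. -/
def verticalTranslation : Multiplicative ℝ →* Equiv.Perm (X × ℝ) where
  toFun s := Equiv.prodCongr (Equiv.refl X) (Equiv.addRight s.toAdd)
  map_one' := by ext p <;> simp
  map_mul' s t := by
    ext p
    · simp
    · simp only [Equiv.prodCongr_apply, Equiv.Perm.mul_apply, toAdd_mul, Prod.map_snd,
        Equiv.coe_addRight]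
      ring

theorem skewConj_mem_centralizer (A : Equiv.Perm X) (h : X → ℝ) :
    skewConj A h ∈ Subgroup.centralizer (Set.range (verticalTranslation X)) := by
  rw [Subgroup.mem_centralizer_iff]
  rintro _ ⟨s, rfl⟩
  refine Equiv.ext fun p => ?_
  change (_, _) = (_, _)
  congr 1
  change p.2 + (h p.1 - h (A p.1)) + s.toAdd = p.2 + s.toAdd + (h p.1 - h (A p.1))
  ring

theorem verticalTranslation_injective [Nonempty X] :
    Function.Injective (verticalTranslation X) := by
  intro s t hst
  have := congrArg Prod.snd (Equiv.congr_fun hst (Classical.arbitrary X, 0))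
  change 0 + s.toAdd = 0 + t.toAdd at this
  simpa using this

theorem isNontriviallyTwisted_of_skewConj [Nonempty X]
    (l : List (ℕ × Equiv.Perm X × (X → ℝ))) (hpow : ∀ q ∈ l, q.2.1 ^ q.1 = 1) {k : ℝ}
    (hk : k ≠ 0)
    (hprod : ∀ x t, (l.map fun q => skewConj q.2.1 q.2.2).prod (x, t) = (x, t + k)) :
    IsNontriviallyTwisted (l.map Prod.fst) := by
  refine ⟨_, _, verticalTranslation X, k, verticalTranslation_injective, hk, ?_⟩
  have key : IsTorsionProd (Subgroup.centralizer (Set.range (verticalTranslation X)))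
      (l.map Prod.fst) (l.map fun q => skewConj q.2.1 q.2.2).prod := by
    clear hprod
    induction l with
    | nil => rfl
    | cons q l ih =>
      refine ⟨skewConj q.2.1 q.2.2, skewConj_mem_centralizer _ _, ?_, _,
        ih fun q' hq' => hpow q' (List.mem_cons_of_mem _ hq'), rfl⟩
      refine Equiv.ext fun p => ?_
      rw [← Prod.mk.eta (p := p), skewConj_pow_apply, hpow q List.mem_cons_self]
      simp
  rwa [show (l.map fun q => skewConj q.2.1 q.2.2).prod =
    verticalTranslation X (Multiplicative.ofAdd k) from Equiv.ext fun p => hprod p.1 p.2] at key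

end SkewProduct

section Euclidean

/-- The affine automorphism of the plane with linear part `!![a, b; c, d]` of determinant one,
fixing the point `(p, q)`. -/
def affinePerm (a b c d p q : ℝ) (h : a * d - b * c = 1) : Equiv.Perm (ℝ × ℝ) where
  toFun v := (a * (v.1 - p) + b * (v.2 - q) + p, c * (v.1 - p) + d * (v.2 - q) + q)
  invFun v := (d * (v.1 - p) - b * (v.2 - q) + p, a * (v.2 - q) - c * (v.1 - p) + q)
  left_inv v := by
    ext
    · linear_combination (v.1 - p) * h
    · linear_combination (v.2 - q) * h
  right_inv v := by
    ext
    · linear_combination (v.1 - p) * h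
    · linear_combination (v.2 - q) * h

theorem affinePerm_apply (a b c d p q : ℝ) (h : a * d - b * c = 1) (v : ℝ × ℝ) :
    affinePerm a b c d p q h v =
      (a * (v.1 - p) + b * (v.2 - q) + p, c * (v.1 - p) + d * (v.2 - q) + q) := rfl

/-- The linear form `det((p, q), ·)`. -/
def areaForm (p q : ℝ) (v : ℝ × ℝ) : ℝ := p * v.2 - q * v.1

theorem isNontriviallyTwisted_two_two_two_two : IsNontriviallyTwisted [2, 2, 2, 2] := by
  refine isNontriviallyTwisted_of_skewConj (k := 4)
    [(2, affinePerm (-1) 0 0 (-1) 0 0 (by norm_num), areaForm 0 0),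
     (2, affinePerm (-1) 0 0 (-1) 1 0 (by norm_num), areaForm 1 0),
     (2, affinePerm (-1) 0 0 (-1) 1 1 (by norm_num), areaForm 1 1),
     (2, affinePerm (-1) 0 0 (-1) 0 1 (by norm_num), areaForm 0 1)] ?_ (by norm_num) ?_
  · simp only [List.forall_mem_cons, List.not_mem_nil, false_imp_iff, implies_true, and_true]
    refine ⟨?_, ?_, ?_, ?_⟩ <;> ext v <;>
      simp [pow_succ, Equiv.Perm.mul_apply, affinePerm_apply]
  · intro x t
    simp only [List.map_cons, List.map_nil, List.prod_cons, List.prod_nil, mul_one,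
      Equiv.Perm.mul_apply, skewConj_apply, affinePerm_apply, areaForm]
    ext <;> simp <;> ring

theorem isNontriviallyTwisted_three_three_three : IsNontriviallyTwisted [3, 3, 3] := by
  refine isNontriviallyTwisted_of_skewConj (k := 2)
    [(3, affinePerm 0 (-1) 1 (-1) 1 1 (by norm_num), areaForm 1 1),
     (3, affinePerm 0 (-1) 1 (-1) 0 0 (by norm_num), areaForm 0 0),
     (3, affinePerm 0 (-1) 1 (-1) 1 0 (by norm_num), areaForm 1 0)] ?_ (by norm_num) ?_
  · simp only [List.forall_mem_cons, List.not_mem_nil, false_imp_iff, implies_true, and_true]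
    refine ⟨?_, ?_, ?_⟩ <;> ext v <;>
      simp [pow_succ, Equiv.Perm.mul_apply, affinePerm_apply] <;> ring
  · intro x t
    simp only [List.map_cons, List.map_nil, List.prod_cons, List.prod_nil, mul_one,
      Equiv.Perm.mul_apply, skewConj_apply, affinePerm_apply, areaForm]
    ext <;> simp <;> ring

theorem isNontriviallyTwisted_two_four_four : IsNontriviallyTwisted [2, 4, 4] := by
  refine isNontriviallyTwisted_of_skewConj (k := 2)
    [(2, affinePerm (-1) 0 0 (-1) 0 1 (by norm_num), areaForm 0 1),
     (4, affinePerm 0 (-1) 1 0 0 0 (by norm_num), areaForm 0 0),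
     (4, affinePerm 0 (-1) 1 0 1 1 (by norm_num), areaForm 1 1)] ?_ (by norm_num) ?_
  · simp only [List.forall_mem_cons, List.not_mem_nil, false_imp_iff, implies_true, and_true]
    refine ⟨?_, ?_, ?_⟩ <;> ext v <;>
      simp [pow_succ, Equiv.Perm.mul_apply, affinePerm_apply]
  · intro x t
    simp only [List.map_cons, List.map_nil, List.prod_cons, List.prod_nil, mul_one,
      Equiv.Perm.mul_apply, skewConj_apply, affinePerm_apply, areaForm]
    ext <;> simp <;> ring

theorem isNontriviallyTwisted_two_three_six : IsNontriviallyTwisted [2, 3, 6] := by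
  refine isNontriviallyTwisted_of_skewConj (k := 4)
    [(2, affinePerm (-1) 0 0 (-1) 1 (-1) (by norm_num), areaForm 1 (-1)),
     (3, affinePerm 0 (-1) 1 (-1) 2 0 (by norm_num), areaForm 2 0),
     (6, affinePerm 1 (-1) 1 0 0 0 (by norm_num), areaForm 0 0)] ?_ (by norm_num) ?_
  · simp only [List.forall_mem_cons, List.not_mem_nil, false_imp_iff, implies_true, and_true]
    refine ⟨?_, ?_, ?_⟩ <;> ext v <;>
      simp [pow_succ, Equiv.Perm.mul_apply, affinePerm_apply] <;> ring
  · intro x t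
    simp only [List.map_cons, List.map_nil, List.prod_cons, List.prod_nil, mul_one,
      Equiv.Perm.mul_apply, skewConj_apply, affinePerm_apply, areaForm]
    ext <;> simp <;> ring

end Euclidean

section Hyperbolic

open UpperHalfPlane MatrixGroups Real

/-- The automorphy factor `cτ + d`. -/
def automorphyFactor (g : SL(2, ℝ)) (τ : ℍ) : ℂ := (g 1 0 : ℂ) * τ + (g 1 1 : ℂ)

theorem automorphyFactor_ne_zero (g : SL(2, ℝ)) (τ : ℍ) : automorphyFactor g τ ≠ 0 :=
  denom_ne_zero (g : GL (Fin 2) ℝ) τ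

theorem coe_smul_mul_automorphyFactor (g : SL(2, ℝ)) (τ : ℍ) :
    ((g • τ : ℍ) : ℂ) * automorphyFactor g τ = (g 0 0 : ℂ) * τ + (g 0 1 : ℂ) := by
  rw [coe_specialLinearGroup_apply]
  exact div_mul_cancel₀ _ (automorphyFactor_ne_zero g τ)

theorem automorphyFactor_mul (g g' : SL(2, ℝ)) (τ : ℍ) :
    automorphyFactor (g * g') τ = automorphyFactor g (g' • τ) * automorphyFactor g' τ := by
  have h : automorphyFactor g (g' • τ) * automorphyFactor g' τ =
      (g 1 0 : ℂ) * (((g' • τ : ℍ) : ℂ) * automorphyFactor g' τ) +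
        (g 1 1 : ℂ) * automorphyFactor g' τ := by
    rw [automorphyFactor]; ring
  rw [h, coe_smul_mul_automorphyFactor]
  simp only [automorphyFactor, Matrix.SpecialLinearGroup.coe_mul, Matrix.mul_apply,
    Fin.sum_univ_two]
  push_cast
  ring

theorem automorphyFactor_im_pos {g : SL(2, ℝ)} (hg : 0 < g 1 0) (τ : ℍ) :
    0 < (automorphyFactor g τ).im := by
  have : (automorphyFactor g τ).im = g 1 0 * τ.im := by simp [automorphyFactor]
  rw [this]
  exact mul_pos hg τ.im_pos

theorem arg_mem_Ioo_of_im_pos {z : ℂ} (hz : 0 < z.im) : z.arg ∈ Set.Ioo 0 π :=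
  ⟨(Complex.arg_nonneg_iff.2 hz.le).lt_of_ne fun h => hz.ne' (Complex.arg_eq_zero_iff.1 h.symm).2,
    Complex.arg_lt_pi_iff.2 (Or.inr hz.ne')⟩

/-- `g` is conjugate in `SL(2, ℝ)` to the counterclockwise rotation by `θ`, for `0 < θ < π`. -/
def IsEllipticOfAngle (g : SL(2, ℝ)) (θ : ℝ) : Prop :=
  0 < g 1 0 ∧ g 0 0 + g 1 1 = 2 * cos θ

theorem mul_self_apply_eq (g : SL(2, ℝ)) :
    (g : Matrix (Fin 2) (Fin 2) ℝ) * (g : Matrix (Fin 2) (Fin 2) ℝ) =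
      (g 0 0 + g 1 1) • (g : Matrix (Fin 2) (Fin 2) ℝ) - 1 := by
  have h := g.det_coe
  rw [Matrix.det_fin_two] at h
  ext i j
  fin_cases i <;> fin_cases j <;> simp [Matrix.mul_apply, Fin.sum_univ_two] <;>
    linarith

/-- `h(τ) = arg (τ - τ̄₀)`, where `τ₀` is the fixed point of `g`. -/
noncomputable def fixedPointArg (g : SL(2, ℝ)) (θ : ℝ) (τ : ℍ) : ℝ :=
  Complex.arg (automorphyFactor g τ - Complex.exp (-(θ * Complex.I)))

namespace IsEllipticOfAngle

variable {g : SL(2, ℝ)} {θ : ℝ}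

theorem sin_smul_pow (hg : IsEllipticOfAngle g θ) (n : ℕ) :
    sin θ • ((g ^ (n + 1) : SL(2, ℝ)) : Matrix (Fin 2) (Fin 2) ℝ) =
      sin ((n + 1) * θ) • (g : Matrix (Fin 2) (Fin 2) ℝ) - sin (n * θ) • 1 := by
  induction n with
  | zero => simp
  | succ n ih =>
    rw [pow_succ, Matrix.SpecialLinearGroup.coe_mul, ← smul_mul_assoc, ih, sub_mul,
      smul_mul_assoc, mul_self_apply_eq, hg.2, smul_mul_assoc, one_mul, smul_sub, smul_smul,
      sub_right_comm, ← sub_smul]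
    congr 2
    · have h₁ : ((n + 1 : ℕ) + 1 : ℝ) * θ = (n + 1) * θ + θ := by push_cast; ring
      have h₂ : (n : ℝ) * θ = (n + 1) * θ - θ := by ring
      rw [h₁, h₂, sin_add, sin_sub]
      ring
    · push_cast; rfl

theorem pow_eq_neg_one {n : ℕ} (hn : 2 ≤ n) (hg : IsEllipticOfAngle g (π / n)) :
    g ^ n = -1 := by
  obtain ⟨k, rfl⟩ : ∃ k, n = k + 1 := ⟨n - 1, by omega⟩
  have hk : ((k + 1 : ℕ) : ℝ) ≠ 0 := by positivity
  have h2 : (2 : ℝ) ≤ (k + 1 : ℕ) := by exact_mod_cast hn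
  have hsin : 0 < sin (π / (k + 1 : ℕ)) :=
    sin_pos_of_pos_of_lt_pi (by positivity) (div_lt_self pi_pos (by linarith))
  have h := hg.sin_smul_pow k
  have h₁ : ((k : ℝ) + 1) * (π / (k + 1 : ℕ)) = π := by push_cast at hk ⊢; field_simp
  have h₂ : (k : ℝ) * (π / (k + 1 : ℕ)) = π - π / (k + 1 : ℕ) := by linear_combination h₁
  rw [h₁, h₂, sin_pi, sin_pi_sub, zero_smul, zero_sub, ← smul_neg] at h
  ext1 i j
  simpa using congrFun (congrFun (smul_right_injective _ hsin.ne' h) i) j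

theorem toPerm_pow {n : ℕ} (hn : 2 ≤ n) (hg : IsEllipticOfAngle g (π / n)) :
    (MulAction.toPerm g : Equiv.Perm ℍ) ^ n = 1 := by
  ext τ
  have : (MulAction.toPerm g : Equiv.Perm ℍ) ^ n = MulAction.toPerm (g ^ n) :=
    (map_pow (MulAction.toPermHom SL(2, ℝ) ℍ) g n).symm
  rw [this, hg.pow_eq_neg_one hn, MulAction.toPerm_apply, coe_specialLinearGroup_apply]
  simp

theorem skewConj_apply (hg : IsEllipticOfAngle g θ) (hθ : θ ∈ Set.Ioo 0 π) (τ : ℍ) (t : ℝ) :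
    skewConj (MulAction.toPerm g) (fixedPointArg g θ) (τ, t) =
      (g • τ, t + ((automorphyFactor g τ).arg - θ)) := by
  set E := Complex.exp (θ * Complex.I) with hE
  set E' := Complex.exp (-(θ * Complex.I)) with hE'
  have hEE : E * E' = 1 := by rw [hE, hE', ← Complex.exp_add]; simp
  have hcos : E + E' = 2 * cos θ := by
    rw [hE, hE', Complex.ofReal_cos, Complex.two_cos, neg_mul]
  have him : ∀ τ : ℍ, 0 < (automorphyFactor g τ - E').im := fun τ => by
    have h₁ : E'.im = - sin θ := by
      rw [hE', ← neg_mul, ← Complex.ofReal_neg, Complex.exp_ofReal_mul_I_im, sin_neg]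
    rw [Complex.sub_im, h₁]
    linarith [automorphyFactor_im_pos hg.1 τ, sin_pos_of_pos_of_lt_pi hθ.1 hθ.2]
  have hne : ∀ τ : ℍ, automorphyFactor g τ - E' ≠ 0 := fun τ h => by
    have := him τ
    simp [h] at this
  have hj : automorphyFactor g (g • τ) * automorphyFactor g τ =
      2 * cos θ * automorphyFactor g τ - 1 := by
    rw [← automorphyFactor_mul, automorphyFactor, Matrix.SpecialLinearGroup.coe_mul,
      mul_self_apply_eq, hg.2, automorphyFactor]
    simp
    ring
  have hmul : automorphyFactor g τ * (automorphyFactor g (g • τ) - E') =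
      E * (automorphyFactor g τ - E') := by
    linear_combination hj - automorphyFactor g τ * hcos + hEE
  have hang : (((automorphyFactor g τ).arg + fixedPointArg g θ (g • τ) : ℝ) : Angle) =
      ((θ + fixedPointArg g θ τ : ℝ) : Angle) := by
    have := congrArg (fun z : ℂ => (z.arg : Angle)) hmul
    rw [Complex.arg_mul_coe_angle (automorphyFactor_ne_zero g τ) (hne _),
      Complex.arg_mul_coe_angle (Complex.exp_ne_zero _) (hne _),
      Complex.exp_mul_I, Complex.arg_cos_add_sin_mul_I ⟨by linarith [hθ.1, pi_pos], hθ.2.le⟩] at this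
    rw [Angle.coe_add, Angle.coe_add]
    exact this
  obtain ⟨k, hk⟩ := Angle.angle_eq_iff_two_pi_dvd_sub.1 hang
  have h₁ := arg_mem_Ioo_of_im_pos (automorphyFactor_im_pos hg.1 τ)
  have h₂ : fixedPointArg g θ τ ∈ Set.Ioo 0 π := arg_mem_Ioo_of_im_pos (him τ)
  have h₃ : fixedPointArg g θ (g • τ) ∈ Set.Ioo 0 π := arg_mem_Ioo_of_im_pos (him _)
  have hk0 : k = 0 := by
    have hlt : (k : ℝ) < 1 := by nlinarith [pi_pos, h₁.2, h₂.1, h₃.2, hθ.1]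
    have hgt : (-1 : ℝ) < k := by nlinarith [pi_pos, h₁.1, h₂.2, h₃.1, hθ.2]
    have : k < 1 := by exact_mod_cast hlt
    have : -1 < k := by exact_mod_cast hgt
    omega
  rw [hk0, Int.cast_zero, mul_zero] at hk
  rw [_root_.skewConj_apply, MulAction.toPerm_apply]
  congr 2
  linarith

end IsEllipticOfAngle

theorem arg_add_arg_add_arg_eq_pi {x y z : ℂ} (hx : 0 < x.im) (hy : 0 < y.im) (hz : 0 < z.im)
    (h : x * y * z = -1) : x.arg + y.arg + z.arg = π := by
  have hx0 : x ≠ 0 := fun h => by simp [h] at hx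
  have hy0 : y ≠ 0 := fun h => by simp [h] at hy
  have hz0 : z ≠ 0 := fun h => by simp [h] at hz
  have hang : ((x.arg + y.arg + z.arg : ℝ) : Angle) = (π : ℝ) := by
    rw [← Complex.arg_neg_one, ← h, Complex.arg_mul_coe_angle (mul_ne_zero hx0 hy0) hz0,
      Complex.arg_mul_coe_angle hx0 hy0, Angle.coe_add, Angle.coe_add]
  obtain ⟨k, hk⟩ := Angle.angle_eq_iff_two_pi_dvd_sub.1 hang
  obtain ⟨hx₁, hx₂⟩ := arg_mem_Ioo_of_im_pos hx
  obtain ⟨hy₁, hy₂⟩ := arg_mem_Ioo_of_im_pos hy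
  obtain ⟨hz₁, hz₂⟩ := arg_mem_Ioo_of_im_pos hz
  have hlt : (k : ℝ) < 1 := by nlinarith [pi_pos]
  have hgt : (-1 : ℝ) < k := by nlinarith [pi_pos]
  have hk0 : k = 0 := by
    have : k < 1 := by exact_mod_cast hlt
    have : -1 < k := by exact_mod_cast hgt
    omega
  rw [hk0, Int.cast_zero, mul_zero] at hk
  linarith

theorem arg_add_arg_add_arg_add_arg_eq_two_pi {w x y z : ℂ} (hw : 0 < w.im) (hx : 0 < x.im)
    (hy : 0 < y.im) (hz : 0 < z.im) (h : w * x * y * z = 1) :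
    w.arg + x.arg + y.arg + z.arg = 2 * π := by
  have hw0 : w ≠ 0 := fun h => by simp [h] at hw
  have hx0 : x ≠ 0 := fun h => by simp [h] at hx
  have hy0 : y ≠ 0 := fun h => by simp [h] at hy
  have hz0 : z ≠ 0 := fun h => by simp [h] at hz
  have hang : ((w.arg + x.arg + y.arg + z.arg : ℝ) : Angle) = (0 : ℝ) := by
    rw [← Complex.arg_one, ← h,
      Complex.arg_mul_coe_angle (mul_ne_zero (mul_ne_zero hw0 hx0) hy0) hz0,
      Complex.arg_mul_coe_angle (mul_ne_zero hw0 hx0) hy0, Complex.arg_mul_coe_angle hw0 hx0,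
      Angle.coe_add, Angle.coe_add, Angle.coe_add]
  obtain ⟨k, hk⟩ := Angle.angle_eq_iff_two_pi_dvd_sub.1 hang
  obtain ⟨hw₁, hw₂⟩ := arg_mem_Ioo_of_im_pos hw
  obtain ⟨hx₁, hx₂⟩ := arg_mem_Ioo_of_im_pos hx
  obtain ⟨hy₁, hy₂⟩ := arg_mem_Ioo_of_im_pos hy
  obtain ⟨hz₁, hz₂⟩ := arg_mem_Ioo_of_im_pos hz
  have hlt : (k : ℝ) < 2 := by nlinarith [pi_pos]
  have hgt : (0 : ℝ) < k := by nlinarith [pi_pos]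
  have hk1 : k = 1 := by
    have : k < 2 := by exact_mod_cast hlt
    have : 0 < k := by exact_mod_cast hgt
    omega
  rw [hk1, Int.cast_one] at hk
  linarith

theorem pi_div_mem_Ioo {n : ℕ} (hn : 2 ≤ n) : π / n ∈ Set.Ioo 0 π := by
  have : (2 : ℝ) ≤ n := by exact_mod_cast hn
  exact ⟨div_pos pi_pos (by linarith), div_lt_self pi_pos (by linarith)⟩

theorem isNontriviallyTwisted_of_mul_eq_neg_one {g₁ g₂ g₃ : SL(2, ℝ)} {n₁ n₂ n₃ : ℕ}
    (hn₁ : 2 ≤ n₁) (hn₂ : 2 ≤ n₂) (hn₃ : 2 ≤ n₃) (h₁ : IsEllipticOfAngle g₁ (π / n₁))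
    (h₂ : IsEllipticOfAngle g₂ (π / n₂)) (h₃ : IsEllipticOfAngle g₃ (π / n₃))
    (hg : g₁ * g₂ * g₃ = -1) (hne : π / n₁ + π / n₂ + π / n₃ ≠ π) :
    IsNontriviallyTwisted [n₁, n₂, n₃] := by
  refine isNontriviallyTwisted_of_skewConj (X := ℍ) (k := π - (π / n₁ + π / n₂ + π / n₃))
    [(n₁, MulAction.toPerm g₁, fixedPointArg g₁ (π / n₁)),
     (n₂, MulAction.toPerm g₂, fixedPointArg g₂ (π / n₂)),
     (n₃, MulAction.toPerm g₃, fixedPointArg g₃ (π / n₃))] ?_ (sub_ne_zero.2 hne.symm) ?_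
  · simp only [List.forall_mem_cons, List.not_mem_nil, false_imp_iff, implies_true, and_true]
    exact ⟨h₁.toPerm_pow hn₁, h₂.toPerm_pow hn₂, h₃.toPerm_pow hn₃⟩
  · intro τ t
    simp only [List.map_cons, List.map_nil, List.prod_cons, List.prod_nil, mul_one,
      Equiv.Perm.mul_apply, h₃.skewConj_apply (pi_div_mem_Ioo hn₃),
      h₂.skewConj_apply (pi_div_mem_Ioo hn₂), h₁.skewConj_apply (pi_div_mem_Ioo hn₁)]
    have hsum := arg_add_arg_add_arg_eq_pi (automorphyFactor_im_pos h₁.1 (g₂ • g₃ • τ))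
      (automorphyFactor_im_pos h₂.1 (g₃ • τ)) (automorphyFactor_im_pos h₃.1 τ) (by
        rw [← automorphyFactor_mul, ← automorphyFactor_mul, hg]
        simp [automorphyFactor])
    refine Prod.ext ?_ (by dsimp only; linarith)
    simp only [← mul_smul, ← mul_assoc, hg]
    ext1
    rw [coe_specialLinearGroup_apply]
    simp

theorem isNontriviallyTwisted_of_mul_eq_one {g₁ g₂ g₃ g₄ : SL(2, ℝ)} {n₁ n₂ n₃ n₄ : ℕ}
    (hn₁ : 2 ≤ n₁) (hn₂ : 2 ≤ n₂) (hn₃ : 2 ≤ n₃) (hn₄ : 2 ≤ n₄)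
    (h₁ : IsEllipticOfAngle g₁ (π / n₁)) (h₂ : IsEllipticOfAngle g₂ (π / n₂))
    (h₃ : IsEllipticOfAngle g₃ (π / n₃)) (h₄ : IsEllipticOfAngle g₄ (π / n₄))
    (hg : g₁ * g₂ * g₃ * g₄ = 1) (hne : π / n₁ + π / n₂ + π / n₃ + π / n₄ ≠ 2 * π) :
    IsNontriviallyTwisted [n₁, n₂, n₃, n₄] := by
  refine isNontriviallyTwisted_of_skewConj (X := ℍ)
    (k := 2 * π - (π / n₁ + π / n₂ + π / n₃ + π / n₄))
    [(n₁, MulAction.toPerm g₁, fixedPointArg g₁ (π / n₁)),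
     (n₂, MulAction.toPerm g₂, fixedPointArg g₂ (π / n₂)),
     (n₃, MulAction.toPerm g₃, fixedPointArg g₃ (π / n₃)),
     (n₄, MulAction.toPerm g₄, fixedPointArg g₄ (π / n₄))] ?_ (sub_ne_zero.2 hne.symm) ?_
  · simp only [List.forall_mem_cons, List.not_mem_nil, false_imp_iff, implies_true, and_true]
    exact ⟨h₁.toPerm_pow hn₁, h₂.toPerm_pow hn₂, h₃.toPerm_pow hn₃, h₄.toPerm_pow hn₄⟩
  · intro τ t
    simp only [List.map_cons, List.map_nil, List.prod_cons, List.prod_nil, mul_one,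
      Equiv.Perm.mul_apply, h₄.skewConj_apply (pi_div_mem_Ioo hn₄),
      h₃.skewConj_apply (pi_div_mem_Ioo hn₃),
      h₂.skewConj_apply (pi_div_mem_Ioo hn₂), h₁.skewConj_apply (pi_div_mem_Ioo hn₁)]
    have hsum := arg_add_arg_add_arg_add_arg_eq_two_pi
      (automorphyFactor_im_pos h₁.1 (g₂ • g₃ • g₄ • τ))
      (automorphyFactor_im_pos h₂.1 (g₃ • g₄ • τ)) (automorphyFactor_im_pos h₃.1 (g₄ • τ))
      (automorphyFactor_im_pos h₄.1 τ) (by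
        rw [← automorphyFactor_mul, ← automorphyFactor_mul, ← automorphyFactor_mul, hg]
        simp [automorphyFactor])
    refine Prod.ext ?_ (by dsimp only; linarith)
    simp only [← mul_smul, ← mul_assoc, hg, one_smul]

theorem SL2_mul_apply (g g' : SL(2, ℝ)) (i j : Fin 2) :
    (g * g') i j = g i 0 * g' 0 j + g i 1 * g' 1 j := by
  rw [Matrix.SpecialLinearGroup.coe_mul, Matrix.mul_apply, Fin.sum_univ_two]

theorem SL2_inv_one_zero (g : SL(2, ℝ)) : g⁻¹ 1 0 = -g 1 0 := by
  rw [Matrix.SpecialLinearGroup.SL2_inv_expl]; simp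

theorem SL2_inv_trace (g : SL(2, ℝ)) : g⁻¹ 0 0 + g⁻¹ 1 1 = g 0 0 + g 1 1 := by
  rw [Matrix.SpecialLinearGroup.SL2_inv_expl]; simp [add_comm]

/-- Rotations by `2 * π / a`, `2 * π / b`, `2 * π / c` about the vertices of a hyperbolic triangle. -/
theorem isNontriviallyTwisted_of_hyperbolic {a b c : ℕ} (ha : 2 ≤ a) (hb : 2 ≤ b) (hc : 2 ≤ c)
    (h : π / a + π / b + π / c < π) : IsNontriviallyTwisted [a, b, c] := by
  set α := π / a with hα
  set β := π / b with hβ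
  set γ := π / c with hγ
  obtain ⟨hα0, hαπ⟩ : α ∈ Set.Ioo 0 π := pi_div_mem_Ioo ha
  obtain ⟨hβ0, hβπ⟩ : β ∈ Set.Ioo 0 π := pi_div_mem_Ioo hb
  obtain ⟨hγ0, hγπ⟩ : γ ∈ Set.Ioo 0 π := pi_div_mem_Ioo hc
  have hsα : 0 < sin α := sin_pos_of_pos_of_lt_pi hα0 hαπ
  have hsβ : 0 < sin β := sin_pos_of_pos_of_lt_pi hβ0 hβπ
  have hle : ∀ n : ℕ, 2 ≤ n → π / n ≤ π / 2 := fun n hn =>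
    div_le_div_of_nonneg_left pi_pos.le two_pos (by exact_mod_cast hn)
  have hcα : 0 ≤ cos α := cos_nonneg_of_mem_Icc ⟨by linarith, hle a ha⟩
  have hcβ : 0 ≤ cos β := cos_nonneg_of_mem_Icc ⟨by linarith, hle b hb⟩
  have hcos : -cos (α + β) < cos γ := by
    rw [← cos_pi_sub]
    exact cos_lt_cos_of_nonneg_of_le_pi hγ0.le (by linarith) (by linarith)
  rw [cos_add] at hcos
  set u := (cos α * cos β + cos γ) / (sin α * sin β) with hu
  have hss : 0 < sin α * sin β := mul_pos hsα hsβ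
  have hu1 : 1 < u := by rw [hu, lt_div_iff₀ hss]; linarith
  have hus : u * (sin α * sin β) = cos α * cos β + cos γ := div_mul_cancel₀ _ hss.ne'
  obtain ⟨k, l, hk, hl, hkl, hkl'⟩ : ∃ k l : ℝ, 0 < k ∧ 0 < l ∧ k * l = 1 ∧ k + l = 2 * u := by
    have hsq : √(u ^ 2 - 1) ^ 2 = u ^ 2 - 1 := sq_sqrt (by nlinarith)
    have hlt : √(u ^ 2 - 1) < u := by
      rw [sqrt_lt' (by linarith)]; linarith
    exact ⟨u + √(u ^ 2 - 1), u - √(u ^ 2 - 1), by positivity, by linarith,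
      by linear_combination -hsq, by ring⟩
  have hpos : 0 < sin α * cos β + l * (cos α * sin β) := by
    rcases hcα.eq_or_lt with h0 | h0
    · rcases hcβ.eq_or_lt with h1 | h1
      · exfalso
        have hα' : α = π / 2 := injOn_cos ⟨hα0.le, hαπ.le⟩ ⟨by positivity, by linarith [pi_pos]⟩
          (by rw [← h0, cos_pi_div_two])
        have hβ' : β = π / 2 := injOn_cos ⟨hβ0.le, hβπ.le⟩ ⟨by positivity, by linarith [pi_pos]⟩
          (by rw [← h1, cos_pi_div_two])
        linarith
      · rw [← h0]; positivity
    · positivity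
  have h1 := sin_sq_add_cos_sq α
  have h2 := sin_sq_add_cos_sq β
  let g₁ : SL(2, ℝ) := ⟨!![cos α, -sin α; sin α, cos α], by
    rw [Matrix.det_fin_two_of]; linear_combination h1⟩
  let g₂ : SL(2, ℝ) := ⟨!![cos β, -(k * sin β); l * sin β, cos β], by
    rw [Matrix.det_fin_two_of]; linear_combination h2 + sin β ^ 2 * hkl⟩
  let g₃ : SL(2, ℝ) := -(g₁ * g₂)⁻¹
  refine isNontriviallyTwisted_of_mul_eq_neg_one (g₁ := g₁) (g₂ := g₂) (g₃ := g₃) ha hb hc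
    ⟨hsα, ?_⟩ ⟨mul_pos hl hsβ, ?_⟩ ⟨?_, ?_⟩ ?_ h.ne
  · simp [g₁]; ring
  · simp [g₂]; ring
  · rw [Matrix.SpecialLinearGroup.coe_neg, Matrix.neg_apply, SL2_inv_one_zero, SL2_mul_apply]
    simp [g₁, g₂]
    linarith
  · rw [Matrix.SpecialLinearGroup.coe_neg, Matrix.neg_apply, Matrix.neg_apply, ← neg_add,
      SL2_inv_trace, SL2_mul_apply, SL2_mul_apply]
    simp [g₁, g₂]
    linear_combination (sin α * sin β) * hkl' + 2 * hus
  · simp [g₃]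

theorem isNontriviallyTwisted_two_two {a b : ℕ} (ha : 2 ≤ a) (hb : 3 ≤ b) :
    IsNontriviallyTwisted [2, 2, a, b] := by
  have hle : ∀ n : ℕ, 2 ≤ n → π / n ≤ π / 2 := fun n hn =>
    div_le_div_of_nonneg_left pi_pos.le two_pos (by exact_mod_cast hn)
  have hcos : ∀ n : ℕ, 2 ≤ n → 0 ≤ cos (π / n) := fun n hn =>
    cos_nonneg_of_mem_Icc ⟨by linarith [(pi_div_mem_Ioo hn).1, pi_pos], hle n hn⟩
  have hca := hcos a ha
  have hcb := hcos b (by omega)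
  set x := cos (π / a)
  set y := cos (π / b)
  set s := (4 * y + 2 * x) / 3 with hs
  have hs0 : 0 ≤ s := by positivity
  let g₁ : SL(2, ℝ) := ⟨!![0, -1; 1, 0], by rw [Matrix.det_fin_two_of]; norm_num⟩
  let g₂ : SL(2, ℝ) := ⟨!![0, -2; 1 / 2, 0], by rw [Matrix.det_fin_two_of]; norm_num⟩
  let g₃ : SL(2, ℝ) := ⟨!![2 * x + s, -(1 + (2 * x + s) * s); 1, -s], by
    rw [Matrix.det_fin_two_of]; ring⟩
  let g₄ : SL(2, ℝ) := (g₁ * g₂ * g₃)⁻¹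
  refine isNontriviallyTwisted_of_mul_eq_one (g₁ := g₁) (g₂ := g₂) (g₃ := g₃) (g₄ := g₄)
    le_rfl le_rfl ha (by omega) ⟨?_, ?_⟩ ⟨?_, ?_⟩ ⟨?_, ?_⟩ ⟨?_, ?_⟩ (by simp [g₄]) ?_
  · simp [g₁]
  · simp [g₁]
  · simp [g₂]
  · simp [g₂]
  · simp [g₃]
  · simp [g₃, x]
  · rw [SL2_inv_one_zero]
    simp only [SL2_mul_apply]
    simp [g₁, g₂, g₃]
  · rw [SL2_inv_trace]
    simp only [SL2_mul_apply]
    simp [g₁, g₂, g₃]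
    linarith
  · have h2 : π / b ≤ π / 3 :=
      div_le_div_of_nonneg_left pi_pos.le three_pos (by exact_mod_cast hb)
    have := hle a ha
    push_cast
    intro h
    linarith [pi_pos]

end Hyperbolic

theorem isNontriviallyTwisted_of_not_spherical {a b c : ℕ} (ha : 2 ≤ a) (hab : a ≤ b)
    (hbc : b ≤ c) (h₂ : ¬ (a = 2 ∧ b = 2)) (h₃ : ¬ (a = 2 ∧ b = 3 ∧ c ≤ 5)) :
    IsNontriviallyTwisted [a, b, c] := by
  have hle : ∀ k n : ℕ, 0 < k → k ≤ n → Real.pi / n ≤ Real.pi / k := fun k n hk hkn =>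
    div_le_div_of_nonneg_left Real.pi_pos.le (by exact_mod_cast hk) (by exact_mod_cast hkn)
  have hyp : ∀ k l n : ℕ, 0 < k → 0 < l → 0 < n → k ≤ a → l ≤ b → n ≤ c →
      (1 / k + 1 / l + 1 / n : ℝ) < 1 → IsNontriviallyTwisted [a, b, c] := by
    intro k l n hk hl hn hka hlb hnc h
    refine isNontriviallyTwisted_of_hyperbolic ha (by omega) (by omega) ?_
    have := mul_lt_mul_of_pos_left h Real.pi_pos
    rw [mul_add, mul_add, mul_one_div, mul_one_div, mul_one_div, mul_one] at this
    linarith [hle k a hk hka, hle l b hl hlb, hle n c hn hnc]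
  by_cases ha3 : 3 ≤ a
  · by_cases hc4 : 4 ≤ c
    · exact hyp 3 3 4 (by omega) (by omega) (by omega) ha3 (by omega) hc4 (by norm_num)
    · obtain ⟨rfl, rfl, rfl⟩ : a = 3 ∧ b = 3 ∧ c = 3 := by omega
      exact isNontriviallyTwisted_three_three_three
  · obtain rfl : a = 2 := by omega
    by_cases hb4 : 4 ≤ b
    · by_cases hc5 : 5 ≤ c
      · exact hyp 2 4 5 (by omega) (by omega) (by omega) le_rfl hb4 hc5 (by norm_num)
      · obtain ⟨rfl, rfl⟩ : b = 4 ∧ c = 4 := by omega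
        exact isNontriviallyTwisted_two_four_four
    · obtain rfl : b = 3 := by omega
      by_cases hc7 : 7 ≤ c
      · exact hyp 2 3 7 (by omega) (by omega) (by omega) le_rfl le_rfl hc7 (by norm_num)
      · obtain rfl : c = 6 := by omega
        exact isNontriviallyTwisted_two_three_six

theorem isNontriviallyTwisted_of_four {a b c d : ℕ} (ha : 2 ≤ a) (hab : a ≤ b) (hbc : b ≤ c)
    (hcd : c ≤ d) : IsNontriviallyTwisted [a, b, c, d] := by
  by_cases hb : b = 2
  · obtain rfl : a = 2 := by omega
    subst hb
    by_cases hd : d = 2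
    · obtain rfl : c = 2 := by omega
      subst hd
      exact isNontriviallyTwisted_two_two_two_two
    · exact isNontriviallyTwisted_two_two hbc (by omega)
  · exact (isNontriviallyTwisted_of_not_spherical (a := b) (b := c) (c := d) (by omega) hbc hcd
      (by omega) (by omega)).of_subperm (List.sublist_cons_self _ _).subperm

/-- **Rim Theorem, infinite order.** For integers `m ≥ 2`, `r ≥ 3` and `bᵢ > dᵢ ≥ 1` with
`gcd(bᵢ, dᵢ) = 1`, the central element `γ` has infinite order in `Γ(m; b₁,…,b_r; d₁,…,d_r)`
unless (necessarily with `r = 3`), after a permutation of the indices, either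
`(b₁,b₂,b₃) = (2,2,n)` (`n ≥ 2`) with `(d₁,d₂,d₃) = (1,1,t)`, or `(b₁,b₂,b₃) = (2,3,n)`
(`3 ≤ n ≤ 5`) with `(d₁,d₂,d₃) = (1,c,t)`, `c ∈ {1,2}` (the constraints `1 ≤ t ≤ n−1`
being automatic from `1 ≤ dᵢ < bᵢ`). -/
theorem rim_gamma_infinite_order (m r : ℕ) (hm : 2 ≤ m) (hr : 3 ≤ r)
    (b d : Fin r → ℕ) (hd : ∀ i, 1 ≤ d i) (hbd : ∀ i, d i < b i)
    (hgcd : ∀ i, Nat.gcd (b i) (d i) = 1)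
    (hexc : ¬ ∃ σ : Fin 3 ≃ Fin r,
        (b (σ 0) = 2 ∧ b (σ 1) = 2 ∧ 2 ≤ b (σ 2) ∧ d (σ 0) = 1 ∧ d (σ 1) = 1) ∨
        (b (σ 0) = 2 ∧ b (σ 1) = 3 ∧ 3 ≤ b (σ 2) ∧ b (σ 2) ≤ 5 ∧ d (σ 0) = 1 ∧
          (d (σ 1) = 1 ∨ d (σ 1) = 2))) :
    ¬ IsOfFinOrder (combGamma m b d) := by
  refine IsNontriviallyTwisted.not_isOfFinOrder_combGamma
    (fun i => (hd i).trans_lt (hbd i) |>.le) hgcd ?_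
  have hb : ∀ i, 2 ≤ b i := fun i => by have := hd i; have := hbd i; omega
  set σ := Tuple.sort b
  have hmono : Monotone (b ∘ σ) := Tuple.monotone_sort b
  have hle : ∀ i j, i ≤ j → b (σ i) ≤ b (σ j) := fun i j hij => hmono hij
  refine IsNontriviallyTwisted.of_subperm (L := List.ofFn (b ∘ σ))
    (Equiv.Perm.ofFn_comp_perm σ b).subperm ?_
  obtain rfl | hr4 := hr.eq_or_lt
  · have h01 := hle 0 1 (by decide)
    have h12 := hle 1 2 (by decide)
    have hsph := not_exists.1 hexc σ
    have hd2 : ∀ i, b i = 2 → d i = 1 := fun i hi => by have := hd i; have := hbd i; omega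
    have hd3 : ∀ i, b i = 3 → d i = 1 ∨ d i = 2 := fun i hi => by
      have := hd i; have := hbd i; omega
    have := isNontriviallyTwisted_of_not_spherical (hb (σ 0)) h01 h12
      (fun h => hsph (Or.inl ⟨h.1, h.2, hb _, hd2 _ h.1, hd2 _ h.2⟩))
      (fun h => hsph (Or.inr ⟨h.1, h.2.1, by omega, h.2.2, hd2 _ h.1, hd3 _ h.2.1⟩))
    simpa [List.ofFn_succ] using this
  · obtain ⟨n, rfl⟩ : ∃ n, r = n + 1 + 1 + 1 + 1 := ⟨r - 4, by omega⟩
    refine IsNontriviallyTwisted.of_subperm (L := [_, _, _, _]) ?_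
      (isNontriviallyTwisted_of_four (hb (σ 0)) (hle 0 1 (Fin.zero_le _))
        (hle 1 (Fin.succ 1) ?_) (hle (Fin.succ 1) (Fin.succ (Fin.succ 1)) ?_))
    · simp only [List.ofFn_succ, Function.comp_apply]
      exact (List.prefix_append [_, _, _, _] _).sublist.subperm
    · exact Fin.succ_le_succ_iff.2 (Fin.zero_le _)
    · exact Fin.succ_le_succ_iff.2 (Fin.succ_le_succ_iff.2 (Fin.zero_le _))
end

section
/- Fix integers m ≥ 2, r ≥ 3, and bᵢ, dᵢ with bᵢ > dᵢ ≥ 1 for i = 1, …, r, and set cᵢ = gcd(bᵢ, dᵢ). Then the order of the central element γ in Γ(m; b₁,…,b_r; d₁,…,d_r) is equal to the order of the central element γ in Γ(m; b₁/c₁,…,b_r/c_r; d₁/c₁,…,d_r/c_r); in particular γ has finite order in the first group if and only if it has finite order in the second. -/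
/-- Every element of a group has an `n`-th root in some larger group. -/
theorem exists_injective_hom_pow_eq {H : Type} [Group H] (h : H) {n : ℕ} (hn : 0 < n) :
    ∃ (K : Type) (_ : Group K) (f : H →* K), Function.Injective f ∧ ∃ k : K, k ^ n = f h := by
  let f : H →* Equiv.Perm (H × Fin n) :=
    { toFun := fun g => (Equiv.mulLeft g).prodCongr (Equiv.refl _)
      map_one' := by ext x <;> simp
      map_mul' := fun g g' => by ext x <;> simp [mul_assoc] }
  let s : H × Fin n → H × Fin n := fun x =>
    (h ^ ((x.2 + 1) / n) * x.1, ⟨(x.2 + 1) % n, Nat.mod_lt _ hn⟩)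
  have s_iterate (j : ℕ) (x : H × Fin n) :
      s^[j] x = (h ^ ((x.2 + j) / n) * x.1, ⟨(x.2 + j) % n, Nat.mod_lt _ hn⟩) := by
    induction j with
    | zero => ext <;> simp [Nat.div_eq_of_lt x.2.2, Nat.mod_eq_of_lt x.2.2]
    | succ j ih =>
      have hdiv : ((x.2 + j) % n + 1) / n + (x.2 + j) / n = (x.2 + (j + 1)) / n := by
        rw [← Nat.add_mul_div_left _ _ hn, ← add_assoc]
        congr 1
        have := Nat.mod_add_div (x.2 + j) n
        omega
      rw [Function.iterate_succ_apply', ih]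
      ext
      · simp only [s, ← mul_assoc, ← pow_add, hdiv]
      · simp [s, add_assoc]
  have s_iterate_n : s^[n] = f h := by
    funext x
    rw [s_iterate, Nat.add_div_right _ hn, Nat.div_eq_of_lt x.2.2]
    ext <;> simp [f, Nat.mod_eq_of_lt x.2.2]
  have hs : Function.Bijective s := by
    obtain ⟨j, rfl⟩ := Nat.exists_eq_succ_of_ne_zero hn.ne'
    have hbij := (f h).bijective
    rw [← s_iterate_n] at hbij
    constructor
    · have := hbij.injective
      rw [Function.iterate_succ] at this
      exact this.of_comp
    · have := hbij.surjective
      rw [Function.iterate_succ'] at this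
      exact this.of_comp
  refine ⟨Equiv.Perm (H × Fin n), inferInstance, f, fun g g' hg => ?_,
    Equiv.ofBijective s hs, ?_⟩
  · simpa [f] using congrArg Prod.fst (DFunLike.congr_fun hg ((1 : H), (⟨0, hn⟩ : Fin n)))
  · apply DFunLike.coe_injective
    rw [Equiv.Perm.coe_pow]
    exact s_iterate_n

/-- Roots of a family of elements of a group exist simultaneously in some larger
group. -/
theorem exists_injective_hom_forall_pow_eq {H ι : Type} [Group H] (h : ι → H)
    {n : ι → ℕ} (hn : ∀ i, 0 < n i) :
    ∃ (K : Type) (_ : Group K) (f : H →* K), Function.Injective f ∧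
      ∃ k : ι → K, ∀ i, k i ^ n i = f (h i) := by
  choose K hK f hf k hk using fun i => exists_injective_hom_pow_eq (h i) (hn i)
  refine ⟨Monoid.PushoutI f, inferInstance, Monoid.PushoutI.base f, ?_,
    fun i => Monoid.PushoutI.of i (k i), fun i => ?_⟩
  · exact Monoid.PushoutI.base_injective hf
  · rw [← map_pow, hk, Monoid.PushoutI.of_apply_eq_base]

section CombGroup

variable {m r : ℕ} {b d : Fin r → ℕ}

/-- The generator `βᵢ` of `Γ(m; b₁,…,b_r; d₁,…,d_r)`. -/
def combBeta (m : ℕ) {r : ℕ} (b d : Fin r → ℕ) (i : Fin r) : CombGroup m b d :=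
  PresentedGroup.of (some i)

theorem combBeta_pow (i : Fin r) : combBeta m b d i ^ b i = combGamma m b d := by
  rw [← mul_inv_eq_one]
  exact PresentedGroup.one_of_mem (rels := combRelators m b d) (Or.inl ⟨i, rfl⟩)

theorem prod_combBeta_pow :
    (List.ofFn fun i => combBeta m b d i ^ d i).prod = combGamma m b d ^ m := by
  rw [← mul_inv_eq_one]
  have h := PresentedGroup.one_of_mem (rels := combRelators m b d) (Or.inr rfl)
  simp only [map_mul, map_inv, map_pow, map_list_prod, List.map_ofFn, Function.comp_def] at h
  exact h

theorem exists_combGroup_hom {K : Type} [Group K] (g : K) (k : Fin r → K)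
    (hk : ∀ i, k i ^ b i = g) (hprod : (List.ofFn fun i => k i ^ d i).prod = g ^ m) :
    ∃ f : CombGroup m b d →* K, f (combGamma m b d) = g := by
  have hrel : ∀ w ∈ combRelators m b d,
      FreeGroup.lift (fun o : Option (Fin r) => o.elim g k) w = 1 := by
    rintro w (⟨i, rfl⟩ | rfl)
    · simp [hk]
    · simp [map_list_prod, List.map_ofFn, Function.comp_def, hprod]
  exact ⟨PresentedGroup.toGroup hrel, PresentedGroup.toGroup.of hrel⟩

/-- Multiplying each pair `bᵢ, dᵢ` by a common positive factor does not change the order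
of `γ`. -/
theorem orderOf_combGamma_mul {c : Fin r → ℕ} (hc : ∀ i, 0 < c i) :
    orderOf (combGamma m (fun i => c i * b i) (fun i => c i * d i)) =
      orderOf (combGamma m b d) := by
  apply Nat.dvd_antisymm
  · obtain ⟨f, hf⟩ := exists_combGroup_hom (m := m) (b := b) (d := d)
      (combGamma m (fun i => c i * b i) (fun i => c i * d i))
      (fun i => combBeta m _ _ i ^ c i)
      (fun i => by rw [← pow_mul]; exact combBeta_pow i)
      (by simp only [← pow_mul]; exact prod_combBeta_pow)
    rw [← hf]
    exact orderOf_map_dvd f _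
  · obtain ⟨K, _, f, hf, k, hk⟩ := exists_injective_hom_forall_pow_eq (combBeta m b d) hc
    obtain ⟨g, hg⟩ := exists_combGroup_hom (m := m) (b := fun i => c i * b i)
      (d := fun i => c i * d i) (f (combGamma m b d)) k
      (fun i => by rw [pow_mul, hk, ← map_pow, combBeta_pow])
      (by
        simp only [pow_mul, hk]
        rw [← map_pow, ← prod_combBeta_pow]
        simp [map_list_prod, List.map_ofFn, Function.comp_def])
    rw [← orderOf_injective f hf, ← hg]
    exact orderOf_map_dvd g _

end CombGroup

/-- **Step I of the Rim Theorem.** For `m ≥ 2`, `r ≥ 3`, `bᵢ > dᵢ ≥ 1` and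
`cᵢ = gcd(bᵢ, dᵢ)`, the order of `γ` in `Γ(m; b₁,…,b_r; d₁,…,d_r)` equals the order of `γ`
in `Γ(m; b₁/c₁,…,b_r/c_r; d₁/c₁,…,d_r/c_r)` (orders as natural numbers, `0` meaning
infinite order); in particular `γ` has finite order in the one iff it does in the other. -/
theorem rim_gamma_order_gcd_reduction (m r : ℕ) (hm : 2 ≤ m) (hr : 3 ≤ r)
    (b d : Fin r → ℕ) (hd : ∀ i, 1 ≤ d i) (hbd : ∀ i, d i < b i) :
    orderOf (combGamma m b d) =
      orderOf (combGamma m (fun i => b i / Nat.gcd (b i) (d i))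
        (fun i => d i / Nat.gcd (b i) (d i))) ∧
    (IsOfFinOrder (combGamma m b d) ↔
      IsOfFinOrder (combGamma m (fun i => b i / Nat.gcd (b i) (d i))
        (fun i => d i / Nat.gcd (b i) (d i)))) := by
  have horder := orderOf_combGamma_mul (m := m) (b := fun i => b i / Nat.gcd (b i) (d i))
    (d := fun i => d i / Nat.gcd (b i) (d i)) (c := fun i => Nat.gcd (b i) (d i))
    (fun i => Nat.gcd_pos_of_pos_right _ (hd i))
  have hb : (fun i => Nat.gcd (b i) (d i) * (b i / Nat.gcd (b i) (d i))) = b :=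
    funext fun i => Nat.mul_div_cancel' (Nat.gcd_dvd_left _ _)
  have hd' : (fun i => Nat.gcd (b i) (d i) * (d i / Nat.gcd (b i) (d i))) = d :=
    funext fun i => Nat.mul_div_cancel' (Nat.gcd_dvd_right _ _)
  rw [hb, hd'] at horder
  exact ⟨horder, by rw [← orderOf_pos_iff, ← orderOf_pos_iff, horder]⟩
end

section
/- Fix integers m ≥ 2, r ≥ 3, and bᵢ, dᵢ with bᵢ > dᵢ ≥ 1 and gcd(bᵢ, dᵢ) = 1 for i = 1, …, r, and let Γ = Γ(m; b₁,…,b_r; d₁,…,d_r). Then the quotient of Γ by the normal closure of the central element γ is isomorphic to the polygonal group T(b₁,…,b_r), via an isomorphism carrying the class of βᵢ^{dᵢ} to δᵢ for each i. -/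
/-- Relators of the polygonal group `T(b₁,…,b_r)`: generators `δ₁,…,δ_r` and relations
`δ₁^{b₁} = ⋯ = δ_r^{b_r} = δ₁δ₂⋯δ_r = 1`. -/
def polygonalRelators {r : ℕ} (b : Fin r → ℕ) : Set (FreeGroup (Fin r)) :=
  (Set.range fun i : Fin r => FreeGroup.of i ^ (b i)) ∪
  {(List.ofFn fun i : Fin r => FreeGroup.of i).prod}

/-- The defining relation `βᵢ^{bᵢ} = γ` in `Γ(m; b; d)`. -/
theorem combGroup_beta_pow (m : ℕ) {r : ℕ} (b d : Fin r → ℕ) (i : Fin r) :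
    (PresentedGroup.of (some i) : CombGroup m b d) ^ b i = combGamma m b d := by
  have h := PresentedGroup.one_of_mem (rels := combRelators m b d) (Or.inl ⟨i, rfl⟩)
  rwa [map_mul, map_inv, map_pow, mul_inv_eq_one] at h

/-- The defining relation `β₁^{d₁}⋯β_r^{d_r} = γ^m` in `Γ(m; b; d)`. -/
theorem combGroup_prod_beta_pow (m : ℕ) {r : ℕ} (b d : Fin r → ℕ) :
    (List.ofFn fun i => (PresentedGroup.of (some i) : CombGroup m b d) ^ d i).prod =
      combGamma m b d ^ m := by
  have h := PresentedGroup.one_of_mem (rels := combRelators m b d) (Or.inr rfl)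
  rw [map_mul, map_inv, map_pow, mul_inv_eq_one, map_list_prod, List.map_ofFn] at h
  simp only [Function.comp_def, map_pow] at h
  exact h

theorem polygonal_of_pow {r : ℕ} (b : Fin r → ℕ) (i : Fin r) :
    (PresentedGroup.of i : PresentedGroup (polygonalRelators b)) ^ b i = 1 := by
  have h := PresentedGroup.one_of_mem (rels := polygonalRelators b) (Or.inl ⟨i, rfl⟩)
  rwa [map_pow] at h

theorem polygonal_prod_of {r : ℕ} (b : Fin r → ℕ) :
    (List.ofFn fun i => (PresentedGroup.of i : PresentedGroup (polygonalRelators b))).prod = 1 := by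
  have h := PresentedGroup.one_of_mem (rels := polygonalRelators b) (Or.inr rfl)
  rwa [map_list_prod, List.map_ofFn] at h

theorem pow_eq_self_of_modEq_one {G : Type*} [Monoid G] {x : G} {n k : ℕ} (hx : x ^ n = 1)
    (hk : k % n = 1) : x ^ k = x := by
  rw [pow_eq_pow_mod k hx, hk, pow_one]

/-- The map `Γ(m; b; d) → T(b)` sending `γ` to `1` and `βᵢ` to `δᵢ^{eᵢ}`, where `eᵢ` inverts `dᵢ`
modulo `bᵢ`. -/
def combToPolygonal (m : ℕ) {r : ℕ} (b d e : Fin r → ℕ) (he : ∀ i, d i * e i % b i = 1) :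
    CombGroup m b d →* PresentedGroup (polygonalRelators b) :=
  PresentedGroup.toGroup
    (f := fun o => o.elim 1 fun i => PresentedGroup.of i ^ e i) <| by
  rintro _ (⟨i, rfl⟩ | rfl)
  · simp only [map_mul, map_inv, map_pow, FreeGroup.lift_apply_of, Option.elim]
    rw [pow_right_comm, polygonal_of_pow, one_pow, inv_one, mul_one]
  · simp only [map_mul, map_inv, map_pow, map_list_prod, List.map_ofFn, Function.comp_def,
      FreeGroup.lift_apply_of, Option.elim, one_pow, inv_one, mul_one]
    simp only [← pow_mul', pow_eq_self_of_modEq_one (polygonal_of_pow b _) (he _)]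
    exact polygonal_prod_of b

/-- The map `Γ(m; b; d)/⟨⟨γ⟩⟩ → T(b)` induced by `combToPolygonal`. -/
def combQuotientToPolygonal (m : ℕ) {r : ℕ} (b d e : Fin r → ℕ)
    (he : ∀ i, d i * e i % b i = 1) :
    (CombGroup m b d ⧸ Subgroup.normalClosure {combGamma m b d}) →*
      PresentedGroup (polygonalRelators b) :=
  QuotientGroup.lift _ (combToPolygonal m b d e he) <|
    Subgroup.normalClosure_le_normal <| Set.singleton_subset_iff.2 <|
      PresentedGroup.toGroup.of _

theorem combQuotientToPolygonal_beta (m : ℕ) {r : ℕ} (b d e : Fin r → ℕ)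
    (he : ∀ i, d i * e i % b i = 1) (i : Fin r) :
    combQuotientToPolygonal m b d e he
      (QuotientGroup.mk' _ (PresentedGroup.of (some i))) = PresentedGroup.of i ^ e i := by
  rw [combQuotientToPolygonal, QuotientGroup.mk'_apply, QuotientGroup.lift_mk,
    combToPolygonal, PresentedGroup.toGroup.of, Option.elim]

theorem mk_combGamma (m : ℕ) {r : ℕ} (b d : Fin r → ℕ) :
    QuotientGroup.mk' (Subgroup.normalClosure {combGamma m b d}) (combGamma m b d) = 1 :=
  (QuotientGroup.eq_one_iff _).2 (Subgroup.subset_normalClosure rfl)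

theorem mk_beta_pow (m : ℕ) {r : ℕ} (b d : Fin r → ℕ) (i : Fin r) :
    QuotientGroup.mk' (Subgroup.normalClosure {combGamma m b d}) (PresentedGroup.of (some i)) ^ b i
      = 1 := by
  rw [← map_pow, combGroup_beta_pow, mk_combGamma]

/-- The map `T(b) → Γ(m; b; d)/⟨⟨γ⟩⟩` sending `δᵢ` to the class of `βᵢ^{dᵢ}`. -/
def polygonalToCombQuotient (m : ℕ) {r : ℕ} (b d : Fin r → ℕ) :
    PresentedGroup (polygonalRelators b) →*
      CombGroup m b d ⧸ Subgroup.normalClosure {combGamma m b d} :=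
  PresentedGroup.toGroup
    (f := fun i => QuotientGroup.mk' _ (PresentedGroup.of (some i) ^ d i)) <| by
  rintro _ (⟨i, rfl⟩ | rfl)
  · simp only [map_pow, FreeGroup.lift_apply_of]
    rw [pow_right_comm, mk_beta_pow, one_pow]
  · rw [map_list_prod, List.map_ofFn]
    simp only [Function.comp_def, FreeGroup.lift_apply_of]
    have h := congrArg (QuotientGroup.mk' (Subgroup.normalClosure {combGamma m b d}))
      (combGroup_prod_beta_pow m b d)
    rwa [map_list_prod, List.map_ofFn, map_pow, mk_combGamma, one_pow] at h

theorem polygonalToCombQuotient_of (m : ℕ) {r : ℕ} (b d : Fin r → ℕ) (i : Fin r) :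
    polygonalToCombQuotient m b d (PresentedGroup.of i) =
      QuotientGroup.mk' _ (PresentedGroup.of (some i)) ^ d i :=
  (PresentedGroup.toGroup.of _).trans (map_pow _ _ _)

/-- **Step II of the Rim Theorem.** For `m ≥ 2`, `r ≥ 3`, `bᵢ > dᵢ ≥ 1` with
`gcd(bᵢ, dᵢ) = 1`, the quotient of `Γ(m; b₁,…,b_r; d₁,…,d_r)` by the normal closure of the
central element `γ` is isomorphic to the polygonal group `T(b₁,…,b_r)`, via an isomorphism
carrying the class of `βᵢ^{dᵢ}` to `δᵢ` for each `i`. -/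
theorem rim_quotient_is_polygonal (m r : ℕ) (hm : 2 ≤ m) (hr : 3 ≤ r)
    (b d : Fin r → ℕ) (hd : ∀ i, 1 ≤ d i) (hbd : ∀ i, d i < b i)
    (hgcd : ∀ i, Nat.gcd (b i) (d i) = 1) :
    ∃ φ : (CombGroup m b d ⧸ Subgroup.normalClosure {combGamma m b d}) ≃*
        PresentedGroup (polygonalRelators b),
      ∀ i : Fin r,
        φ (QuotientGroup.mk' (Subgroup.normalClosure {combGamma m b d})
            ((PresentedGroup.of (some i) : CombGroup m b d) ^ (d i))) =
          PresentedGroup.of i := by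
  have hinv : ∀ i, ∃ e, d i * e % b i = 1 := fun i =>
    (Nat.exists_mul_mod_eq_one_of_coprime (Nat.Coprime.symm (hgcd i))
      ((hd i).trans_lt (hbd i))).imp fun _ h => h.2
  choose e he using hinv
  have hβ := combQuotientToPolygonal_beta m b d e he
  have hδ := polygonalToCombQuotient_of m b d
  refine ⟨MonoidHom.toMulEquiv (combQuotientToPolygonal m b d e he)
    (polygonalToCombQuotient m b d) ?_ ?_, fun i => ?_⟩
  · refine QuotientGroup.monoidHom_ext _ (PresentedGroup.ext fun o => ?_)
    simp only [MonoidHom.comp_apply, MonoidHom.id_apply]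
    cases o with
    | none =>
      change polygonalToCombQuotient m b d (combQuotientToPolygonal m b d e he
        (QuotientGroup.mk' _ (combGamma m b d))) = QuotientGroup.mk' _ (combGamma m b d)
      rw [mk_combGamma, map_one, map_one]
    | some i =>
      rw [hβ, map_pow, hδ, ← pow_mul, pow_eq_self_of_modEq_one (mk_beta_pow m b d i) (he i)]
  · refine PresentedGroup.ext fun i => ?_
    simp only [MonoidHom.comp_apply, MonoidHom.id_apply]
    rw [hδ, map_pow, hβ, ← pow_mul', pow_eq_self_of_modEq_one (polygonal_of_pow b i) (he i)]
  · rw [MonoidHom.toMulEquiv_apply, map_pow, map_pow, hβ, ← pow_mul',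
      pow_eq_self_of_modEq_one (polygonal_of_pow b i) (he i)]
end

section
/- Let n ≥ 2 and p ≥ 1 be integers with gcd(p, n) = 1, and let Γ be the group with generators a, b and defining relations a² = bⁿ and a² = a bᵖ a bᵖ (the quotient of the free group on a, b by the normal closure of the corresponding relators). Then the relations imply a^{4p} = 1 and b^{2pn} = 1 in Γ, and Γ is a finite group of order at most 4pn. -/
/-- Relators of the group `Γ = ⟨a, b | a² = bⁿ, a² = a bᵖ a bᵖ⟩`, with `a` the generator
`true` and `b` the generator `false`. -/
def caseVaRelators (n p : ℕ) : Set (FreeGroup Bool) :=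
  {FreeGroup.of true ^ 2 * (FreeGroup.of false ^ n)⁻¹,
   FreeGroup.of true ^ 2 *
     (FreeGroup.of true * FreeGroup.of false ^ p *
      FreeGroup.of true * FreeGroup.of false ^ p)⁻¹}

section

variable {G : Type*} [Group G] {a b : G} {n p : ℕ}

/-- The relation `a² = a bᵖ a bᵖ` says that `a` inverts `bᵖ`. -/
theorem semiconjBy_pow_inv_of_sq_eq (h₂ : a ^ 2 = a * b ^ p * a * b ^ p) :
    SemiconjBy a (b ^ p) (b ^ p)⁻¹ := by
  have h : a = b ^ p * a * b ^ p := by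
    apply mul_left_cancel (a := a)
    simpa [pow_two, mul_assoc] using h₂
  rw [SemiconjBy, eq_inv_mul_iff_mul_eq, ← mul_assoc]
  exact h.symm

theorem semiconjBy_pow_of_sq_eq (h₁ : a ^ 2 = b ^ n) : SemiconjBy a (b ^ n) (b ^ n) :=
  h₁ ▸ (Commute.refl a).pow_right 2

theorem pow_two_mul_mul_eq_one (h₁ : a ^ 2 = b ^ n) (h₂ : a ^ 2 = a * b ^ p * a * b ^ p) :
    b ^ (2 * p * n) = 1 := by
  have h := ((semiconjBy_pow_inv_of_sq_eq h₂).pow_right n).eq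
  have h' := ((semiconjBy_pow_of_sq_eq h₁).pow_right p).eq
  rw [← pow_mul, inv_pow, ← pow_mul] at h
  rw [← pow_mul, mul_comm n p, h] at h'
  have h'' := mul_right_cancel h'
  rw [mul_assoc, two_mul, pow_add]
  nth_rewrite 1 [← h'']
  exact inv_mul_cancel _

/-- Conjugation by `a` sends `b` to a power of `b`. -/
theorem exists_mul_eq_mul_zpow (hgcd : Nat.gcd p n = 1) (h₁ : a ^ 2 = b ^ n)
    (h₂ : a ^ 2 = a * b ^ p * a * b ^ p) : ∃ c : ℤ, b * a = a * b ^ c := by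
  obtain ⟨u, v, huv⟩ := (Nat.isCoprime_iff_coprime (m := p) (n := n)).2 hgcd
  have h := ((semiconjBy_pow_inv_of_sq_eq h₂).inv_right.zpow_right u).mul_right
    ((semiconjBy_pow_of_sq_eq h₁).zpow_right v)
  refine ⟨-(p * u) + n * v, ?_⟩
  have hb : (b ^ p)⁻¹⁻¹ ^ u * (b ^ n) ^ v = b := by
    rw [inv_inv, ← zpow_natCast, ← zpow_natCast, ← zpow_mul, ← zpow_mul, ← zpow_add,
      mul_comm (p : ℤ), mul_comm (n : ℤ), huv, zpow_one]
  rw [hb] at h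
  rw [← h.eq, inv_zpow, ← zpow_natCast, ← zpow_natCast, ← zpow_mul, ← zpow_mul, zpow_add,
    zpow_neg]

theorem exists_eq_zpow_or_eq_mul_zpow (hgen : Subgroup.closure {a, b} = ⊤)
    (hgcd : Nat.gcd p n = 1) (h₁ : a ^ 2 = b ^ n) (h₂ : a ^ 2 = a * b ^ p * a * b ^ p) (x : G) :
    ∃ k : ℤ, x = b ^ k ∨ x = a * b ^ k := by
  obtain ⟨c, hc⟩ := exists_mul_eq_mul_zpow hgcd h₁ h₂
  have hsc : SemiconjBy a (b ^ c) b := hc.symm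
  have hx : x ∈ Subgroup.closure {a, b} := hgen ▸ Subgroup.mem_top x
  have h₁' : a * a = b ^ (n : ℤ) := by rw [← pow_two, h₁, zpow_natCast]
  have hinv : a⁻¹ = a * b ^ (-(n : ℤ)) := by
    rw [zpow_neg, ← h₁', mul_inv_rev, mul_inv_cancel_left]
  induction hx using Subgroup.closure_induction_left with
  | one => exact ⟨0, Or.inl (zpow_zero b).symm⟩
  | mul_left s hs y _ ih =>
    obtain ⟨k, rfl | rfl⟩ := ih <;> rcases hs with rfl | rfl
    · exact ⟨k, Or.inr rfl⟩
    · exact ⟨1 + k, Or.inl (zpow_one_add _ _).symm⟩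
    · exact ⟨n + k, Or.inl (by rw [← mul_assoc, h₁', zpow_add])⟩
    · exact ⟨c + k, Or.inr (by rw [← mul_assoc, hc, mul_assoc, zpow_add])⟩
  | inv_mul_cancel s hs y _ ih =>
    obtain ⟨k, rfl | rfl⟩ := ih <;> rcases hs with rfl | rfl
    · exact ⟨-n + k, Or.inr (by rw [hinv, mul_assoc, zpow_add])⟩
    · exact ⟨-1 + k, Or.inl (by rw [zpow_add, zpow_neg_one])⟩
    · exact ⟨k, Or.inl (inv_mul_cancel_left _ _)⟩
    · exact ⟨-c + k, Or.inr (by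
        rw [← mul_assoc, ← hsc.inv_right.eq, mul_assoc, zpow_add, zpow_neg])⟩

theorem exists_surjective_bool_prod_fin (hn : 0 < n) (hp : 0 < p)
    (hgen : Subgroup.closure {a, b} = ⊤) (hgcd : Nat.gcd p n = 1) (h₁ : a ^ 2 = b ^ n)
    (h₂ : a ^ 2 = a * b ^ p * a * b ^ p) :
    ∃ f : Bool × Fin (2 * p * n) → G, Function.Surjective f := by
  classical
  have hfin : IsOfFinOrder b :=
    isOfFinOrder_iff_pow_eq_one.2 ⟨2 * p * n, by positivity, pow_two_mul_mul_eq_one h₁ h₂⟩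
  refine ⟨fun z => (if z.1 then a else 1) * b ^ (z.2 : ℕ), fun x => ?_⟩
  have hb (k : ℤ) : ∃ j : Fin (2 * p * n), b ^ (j : ℕ) = b ^ k := by
    obtain ⟨j, hj⟩ := hfin.mem_zpowers_iff_mem_range_orderOf.1 (Subgroup.zpow_mem_zpowers b k) |>
      Finset.mem_image.1
    exact ⟨⟨j, (Finset.mem_range.1 hj.1).trans_le (orderOf_le_of_pow_eq_one (by positivity)
      (pow_two_mul_mul_eq_one h₁ h₂))⟩, hj.2⟩
  obtain ⟨k, hk⟩ := exists_eq_zpow_or_eq_mul_zpow hgen hgcd h₁ h₂ x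
  obtain ⟨j, hj⟩ := hb k
  rcases hk with rfl | rfl
  · exact ⟨(false, j), by simp [hj]⟩
  · exact ⟨(true, j), by simp [hj]⟩

end

theorem closure_caseVa_generators (n p : ℕ) :
    Subgroup.closure {PresentedGroup.of (rels := caseVaRelators n p) true,
      PresentedGroup.of (rels := caseVaRelators n p) false} = ⊤ := by
  rw [← PresentedGroup.closure_range_of (caseVaRelators n p)]
  congr 1
  ext x
  simp [or_comm]

theorem caseVa_sq_eq_pow (n p : ℕ) :
    PresentedGroup.of (rels := caseVaRelators n p) true ^ 2 = PresentedGroup.of false ^ n := by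
  have h := PresentedGroup.one_of_mem (rels := caseVaRelators n p) (Or.inl rfl)
  rw [map_mul, map_inv, mul_inv_eq_one, map_pow, map_pow] at h
  exact h

theorem caseVa_sq_eq_mul (n p : ℕ) :
    PresentedGroup.of (rels := caseVaRelators n p) true ^ 2 =
      PresentedGroup.of true * PresentedGroup.of false ^ p * PresentedGroup.of true *
        PresentedGroup.of false ^ p := by
  have h := PresentedGroup.one_of_mem (rels := caseVaRelators n p) (Or.inr rfl)
  rw [map_mul, map_inv, mul_inv_eq_one] at h
  simp only [map_mul, map_pow] at h
  exact h

/-- **Step Va of the Rim Theorem (finiteness).** Let `n ≥ 2`, `p ≥ 1` with `gcd(p,n) = 1`,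
and let `Γ = ⟨a, b | a² = bⁿ, a² = a bᵖ a bᵖ⟩`. Then `a^{4p} = 1` and `b^{2pn} = 1` in `Γ`,
and `Γ` is a finite group of order at most `4pn`. -/
theorem caseVa_finite (n p : ℕ) (hn : 2 ≤ n) (hp : 1 ≤ p) (hgcd : Nat.gcd p n = 1) :
    (PresentedGroup.of (rels := caseVaRelators n p) true) ^ (4 * p) = 1 ∧
    (PresentedGroup.of (rels := caseVaRelators n p) false) ^ (2 * p * n) = 1 ∧
    Finite (PresentedGroup (caseVaRelators n p)) ∧
    Nat.card (PresentedGroup (caseVaRelators n p)) ≤ 4 * p * n := by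
  have h₁ := caseVa_sq_eq_pow n p
  have h₂ := caseVa_sq_eq_mul n p
  have hb := pow_two_mul_mul_eq_one h₁ h₂
  obtain ⟨f, hf⟩ := exists_surjective_bool_prod_fin (by lia) hp
    (closure_caseVa_generators n p) hgcd h₁ h₂
  refine ⟨?_, hb, Finite.of_surjective f hf, ?_⟩
  · rw [show 4 * p = 2 * (2 * p) by ring, pow_mul, h₁, ← pow_mul, mul_comm n, hb]
  · refine (Nat.card_le_card_of_surjective f hf).trans_eq ?_
    rw [Nat.card_prod, Nat.card_eq_fintype_card, Fintype.card_bool, Nat.card_fin]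
    ring
end
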